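/- For every ε > 0 there is a constant C = C(ε) such that for all x ≥ 2, the number of pairs (d, n) of positive integers with d > x^{1/2}, x < n ≤ 2x, and d² ∣ n²+1, is at most C·x^{7/12+ε}. -/

import Mathlib

lemma divisor_bound (η : ℝ) (hη : 0 < η) : ∃ C : ℝ, 1 ≤ C ∧ ∀ n : ℕ, n ≠ 0 →
    (n.divisors.card : ℝ) ≤ C * (n : ℝ) ^ η := by
  set C0 : ℝ := 1 + 1 / (η * Real.log 2) with hC0
  have hl2 : 0 < Real.log 2 := Real.log_pos (by norm_num)
  have hC0' : 1 ≤ C0 := by rw [hC0]; have : 0 < 1 / (η * Real.log 2) := by positivity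
                           linarith
  set P : ℕ := ⌈(2 : ℝ) ^ (1 / η)⌉₊ with hP
  refine ⟨C0 ^ P, one_le_pow₀ hC0', fun n hn => ?_⟩
  have h1 : (n : ℝ) ^ η = ∏ p ∈ n.primeFactors, ((p : ℝ) ^ η) ^ (n.factorization p) := by
    conv_lhs => rw [← Nat.prod_factorization_pow_eq_self hn]
    rw [Finsupp.prod, Nat.support_factorization]
    push_cast
    rw [← Real.finsetProd_rpow _ _ (fun i _ => by positivity)]
    refine Finset.prod_congr rfl fun p _ => ?_
    rw [← Real.rpow_natCast, ← Real.rpow_natCast, ← Real.rpow_mul (by positivity),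
      ← Real.rpow_mul (by positivity), mul_comm]
  have h2 : ∏ p ∈ n.primeFactors, (if p < P then C0 else 1) ≤ C0 ^ P := by
    rw [Finset.prod_ite, Finset.prod_const, Finset.prod_const_one, mul_one]
    refine pow_le_pow_right₀ hC0' ?_
    calc _ ≤ (Finset.range P).card := Finset.card_le_card (by
            intro p hp; simp at hp ⊢; exact hp.2)
      _ = P := by simp
  rw [Nat.card_divisors hn, h1]
  push_cast
  calc ∏ p ∈ n.primeFactors, ((n.factorization p : ℝ) + 1)
      ≤ ∏ p ∈ n.primeFactors, ((if p < P then C0 else 1) * ((p : ℝ) ^ η) ^ (n.factorization p)) := by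
        refine Finset.prod_le_prod (fun i _ => by positivity) fun p hp => ?_
        have hp2 : 2 ≤ p := (Nat.prime_of_mem_primeFactors hp).two_le
        have hp2' : (2 : ℝ) ≤ p := by exact_mod_cast hp2
        set e := n.factorization p
        split_ifs with h
        · have ha : (2 : ℝ) ^ η ≤ (p : ℝ) ^ η := Real.rpow_le_rpow (by norm_num) hp2' hη.le
          have hb : ((2 : ℝ) ^ η) ^ e ≤ ((p : ℝ) ^ η) ^ e := pow_le_pow_left₀ (by positivity) ha _
          have hc : 1 + e * (η * Real.log 2) ≤ ((2 : ℝ) ^ η) ^ e := by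
            have h3 : 1 + η * Real.log 2 ≤ (2 : ℝ) ^ η := by
              rw [Real.rpow_def_of_pos (by norm_num)]
              have := Real.add_one_le_exp (Real.log 2 * η)
              linarith
            calc 1 + e * (η * Real.log 2) ≤ (1 + η * Real.log 2) ^ e :=
                  one_add_mul_le_pow (by nlinarith [mul_pos hη hl2]) e
              _ ≤ _ := pow_le_pow_left₀ (by positivity) h3 _
          have hd : (e : ℝ) + 1 ≤ C0 * (1 + e * (η * Real.log 2)) := by
            have hz : 0 < η * Real.log 2 := mul_pos hη hl2
            have : C0 * (1 + e * (η * Real.log 2)) = 1 + e + e * (η * Real.log 2) + 1 / (η * Real.log 2) := by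
              rw [hC0]; field_simp; ring
            rw [this]
            have : 0 ≤ (e : ℝ) * (η * Real.log 2) := by positivity
            have : 0 < 1 / (η * Real.log 2) := by positivity
            linarith
          calc (e : ℝ) + 1 ≤ C0 * (1 + e * (η * Real.log 2)) := hd
            _ ≤ C0 * ((p : ℝ) ^ η) ^ e := by
              apply mul_le_mul_of_nonneg_left (hc.trans hb); linarith
        · have ha : (2 : ℝ) ≤ (p : ℝ) ^ η := by
            have h5 : (2 : ℝ) ^ (1 / η) ≤ p := by
              push Not at h
              exact (Nat.le_ceil _).trans (by exact_mod_cast h)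
            calc (2 : ℝ) = ((2 : ℝ) ^ (1 / η)) ^ η := by
                  rw [← Real.rpow_mul (by norm_num)]; field_simp; simp
              _ ≤ _ := Real.rpow_le_rpow (by positivity) h5 hη.le
          have hb : ((2 : ℝ)) ^ e ≤ ((p : ℝ) ^ η) ^ e := pow_le_pow_left₀ (by positivity) ha _
          have hc : (e : ℝ) + 1 ≤ 2 ^ e := by
            have := one_add_mul_le_pow (a := (1 : ℝ)) (by norm_num) e
            norm_num at this; linarith
          linarith
    _ = (∏ p ∈ n.primeFactors, (if p < P then C0 else 1)) *
          ∏ p ∈ n.primeFactors, ((p : ℝ) ^ η) ^ (n.factorization p) := Finset.prod_mul_distrib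
    _ ≤ _ := mul_le_mul_of_nonneg_right h2 (Finset.prod_nonneg fun _ _ => by positivity)


@[ext] structure Qd where
  a : ℤ
  b : ℤ
  u : ℤ
  v : ℤ

lemma gauss_param (d n : ℕ) (h : d ^ 2 ∣ n ^ 2 + 1) :
    ∃ a b u v : ℤ, (a^2-b^2)*v+2*a*b*u = 1 ∧ (a^2-b^2)*u-2*a*b*v = n ∧ (d:ℤ) = a^2+b^2 := by
  have hd0 : d ≠ 0 := by
    rintro rfl
    simp at h
  have hodd : ¬ 2 ∣ d := by
    intro h2
    have h4 : 4 ∣ n^2+1 := by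
      have : 2^2 ∣ d^2 := pow_dvd_pow_of_dvd h2 2
      exact (by simpa using this.trans h)
    have : (n^2+1) % 4 = 0 := Nat.mod_eq_zero_of_dvd h4
    have h5 : n % 4 = 0 ∨ n % 4 = 1 ∨ n % 4 = 2 ∨ n % 4 = 3 := by omega
    rcases h5 with h5 | h5 | h5 | h5 <;> simp [Nat.add_mod, Nat.pow_mod, h5] at this
  have hcop : IsCoprime (d : ℤ) 2 := by
    rw [Int.isCoprime_iff_gcd_eq_one]
    have : Nat.Coprime 2 d := (Nat.Prime.coprime_iff_not_dvd Nat.prime_two).2 hodd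
    simpa [Int.gcd, Nat.Coprime, Nat.gcd_comm] using this
  set z : GaussianInt := ⟨n, 1⟩ with hz
  have hzs : z * star z = ((n ^ 2 + 1 : ℕ) : GaussianInt) := by
    rw [Zsqrtd.ext_iff]
    simp [hz, pow_two]
  obtain ⟨e, he⟩ := h
  have hdvd2 : ((d : GaussianInt)) ^ 2 ∣ z * star z := by
    rw [hzs, he]; exact ⟨(e : GaussianInt), by push_cast; ring⟩
  have hdvd : (d : GaussianInt) ∣ z * star z := (dvd_pow_self _ two_ne_zero).trans hdvd2
  obtain ⟨α, α', h1, h2, h3⟩ := exists_dvd_and_dvd_of_dvd_mul hdvd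
  have hc2 : IsCoprime (d : GaussianInt) 2 := by
    obtain ⟨r, s, hrs⟩ := hcop
    refine ⟨(r : GaussianInt), (s : GaussianInt), ?_⟩
    have := congrArg (fun t : ℤ => (t : GaussianInt)) hrs
    push_cast at this
    exact this
  have hI : IsUnit (⟨0, 1⟩ : GaussianInt) := by
    refine IsUnit.of_mul_eq_one ⟨0, -1⟩ ?_
    rw [Zsqrtd.ext_iff]; simp
  have hc2' : IsCoprime (d : GaussianInt) (2 * ⟨0, 1⟩) := hc2.mul_right ((isCoprime_zero_left.2 hI |>.mono (dvd_zero _) dvd_rfl))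
  have hdiff : z - star z = 2 * ⟨0, 1⟩ := by
    rw [Zsqrtd.ext_iff]; simp [hz]
  have key1 : ∀ w : GaussianInt, w ∣ z → w ∣ (d : GaussianInt) → IsCoprime w (star z) := by
    intro w hw hwd
    have h5 : IsCoprime w (2 * ⟨0, 1⟩) := hc2'.of_isCoprime_of_dvd_left hwd
    rw [← hdiff] at h5
    obtain ⟨k, hk⟩ := hw
    have : star z = -(z - star z) + w * k := by rw [← hk]; ring
    rw [this]
    exact (IsCoprime.neg_right h5).add_mul_left_right k
  have key2 : ∀ w : GaussianInt, w ∣ star z → w ∣ (d : GaussianInt) → IsCoprime w z := by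
    intro w hw hwd
    have h5 : IsCoprime w (2 * ⟨0, 1⟩) := hc2'.of_isCoprime_of_dvd_left hwd
    rw [← hdiff] at h5
    obtain ⟨k, hk⟩ := hw
    have : z = (z - star z) + w * k := by rw [← hk]; ring
    rw [this]
    exact h5.add_mul_left_right k
  have hαd : α ∣ (d : GaussianInt) := ⟨α', h3⟩
  have hα'd : α' ∣ (d : GaussianInt) := ⟨α, by rw [h3]; ring⟩
  have sdvd : ∀ w y : GaussianInt, w ∣ y → star w ∣ star y := by
    rintro w y ⟨k, rfl⟩
    exact ⟨star k, by rw [star_mul, mul_comm]⟩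
  have hsd : star (d : GaussianInt) = (d : GaussianInt) := by
    rw [Zsqrtd.ext_iff]; simp
  have hα2 : α ^ 2 ∣ z := by
    have h6 : α ^ 2 ∣ z * star z := (pow_dvd_pow_of_dvd hαd 2).trans hdvd2
    exact ((key1 α h1 hαd).pow_left).dvd_of_dvd_mul_right h6
  have hn1 : star α ∣ α' := by
    have h6 : star α ∣ α * α' := by rw [← h3, ← hsd]; exact sdvd _ _ hαd
    have h7 : IsCoprime (star α) α := ((key1 α h1 hαd).of_isCoprime_of_dvd_right (sdvd _ _ h1)).symm
    exact h7.dvd_of_dvd_mul_left h6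
  have hn2 : α' ∣ star α := by
    have h6 : α' ∣ star α * star α' := by
      rw [mul_comm, ← star_mul, ← h3, hsd]; exact hα'd
    have h8 : star α' ∣ z := by simpa using sdvd _ _ h2
    have h7 : IsCoprime α' (star α') := (key2 α' h2 hα'd).of_isCoprime_of_dvd_right h8
    exact h7.dvd_of_dvd_mul_right h6
  have hN : Zsqrtd.norm α = Zsqrtd.norm α' := by
    have i1 : Zsqrtd.norm (star α) ∣ Zsqrtd.norm α' := by
      obtain ⟨k, rfl⟩ := hn1; exact ⟨_, Zsqrtd.norm_mul _ _⟩
    have i2 : Zsqrtd.norm α' ∣ Zsqrtd.norm (star α) := by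
      obtain ⟨k, hk⟩ := hn2; rw [hk]; exact ⟨_, Zsqrtd.norm_mul _ _⟩
    have := Int.dvd_antisymm (GaussianInt.norm_nonneg _) (GaussianInt.norm_nonneg _) i1 i2
    rw [← this, Zsqrtd.norm_conj]
  have hNd : Zsqrtd.norm α = d := by
    have h6 := congrArg Zsqrtd.norm h3
    rw [Zsqrtd.norm_mul, ← hN, Zsqrtd.norm_natCast] at h6
    have h7 := GaussianInt.norm_nonneg α
    nlinarith [h7, (Nat.cast_nonneg d : (0:ℤ) ≤ d)]
  obtain ⟨β, hβ⟩ := hα2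
  refine ⟨α.re, α.im, β.re, β.im, ?_, ?_, ?_⟩
  · have := congrArg Zsqrtd.im hβ
    simp [hz, pow_two] at this
    refine Eq.trans ?_ this.symm; ring
  · have := congrArg Zsqrtd.re hβ
    simp [hz, pow_two] at this
    refine Eq.trans ?_ this.symm; ring
  · rw [← hNd, Zsqrtd.norm_def]; ring

lemma gauss_param' (d n : ℕ) (h : d ^ 2 ∣ n ^ 2 + 1) :
    ∃ a b u v : ℤ, 0 < a ∧ |b| ≤ a ∧
     (a^2-b^2)*v+2*a*b*u = 1 ∧ (a^2-b^2)*u-2*a*b*v = n ∧ (d:ℤ) = a^2+b^2 := by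
  obtain ⟨a, b, u, v, h1, h2, h3⟩ := gauss_param d n h
  rcases le_total |b| |a| with hab | hab
  · rcases lt_trichotomy a 0 with ha | ha | ha
    · refine ⟨-a, -b, u, v, by linarith, ?_, ?_, ?_, ?_⟩
      · rw [abs_neg]; rwa [abs_of_neg ha] at hab
      · rw [← h1]; ring
      · rw [← h2]; ring
      · rw [h3]; ring
    · subst ha; simp at hab; subst hab; simp at h1
    · refine ⟨a, b, u, v, ha, ?_, h1, h2, h3⟩
      rwa [abs_of_pos ha] at hab
  · rcases lt_trichotomy b 0 with ha | ha | ha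
    · refine ⟨-b, a, -u, -v, by linarith, ?_, ?_, ?_, ?_⟩
      · rwa [abs_of_neg ha] at hab
      · rw [← h1]; ring
      · rw [← h2]; ring
      · rw [h3]; ring
    · subst ha; simp at hab; subst hab; simp at h1
    · refine ⟨b, -a, -u, -v, ha, ?_, ?_, ?_, ?_⟩
      · rw [abs_neg]; rwa [abs_of_pos ha] at hab
      · rw [← h1]; ring
      · rw [← h2]; ring
      · rw [h3]; ring


structure Good (x : ℝ) (q : Qd) : Prop where
  apos : 0 < q.a
  hab : |q.b| ≤ q.a
  hF : (q.a^2-q.b^2)*q.v+2*q.a*q.b*q.u = 1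
  n1 : x < (((q.a^2-q.b^2)*q.u-2*q.a*q.b*q.v : ℤ) : ℝ)
  n2 : (((q.a^2-q.b^2)*q.u-2*q.a*q.b*q.v : ℤ) : ℝ) ≤ 2 * x
  hd : x < (((q.a^2+q.b^2)^2 : ℤ) : ℝ)

lemma Good.cop {x q} (h : Good x q) : IsCoprime q.a q.b :=
  ⟨q.a * q.v + 2*q.b*q.u, -q.b*q.v, by linear_combination h.hF⟩

lemma Good.cop' {x q} (h : Good x q) : IsCoprime q.u q.v :=
  ⟨2*q.a*q.b, (q.a^2-q.b^2), by linear_combination h.hF⟩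

lemma Good.norm {x q} (h : Good x q) : (q.u^2+q.v^2)*(q.a^2+q.b^2)^2 =
    ((q.a^2-q.b^2)*q.u-2*q.a*q.b*q.v)^2+1 := by
  have := h.hF
  linear_combination (1 + ((q.a^2-q.b^2)*q.v+2*q.a*q.b*q.u)) * h.hF

lemma same_alpha {x : ℝ} {q q' : Qd} (h : Good x q) (h' : Good x q') (ha : q.a = q'.a)
    (hb : q.b = q'.b) : q = q' := by
  obtain ⟨a, b, u, v⟩ := q
  obtain ⟨a', b', u', v'⟩ := q'
  simp only at ha hb
  subst ha hb
  have hF := h.hF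
  have hF' := h'.hF
  have n1 := h.n1
  have n2 := h.n2
  have n1' := h'.n1
  have n2' := h'.n2
  have hd := h.hd
  simp only at hF hF' n1 n2 n1' n2' hd
  set N := (a^2-b^2)*u-2*a*b*v with hN
  set N' := (a^2-b^2)*u'-2*a*b*v' with hN'
  have key : N - N' = (a^2+b^2)^2 * (v * (u-u') - u * (v - v')) := by
    rw [hN, hN']
    linear_combination (-((a^2-b^2)*(u-u')-2*a*b*(v-v'))) * hF + ((a^2-b^2)*u-2*a*b*v)*(hF-hF')
  have h1 : |((N - N' : ℤ):ℝ)| < ((((a^2+b^2)^2 : ℤ)) : ℝ) := by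
    rw [abs_lt]; push_cast at *; constructor <;> linarith
  have h2 : |N - N'| < (a^2+b^2)^2 := by exact_mod_cast h1
  have h3 : N - N' = 0 := Int.eq_zero_of_abs_lt_dvd ⟨_, key⟩ h2
  have hpos : 0 < (a^2+b^2)^2 := by have := h.apos; simp only at this; positivity
  have e1 : (a^2+b^2)^2 * (u-u') = 0 := by
    have : (a^2+b^2)^2 * (u-u') = (a^2-b^2)*(N-N') + 2*a*b*(1-1) := by
      rw [hN, hN']; linear_combination 2*a*b*(hF-hF')
    rw [this, h3]; ring
  have e2 : (a^2+b^2)^2 * (v-v') = 0 := by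
    have : (a^2+b^2)^2 * (v-v') = -2*a*b*(N-N') + (a^2-b^2)*(1-1) := by
      rw [hN, hN']; linear_combination (a^2-b^2)*(hF-hF')
    rw [this, h3]; ring
  have f1 : u = u' := by
    rcases mul_eq_zero.1 e1 with h | h
    · omega
    · linarith
  have f2 : v = v' := by
    rcases mul_eq_zero.1 e2 with h | h
    · omega
    · linarith
  rw [f1, f2]

lemma cop_eq {a b a' b' : ℤ} (ha : 0 < a) (ha' : 0 < a') (h : IsCoprime a b) (h' : IsCoprime a' b')
    (e : a * b' - a' * b = 0) : a = a' ∧ b = b' := by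
  have h1 : a ∣ a' := by
    have : a ∣ a' * b := ⟨b', by linarith⟩
    exact h.dvd_of_dvd_mul_right this
  have h2 : a' ∣ a := by
    have : a' ∣ a * b' := ⟨b, by linarith⟩
    exact h'.dvd_of_dvd_mul_right this
  have h3 : a = a' := Int.dvd_antisymm ha.le ha'.le h1 h2
  subst h3
  refine ⟨rfl, ?_⟩
  have : a * (b' - b) = 0 := by linarith
  rcases mul_eq_zero.1 this with h | h
  · omega
  · linarith

lemma delta_zero {x : ℝ} {q q' : Qd} (h : Good x q) (h' : Good x q')
    (e : q.a * q'.b - q'.a * q.b = 0) : q = q' := by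
  obtain ⟨h1, h2⟩ := cop_eq h.apos h'.apos h.cop h'.cop e
  exact same_alpha h h' h1 h2

/-- Im identity for equal beta -/
lemma beta_identity {a b a' b' u v : ℤ} (hF : (a^2-b^2)*v+2*a*b*u = 1)
    (hF' : (a'^2-b'^2)*v+2*a'*b'*u = 1) :
    (u^2+v^2) * (2 * (a*a'+b*b') * (a*b'-a'*b)) =
      ((a^2-b^2)*u-2*a*b*v) - ((a'^2-b'^2)*u-2*a'*b'*v) := by
  linear_combination (-((a'^2-b'^2)*u-2*a'*b'*v)) * hF + ((a^2-b^2)*u-2*a*b*v) * hF'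

lemma range3_real {x w d d' s : ℝ} (hx : 0 < x) (hw : 1 ≤ w) (hd : 0 < d) (hd' : 0 < d')
    (h1 : x^2 ≤ w*d^2) (h2 : w*d^2 ≤ 5*x^2) (h1' : x^2 ≤ w*d'^2) (h2' : w*d'^2 ≤ 5*x^2)
    (hs : d * d' ≤ 2 * s^2) (hk : (w*(2*s))^2 ≤ (x/10)^2) : False := by
  set P : ℝ := d*d' with hP
  have hPpos : 0 < P := by positivity
  have hx2 : 0 < x^2 := by positivity
  have e : (w*P)^2 = (w*d^2)*(w*d'^2) := by rw [hP]; ring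
  have p1 : x^2 ≤ w*P := by
    refine le_trans (le_abs_self _) (abs_le_of_sq_le_sq ?_ (by positivity))
    rw [e, sq (x^2)]
    exact mul_le_mul h1 h1' hx2.le (by positivity)
  have p2 : w*P ≤ 5*x^2 := by
    refine le_trans (le_abs_self _) (abs_le_of_sq_le_sq ?_ (by positivity))
    rw [e, sq (5*x^2)]
    exact mul_le_mul h2 h2' (by positivity) (by positivity)
  have p3 : w*(w*P) ≤ x^2/200 := by
    have : w^2*P ≤ w^2*(2*s^2) := mul_le_mul_of_nonneg_left hs (by positivity)
    nlinarith
  have p4 : x^2 ≤ w * (w*P) := by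
    calc x^2 ≤ 1 * (w*P) := by linarith
      _ ≤ _ := mul_le_mul_of_nonneg_right hw (by positivity)
  linarith

lemma range3_inj {x : ℝ} (hx : 2 ≤ x) {q q' : Qd} (h : Good x q) (h' : Good x q') (hu : q.u = q'.u)
    (hv : q.v = q'.v) (hn : |((((q.a^2-q.b^2)*q.u-2*q.a*q.b*q.v : ℤ) : ℝ) -
      (((q'.a^2-q'.b^2)*q'.u-2*q'.a*q'.b*q'.v : ℤ) : ℝ))| ≤ x / 10) : q = q' := by
  have hF := h.hF
  have hF' := h'.hF
  have hnm := h.norm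
  have hnm' := h'.norm
  have n1 := h.n1
  have n2 := h.n2
  have n1' := h'.n1
  have n2' := h'.n2
  rw [← hu, ← hv] at hF' hnm' n1' n2' hn
  have hid := beta_identity hF hF'
  set N := (q.a^2-q.b^2)*q.u-2*q.a*q.b*q.v
  set N' := (q'.a^2-q'.b^2)*q.u-2*q'.a*q'.b*q.v
  set g := q.a*q'.a+q.b*q'.b with hg
  set y := q.a*q'.b-q'.a*q.b with hy
  set d := q.a^2+q.b^2 with hd
  set d' := q'.a^2+q'.b^2 with hd'
  set w := q.u^2+q.v^2 with hw
  have hdpos : 0 < d := by have := h.apos; positivity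
  have hdpos' : 0 < d' := by have := h'.apos; positivity
  have hgy : g^2+y^2 = d*d' := by rw [hg, hy, hd, hd']; ring
  have hw1 : 1 ≤ w := by
    by_contra hcon
    have : w = 0 := by have : 0 ≤ w := by positivity
                       omega
    rw [this] at hnm
    nlinarith [sq_nonneg N]
  have hprod : g * y = 0 := by
    by_contra hne
    have hg1 : 1 ≤ g^2 := by
      have : g ≠ 0 := fun h => hne (by rw [h]; ring)
      have := sq_pos_of_ne_zero this
      omega
    have hy1 : 1 ≤ y^2 := by
      have : y ≠ 0 := fun h => hne (by rw [h]; ring)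
      have := sq_pos_of_ne_zero this
      omega
    -- 2 d d' ≤ 4 g^2 y^2
    have k1 : d*d' ≤ 2 * (g*y)^2 := by
      rw [← hgy, mul_pow]; nlinarith [mul_nonneg (sub_nonneg.2 hg1) (sub_nonneg.2 hy1)]
    have k2 : ((w * (2*g*y) : ℤ) : ℝ)^2 ≤ (x/10)^2 := by
      rw [hid, ← sq_abs]
      push_cast
      exact pow_le_pow_left₀ (abs_nonneg _) hn 2
    have k1' : ((d*d' : ℤ):ℝ) ≤ 2 * ((g:ℝ)*y)^2 := by exact_mod_cast k1
    have c1 : (w:ℝ) * (d:ℝ)^2 = (N:ℝ)^2+1 := by exact_mod_cast hnm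
    have c2 : (w:ℝ) * (d':ℝ)^2 = (N':ℝ)^2+1 := by exact_mod_cast hnm'
    have w1 : (1:ℝ) ≤ w := by exact_mod_cast hw1
    have e1 : x^2 ≤ (N:ℝ)^2+1 := by nlinarith
    have e1' : x^2 ≤ (N':ℝ)^2+1 := by nlinarith
    have e2 : (N:ℝ)^2+1 ≤ 5*x^2 := by nlinarith
    have e2' : (N':ℝ)^2+1 ≤ 5*x^2 := by nlinarith
    have dp : (0:ℝ) < d := by exact_mod_cast hdpos
    have dp' : (0:ℝ) < d' := by exact_mod_cast hdpos'
    push_cast at k1' k2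
    refine range3_real (x := x) (w := w) (d := d) (d' := d') (s := (g:ℝ)*y) (by linarith) w1 dp dp'
      (by rw [c1]; exact e1) (by rw [c1]; exact e2) (by rw [c2]; exact e1') (by rw [c2]; exact e2') k1' ?_
    calc _ = ((w:ℝ) * (2*g*y))^2 := by ring
      _ ≤ _ := k2
  rcases mul_eq_zero.1 hprod with h0 | h0
  · exfalso
    have i1 := h.hab
    have i2 := h'.hab
    have i3 := h.apos
    have i4 := h'.apos
    have j1 : q.a * q'.a = |q.b| * |q'.b| := by
      rw [← abs_mul]
      have : q.b * q'.b = - (q.a*q'.a) := by linarith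
      rw [this, abs_neg, abs_of_pos (by positivity)]
    have j2 : |q.b| = q.a := by
      by_contra hne
      have : |q.b| < q.a := lt_of_le_of_ne i1 hne
      have l1 : |q.b| * |q'.b| ≤ |q.b| * q'.a := mul_le_mul_of_nonneg_left i2 (abs_nonneg _)
      have l2 : |q.b| * q'.a < q.a * q'.a := mul_lt_mul_of_pos_right this i4
      linarith
    have j3 : q.a^2 = q.b^2 := by rw [← j2, sq_abs]
    rw [j3] at hF
    have : (2:ℤ) ∣ 1 := ⟨q.a*q.b*q.u, by linarith⟩
    norm_num at this
  · exact delta_zero h h' h0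


lemma card_box {ι : Type*} (S : Finset ι) (f g h : ι → ℤ) (R : ℝ) (hR : 1 ≤ R) (M : ℕ)
    (hinj : ∀ i ∈ S, ∀ j ∈ S, f i = f j → g i = g j → h i = h j → i = j)
    (hf : ∀ i ∈ S, |(f i : ℝ)| ≤ R) (hg : ∀ i ∈ S, |(g i : ℝ)| ≤ R)
    (hh : ∀ i ∈ S, 0 ≤ h i ∧ h i < M) : (S.card : ℝ) ≤ 9 * R^2 * M := by
  set K : ℤ := ⌊R⌋ with hK
  have hK0 : 0 ≤ K := Int.floor_nonneg.2 (by linarith)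
  have hKR : (K:ℝ) ≤ R := Int.floor_le R
  have mem : ∀ z : ℤ, |(z:ℝ)| ≤ R → z ∈ Finset.Icc (-K) K := by
    intro z hz
    rw [Finset.mem_Icc, ← abs_le]
    rw [hK, Int.le_floor]; push_cast; exact hz
  have hle : S.card ≤ ((Finset.Icc (-K) K) ×ˢ ((Finset.Icc (-K) K) ×ˢ (Finset.Ico (0:ℤ) M))).card := by
    refine Finset.card_le_card_of_injOn (fun i => (f i, g i, h i)) ?_ ?_
    · intro i hi
      have hi' : i ∈ S := hi
      simp only [Finset.coe_product, Set.mem_prod, Finset.mem_coe]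
      exact ⟨mem _ (hf i hi'), mem _ (hg i hi'), Finset.mem_Ico.2 (hh i hi')⟩
    · intro i hi j hj hij
      simp only [Prod.mk.injEq] at hij
      exact hinj i hi j hj hij.1 hij.2.1 hij.2.2
  have hc : (((Finset.Icc (-K) K).card : ℕ) : ℝ) ≤ 3 * R := by
    rw [Int.card_Icc]
    have : ((K + 1 - -K).toNat : ℤ) = K + 1 - -K := Int.toNat_of_nonneg (by linarith)
    have h2 : (((K + 1 - -K).toNat : ℕ) : ℝ) = ((K + 1 - -K : ℤ) : ℝ) := by exact_mod_cast this
    rw [h2]; push_cast; linarith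
  rw [Finset.card_product, Finset.card_product] at hle
  have hcM : (Finset.Ico (0:ℤ) M).card = M := by simp
  rw [hcM] at hle
  calc (S.card : ℝ) ≤ (((Finset.Icc (-K) K).card * ((Finset.Icc (-K) K).card * M) : ℕ) : ℝ) := by
        exact_mod_cast hle
    _ ≤ (3*R) * ((3*R) * M) := by
        push_cast; gcongr
    _ = _ := by ring

lemma sq_abs_bound {z : ℤ} {w : ℤ} {R : ℝ} (hR : 0 ≤ R) (h : ((z^2 + w^2 : ℤ):ℝ) ≤ R^2) : |(z:ℝ)| ≤ R := by
  apply abs_le_of_sq_le_sq _ hR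
  push_cast at h; nlinarith [sq_nonneg (w:ℝ)]

lemma range1 {x : ℝ} (hx : 2 ≤ x) (S : Finset Qd) (hS : ∀ q ∈ S, Good x q)
    (hd : ∀ q ∈ S, ((q.a^2+q.b^2 : ℤ):ℝ) ≤ x^((7:ℝ)/12)) : (S.card : ℝ) ≤ 9 * x^((7:ℝ)/12) := by
  have e : (x^((7:ℝ)/24))^2 = x^((7:ℝ)/12) := by
    rw [← Real.rpow_natCast, ← Real.rpow_mul (by linarith)]; norm_num
  have h0 : 0 ≤ x^((7:ℝ)/24) := by positivity
  have := card_box S (fun q => q.a) (fun q => q.b) (fun _ => 0) (x^((7:ℝ)/24))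
    (Real.one_le_rpow (by linarith) (by norm_num)) 1 (fun i hi j hj h1 h2 _ => same_alpha (hS i hi) (hS j hj) h1 h2)
    (fun q hq => sq_abs_bound (w := q.b) h0 (by rw [e]; exact hd q hq))
    (fun q hq => sq_abs_bound (w := q.a) h0 (by rw [e, add_comm]; exact hd q hq))
    (fun _ _ => by norm_num)
  rw [e] at this; simpa using this

lemma range3 {x : ℝ} (hx : 2 ≤ x) (S : Finset Qd) (hS : ∀ q ∈ S, Good x q)
    (hd : ∀ q ∈ S, x^((17:ℝ)/24) ≤ ((q.a^2+q.b^2 : ℤ):ℝ)) : (S.card : ℝ) ≤ 2000 * x^((7:ℝ)/12) := by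
  have hx0 : 0 < x := by linarith
  have e : (x^((7:ℝ)/24))^2 = x^((7:ℝ)/12) := by
    rw [← Real.rpow_natCast, ← Real.rpow_mul (by linarith)]; norm_num
  have e2 : (x^((17:ℝ)/24))^2 * x^((7:ℝ)/12) = x^2 := by
    rw [← Real.rpow_natCast, ← Real.rpow_mul (by linarith), ← Real.rpow_add hx0, ← Real.rpow_natCast]; norm_num
  have h0 : 0 ≤ 3 * x^((7:ℝ)/24) := by positivity
  have hb : ∀ q ∈ S, ((q.u^2+q.v^2 : ℤ):ℝ) ≤ (3 * x^((7:ℝ)/24))^2 := by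
    intro q hq
    have h1 : ((q.u^2+q.v^2 : ℤ):ℝ) * ((q.a^2+q.b^2 : ℤ):ℝ)^2 =
      (((q.a^2-q.b^2)*q.u-2*q.a*q.b*q.v : ℤ) : ℝ)^2+1 := by exact_mod_cast (hS q hq).norm
    have n1 := (hS q hq).n1
    have n2 := (hS q hq).n2
    set N := (((q.a^2-q.b^2)*q.u-2*q.a*q.b*q.v : ℤ) : ℝ)
    have h2 : N^2+1 ≤ 5*x^2 := by nlinarith
    have h3 : (x^((17:ℝ)/24))^2 ≤ ((q.a^2+q.b^2 : ℤ):ℝ)^2 := pow_le_pow_left₀ (by positivity) (hd q hq) 2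
    have hw : (0:ℝ) ≤ ((q.u^2+q.v^2 : ℤ):ℝ) := by exact_mod_cast (by positivity : 0 ≤ q.u^2+q.v^2)
    have h4 : ((q.u^2+q.v^2 : ℤ):ℝ) * (x^((17:ℝ)/24))^2 ≤ (5 * x^((7:ℝ)/12)) * (x^((17:ℝ)/24))^2 := by
      calc _ ≤ ((q.u^2+q.v^2 : ℤ):ℝ) * ((q.a^2+q.b^2 : ℤ):ℝ)^2 := mul_le_mul_of_nonneg_left h3 hw
        _ ≤ 5*x^2 := by rw [h1]; exact h2
        _ = _ := by rw [← e2]; ring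
    have h5 := le_of_mul_le_mul_right h4 (by positivity)
    rw [mul_pow, e]
    have : 0 ≤ x^((7:ℝ)/12) := by positivity
    linarith
  have hN : ∀ q ∈ S, 0 ≤ ⌊10 * (((q.a^2-q.b^2)*q.u-2*q.a*q.b*q.v : ℤ) : ℝ) / x⌋ ∧
      ⌊10 * (((q.a^2-q.b^2)*q.u-2*q.a*q.b*q.v : ℤ) : ℝ) / x⌋ < (21:ℕ) := by
    intro q hq
    have n1 := (hS q hq).n1
    have n2 := (hS q hq).n2
    refine ⟨Int.floor_nonneg.2 (by apply div_nonneg <;> linarith), ?_⟩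
    rw [Int.floor_lt]
    rw [div_lt_iff₀ hx0]; push_cast at *; linarith
  have := card_box S (fun q => q.u) (fun q => q.v) (fun q => ⌊10 * (((q.a^2-q.b^2)*q.u-2*q.a*q.b*q.v : ℤ) : ℝ) / x⌋)
    (3 * x^((7:ℝ)/24)) (by have := Real.one_le_rpow (x := x) (z := 7/24) (by linarith) (by norm_num); linarith) 21
    (fun i hi j hj h1 h2 h3 => by
      refine range3_inj hx (hS i hi) (hS j hj) h1 h2 ?_
      have := Int.abs_sub_lt_one_of_floor_eq_floor h3
      rw [← sub_div, ← mul_sub, abs_div, abs_of_pos hx0, div_lt_one hx0, abs_mul] at this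
      norm_num at this ⊢
      linarith)
    (fun q hq => sq_abs_bound (w := q.v) h0 (hb q hq))
    (fun q hq => sq_abs_bound (w := q.u) h0 (by rw [add_comm]; exact hb q hq))
    hN
  rw [mul_pow, e] at this
  have h7 : 0 ≤ x^((7:ℝ)/12) := by positivity
  norm_num at this
  linarith


open Classical in
lemma select {ι : Type*} (t : ι → ℝ) (s0 : ℝ) (Z K0 : ℕ) (hZ : 0 < Z) (hK0 : 1 ≤ K0) :
    ∀ (J : ℕ) (S : Finset ι) (c l : ℝ), (∀ i ∈ S, c ≤ t i ∧ t i < c + l) → 0 < l →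
    l ≤ s0 * (Z:ℝ)^J → (∀ i ∈ S, ∀ j ∈ S, i ≠ j → s0 ≤ |t i - t j|) → 9^J * K0 < S.card →
    ∃ l' : ℝ, 0 < l' ∧ ∃ S' ⊆ S, K0 ≤ S'.card ∧ (∀ i ∈ S', ∀ j ∈ S', |t i - t j| ≤ l') ∧
      ∃ p : Fin 5 → ι, (∀ k, p k ∈ S') ∧ ∀ k m, k ≠ m → l' / Z ≤ |t (p k) - t (p m)| := by
  intro J
  induction J with
  | zero =>
    intro S c l hS hl hls hsep hcard
    exfalso
    have : 1 < S.card := by simp at hcard; omega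
    obtain ⟨i, hi, j, hj, hij⟩ := Finset.one_lt_card.1 this
    have h1 := hsep i hi j hj hij
    have h2 : |t i - t j| < l := by
      rw [abs_lt]; constructor <;> linarith [(hS i hi).1, (hS i hi).2, (hS j hj).1, (hS j hj).2]
    simp at hls
    linarith
  | succ J ih =>
    intro S c l hS hl hls hsep hcard
    have hZr : (0:ℝ) < Z := by exact_mod_cast hZ
    set bin : ι → ℤ := fun i => ⌊(t i - c) * Z / l⌋ with hbin
    by_cases h9 : 9 ≤ (S.image bin).card
    · obtain ⟨B, hB, hB9⟩ := Finset.exists_subset_card_eq h9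
      set e := B.orderEmbOfFin hB9 with he
      have hmem : ∀ k, ∃ i ∈ S, bin i = e k := by
        intro k
        have : e k ∈ S.image bin := hB (Finset.orderEmbOfFin_mem B hB9 k)
        simpa using this
      choose f hf1 hf2 using hmem
      let g : Fin 5 → Fin 9 := fun k => ⟨2 * k.1, by omega⟩
      refine ⟨l, hl, S, subset_rfl, ?_, ?_, fun k => f (g k), fun k => hf1 _, ?_⟩
      · have : K0 ≤ 9^(J+1)*K0 := Nat.le_mul_of_pos_left _ (by positivity)
        omega
      · intro i hi j hj
        rw [abs_le]; constructor <;> linarith [(hS i hi).1, (hS i hi).2, (hS j hj).1, (hS j hj).2]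
      · have key : ∀ k m : Fin 5, k < m → l / Z ≤ t (f (g m)) - t (f (g k)) := by
          intro k m hkm
          have hkm' : k.1 < m.1 := hkm
          have s1 : e (g k) < e ⟨2*k.1+1, by omega⟩ := by
            rw [OrderEmbedding.lt_iff_lt]; show 2*k.1 < 2*k.1+1; omega
          have s2 : e ⟨2*k.1+1, by omega⟩ < e (g m) := by
            rw [OrderEmbedding.lt_iff_lt]; show 2*k.1+1 < 2*m.1; omega
          have s3 : bin (f (g k)) + 2 ≤ bin (f (g m)) := by rw [hf2, hf2]; omega
          have s4 : (t (f (g k)) - c) * Z / l < bin (f (g k)) + 1 := Int.lt_floor_add_one _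
          have s5 : (bin (f (g m)) : ℝ) ≤ (t (f (g m)) - c) * Z / l := Int.floor_le _
          have s6 : (bin (f (g k)) : ℝ) + 2 ≤ bin (f (g m)) := by exact_mod_cast s3
          have s7 : 1 ≤ (t (f (g m)) - t (f (g k))) * Z / l := by
            have : (t (f (g m)) - t (f (g k))) * Z / l = (t (f (g m)) - c) * Z / l - (t (f (g k)) - c) * Z / l := by
              ring
            rw [this]; linarith
          rw [le_div_iff₀ hl] at s7
          rw [div_le_iff₀ hZr]; linarith
        intro k m hkm
        rcases lt_or_gt_of_ne hkm with h | h
        · rw [abs_sub_comm]; exact (key k m h).trans (le_abs_self _)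
        · exact (key m k h).trans (le_abs_self _)
    · have hlt : (S.image bin).card * (9^J*K0) < S.card := by
        have h8 : (S.image bin).card ≤ 8 := by omega
        calc (S.image bin).card * (9^J*K0) ≤ 8 * (9^J*K0) := Nat.mul_le_mul_right _ h8
          _ ≤ 9^(J+1)*K0 := by rw [pow_succ]; nlinarith [Nat.zero_le (9^J*K0)]
          _ < _ := hcard
      obtain ⟨y, hy, hy2⟩ := Finset.exists_lt_card_fiber_of_mul_lt_card_of_maps_to
        (fun i hi => Finset.mem_image_of_mem bin hi) hlt
      obtain ⟨l', hl', S', hS', r⟩ := ih (S.filter (fun i => bin i = y)) (c + y * l / Z) (l / Z) (by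
          intro i hi
          rw [Finset.mem_filter] at hi
          have s4 : (t i - c) * Z / l < bin i + 1 := Int.lt_floor_add_one _
          have s5 : (bin i : ℝ) ≤ (t i - c) * Z / l := Int.floor_le _
          rw [hi.2, div_lt_iff₀ hl] at s4
          rw [hi.2, le_div_iff₀ hl] at s5
          have w1 : y * l / Z ≤ t i - c := by rw [div_le_iff₀ hZr]; exact s5
          have w2 : t i - c < (y+1) * l / Z := by rw [lt_div_iff₀ hZr]; exact s4
          have w3 : (y+1) * l / Z = y * l / Z + l / Z := by ring
          constructor <;> linarith) (by positivity) (by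
          rw [div_le_iff₀ hZr]; rw [pow_succ] at hls; linarith) (by
          intro i hi j hj
          exact hsep i (Finset.mem_filter.1 hi).1 j (Finset.mem_filter.1 hj).1) hy2
      exact ⟨l', hl', S', hS'.trans (Finset.filter_subset _ _), r⟩

/-- separated points in an interval -/
lemma sep_count {ι : Type*} (t : ι → ℝ) (s l : ℝ) (hs : 0 < s) (S : Finset ι) (hne : S.Nonempty)
    (h1 : ∀ i ∈ S, ∀ j ∈ S, |t i - t j| ≤ l) (h2 : ∀ i ∈ S, ∀ j ∈ S, i ≠ j → s ≤ |t i - t j|) :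
    ((S.card : ℝ) - 1) * s ≤ l := by
  obtain ⟨i0, hi0, hmin⟩ := S.exists_min_image t hne
  have hl : 0 ≤ l := (abs_nonneg _).trans (h1 i0 hi0 i0 hi0)
  have : S.card ≤ (Finset.Icc (0:ℤ) ⌊l/s⌋).card := by
    refine Finset.card_le_card_of_injOn (fun i => ⌊(t i - t i0)/s⌋) ?_ ?_
    · intro i hi
      have hi' : i ∈ S := hi
      simp only [Finset.coe_Icc, Set.mem_Icc]
      constructor
      · apply Int.floor_nonneg.2
        apply div_nonneg _ hs.le
        linarith [hmin i hi']
      · apply Int.floor_le_floor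
        gcongr
        exact (le_abs_self _).trans (h1 i hi' i0 hi0)
    · intro i hi j hj hij
      by_contra hne
      have h3 := Int.abs_sub_lt_one_of_floor_eq_floor hij
      rw [← sub_div, abs_div, abs_of_pos hs, div_lt_one hs] at h3
      have := h2 i hi j hj hne
      have e : t i - t i0 - (t j - t i0) = t i - t j := by ring
      rw [e] at h3
      linarith
  rw [Int.card_Icc] at this
  have hf : 0 ≤ ⌊l/s⌋ := Int.floor_nonneg.2 (by positivity)
  have h4 : (S.card : ℤ) ≤ ⌊l/s⌋ + 1 := by omega
  have h5 : (S.card : ℝ) ≤ (⌊l/s⌋ : ℝ) + 1 := by exact_mod_cast h4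
  have h6 : (⌊l/s⌋ : ℝ) ≤ l / s := Int.floor_le _
  have h7 : (S.card : ℝ) - 1 ≤ l / s := by linarith
  rwa [le_div_iff₀ hs] at h7



open Classical in
lemma relation_exists {κ n : Type*} [Fintype n] [DecidableEq n] [Nonempty n] (w : κ → n → ℤ) (S : Set κ)
    (H : ℝ) (hH1 : 1 ≤ H) (hH : ∀ k ∈ S, ∀ j, |(w k j : ℝ)| ≤ H)
    (hdet : ∀ f : n → κ, (∀ i, f i ∈ S) → (Matrix.of fun i j => w (f i) j).det = 0) :
    ∃ G : n → ℤ, G ≠ 0 ∧ (∀ j, |(G j : ℝ)| ≤ (Fintype.card n * H) ^ (Fintype.card n)) ∧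
      ∀ k ∈ S, ∑ j, G j * w k j = 0 := by
  have hc1 : (1:ℝ) ≤ Fintype.card n := by exact_mod_cast Fintype.card_pos
  have hcH : 1 ≤ Fintype.card n * H := by nlinarith
  set wq : κ → n → ℚ := fun k j => (w k j : ℚ) with hwq
  obtain ⟨b, hbT, hspan, hli⟩ := exists_linearIndependent ℚ (wq '' S)
  have hbfin : b.Finite := hli.setFinite
  have : Fintype b := hbfin.fintype
  have hcard : Fintype.card b ≤ Fintype.card n := by
    have := hli.fintype_card_le_finrank
    simpa using this
  have hrep : ∀ z : b, ∃ k ∈ S, wq k = z.1 := fun z => hbT z.2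
  choose r hr1 hr2 using hrep
  -- transfer
  have transfer : ∀ G : n → ℤ, (∀ z : b, ∑ j, G j * w (r z) j = 0) → ∀ k ∈ S, ∑ j, G j * w k j = 0 := by
    intro G hG k hk
    let φ : (n → ℚ) →ₗ[ℚ] ℚ := ∑ j, (G j : ℚ) • LinearMap.proj j
    have hφ : ∀ v, φ v = ∑ j, (G j : ℚ) * v j := by
      intro v; simp [φ]
    have hb : b ⊆ LinearMap.ker φ := by
      intro z hz
      have h1 := hG ⟨z, hz⟩
      have h2 := hr2 ⟨z, hz⟩
      simp only [SetLike.mem_coe, LinearMap.mem_ker, hφ]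
      simp only at h2
      rw [← h2]
      simp only [hwq]
      exact_mod_cast h1
    have h3 : wq k ∈ Submodule.span ℚ (wq '' S) := Submodule.subset_span ⟨k, hk, rfl⟩
    rw [← hspan] at h3
    have h4 := Submodule.span_le.2 hb h3
    rw [LinearMap.mem_ker, hφ] at h4
    simp only [hwq] at h4
    exact_mod_cast h4
  rcases hcard.lt_or_eq with hlt | heq
  · by_cases hb0 : Fintype.card b = 0
    · have : IsEmpty b := Fintype.card_eq_zero_iff.1 hb0
      obtain ⟨i0⟩ := ‹Nonempty n›
      refine ⟨Pi.single i0 1, ?_, ?_, transfer _ (fun z => isEmptyElim z)⟩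
      · intro h; have := congrFun h i0; simp at this
      · intro j
        have : |((Pi.single i0 1 : n → ℤ) j : ℝ)| ≤ 1 := by
          by_cases hj : j = i0
          · subst hj; simp
          · simp [Pi.single_eq_of_ne hj]
        exact this.trans (one_le_pow₀ hcH)
    · let _ : SeminormedAddCommGroup (Matrix b n ℤ) := Matrix.seminormedAddCommGroup
      let A : Matrix b n ℤ := Matrix.of fun z j => w (r z) j
      obtain ⟨t, ht0, htA, htn⟩ := Int.Matrix.exists_ne_zero_int_vec_norm_le A hlt (Nat.pos_of_ne_zero hb0)
      refine ⟨t, ht0, ?_, ?_⟩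
      · intro j
        have h1 : |(t j : ℝ)| ≤ ‖t‖ := by
          have := norm_le_pi_norm t j
          rwa [Int.norm_eq_abs] at this
        refine h1.trans (htn.trans ?_)
        have hA : max 1 ‖A‖ ≤ H := by
          apply max_le hH1
          rw [Matrix.norm_le_iff (by linarith)]
          intro i j
          rw [Int.norm_eq_abs]
          exact hH _ (hr1 i) j
        have hpos : 0 ≤ max 1 ‖A‖ := le_trans zero_le_one (le_max_left _ _)
        rw [← Real.rpow_natCast]
        have hmn : (Fintype.card b : ℝ) + 1 ≤ Fintype.card n := by exact_mod_cast hlt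
        calc _ ≤ ((Fintype.card n : ℝ) * H) ^ ((Fintype.card b : ℝ) / (Fintype.card n - Fintype.card b)) := by
              apply Real.rpow_le_rpow (by positivity)
              · gcongr
              · apply div_nonneg (by positivity); linarith
          _ ≤ _ := by
              apply Real.rpow_le_rpow_of_exponent_le hcH
              rw [div_le_iff₀ (by linarith)]
              have : (0:ℝ) ≤ Fintype.card b := by positivity
              nlinarith
      · apply transfer
        intro z
        have := congrFun htA z
        simp only [Matrix.mulVec, dotProduct, A, Matrix.of_apply, Pi.zero_apply] at this
        rw [← this]
        exact Finset.sum_congr rfl fun j _ => mul_comm _ _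
  · exfalso
    let e : n ≃ b := (Fintype.equivOfCardEq heq).symm
    have h1 := hdet (fun i => r (e i)) (fun i => hr1 _)
    have h2 : LinearIndependent ℚ (fun i : n => ((e i : b) : n → ℚ)) := hli.comp e e.injective
    have h3 : (Matrix.of fun i j => w (r (e i)) j).map (Int.castRingHom ℚ) = Matrix.of (fun i : n => ((e i : b) : n → ℚ)) := by
      ext i j
      have := congrFun (hr2 (e i)) j
      simpa [hwq] using this
    have h4 : (Matrix.of (fun i : n => ((e i : b) : n → ℚ))).det = 0 := by
      rw [← h3, ← RingHom.mapMatrix_apply, ← RingHom.map_det, h1]; simp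
    have h5 : IsUnit (Matrix.of (fun i : n => ((e i : b) : n → ℚ))) := by
      rw [← Matrix.linearIndependent_rows_iff_isUnit]; exact h2
    rw [Matrix.isUnit_iff_isUnit_det, h4] at h5
    simp at h5

lemma relation_prim {κ n : Type*} [Fintype n] [DecidableEq n] [Nonempty n] (w : κ → n → ℤ) (S : Set κ)
    (H : ℝ) (hH1 : 1 ≤ H) (hH : ∀ k ∈ S, ∀ j, |(w k j : ℝ)| ≤ H)
    (hdet : ∀ f : n → κ, (∀ i, f i ∈ S) → (Matrix.of fun i j => w (f i) j).det = 0) :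
    ∃ G : n → ℤ, G ≠ 0 ∧ (∀ j, |(G j : ℝ)| ≤ (Fintype.card n * H) ^ (Fintype.card n)) ∧
      (∀ k ∈ S, ∑ j, G j * w k j = 0) ∧ ∀ m z : ℤ, (∀ j, m ∣ G j * z) → m ∣ z := by
  obtain ⟨G, hG0, hGb, hGr⟩ := relation_exists w S H hH1 hH hdet
  obtain ⟨j0, hj0⟩ := Function.ne_iff.1 hG0
  obtain ⟨g, hg, hgcd⟩ := Finset.extract_gcd G (Finset.univ_nonempty (α := n))
  set c := Finset.univ.gcd G with hc
  have hc0 : c ≠ 0 := by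
    intro h; rw [h] at hg; apply hj0; simp [hg j0 (Finset.mem_univ _)]
  refine ⟨g, ?_, ?_, ?_, ?_⟩
  · intro h; apply hj0; rw [hg j0 (Finset.mem_univ _), h]; simp
  · intro j
    refine le_trans ?_ (hGb j)
    rw [hg j (Finset.mem_univ _)]
    push_cast
    rw [abs_mul]
    have : (1:ℝ) ≤ |(c:ℝ)| := by exact_mod_cast Int.one_le_abs hc0
    nlinarith [abs_nonneg (g j : ℝ)]
  · intro k hk
    have h1 := hGr k hk
    have h2 : ∑ j, G j * w k j = c * ∑ j, g j * w k j := by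
      rw [Finset.mul_sum]; refine Finset.sum_congr rfl fun j hj => ?_
      rw [hg j hj]; ring
    rw [h2] at h1
    exact (mul_eq_zero.1 h1).resolve_left hc0
  · intro m z h
    have h1 : m ∣ Finset.univ.gcd (fun j => g j * z) := Finset.dvd_gcd fun j _ => h j
    rw [Finset.gcd_mul_right, hgcd, one_mul] at h1
    exact (dvd_normalize_iff).1 h1


lemma det_col_bound {n : Type*} [Fintype n] [DecidableEq n] (M : Matrix n n ℝ) (c : n → ℝ)
    (h : ∀ i j, |M i j| ≤ c j) : |M.det| ≤ (Fintype.card n).factorial * ∏ j, c j := by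
  rw [Matrix.det_apply]
  calc _ ≤ ∑ σ : Equiv.Perm n, |Equiv.Perm.sign σ • ∏ i, M (σ i) i| := Finset.abs_sum_le_sum_abs _ _
    _ ≤ ∑ σ : Equiv.Perm n, ∏ j, c j := by
        refine Finset.sum_le_sum fun σ _ => ?_
        have : |Equiv.Perm.sign σ • ∏ i, M (σ i) i| = ∏ i, |M (σ i) i| := by
          rw [← Finset.abs_prod]
          rcases Int.units_eq_one_or (Equiv.Perm.sign σ) with h | h <;> rw [h] <;> simp
        rw [this]
        exact Finset.prod_le_prod (fun i _ => abs_nonneg _) fun i _ => h _ _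
    _ = _ := by
        rw [Finset.sum_const, Finset.card_univ, Fintype.card_perm]; simp

open Matrix in
lemma det6 (a b u v g y p q : Fin 3 × Fin 2 → ℝ) (a1 b1 d1 : ℝ) (hd1 : d1 = a1^2+b1^2) (hd1' : 0 < d1)
    (hg : ∀ i, g i = (a1 * a i + b1 * b i)/d1) (hy : ∀ i, y i = a1 * b i - b1 * a i)
    (hp : ∀ i, p i = ((a1^2-b1^2) * u i - 2*a1*b1*v i)/d1^2)
    (hq : ∀ i, q i = 2*a1*b1*u i + (a1^2-b1^2)*v i)
    (c0 c1 c2 c3 c4 : ℝ)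
    (hF : ∀ i, (g i)^2 * q i + 2*d1*(g i * y i * p i) - (1/d1^2)*((y i)^2 * q i) = 1)
    (h0 : ∀ i, |(g i)^2 * p i| ≤ c0) (h1 : ∀ i, |g i * y i * p i| ≤ c1) (h2 : ∀ i, |(y i)^2 * p i| ≤ c2)
    (h3 : ∀ i, |g i * y i * q i + 2*d1*((y i)^2 * p i)| ≤ c3) (h4 : ∀ i, |(y i)^2 * q i| ≤ c4) :
    |(Matrix.of (fun (i : Fin 3 × Fin 2) (j : Fin 3 × Fin 2) =>
      (![(a i)^2, a i * b i, (b i)^2] j.1) * (![u i, v i] j.2))).det| ≤ 720 * (c0*c1*c2*c3*c4) := by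
  set W : Matrix (Fin 3 × Fin 2) (Fin 3 × Fin 2) ℝ := Matrix.of (fun (i : Fin 3 × Fin 2) (j : Fin 3 × Fin 2) =>
      (![(a i)^2, a i * b i, (b i)^2] j.1) * (![u i, v i] j.2)) with hW
  have hne : d1 ≠ 0 := hd1'.ne'
  set S : Matrix (Fin 3) (Fin 3) ℝ := !![(a1/d1)^2, -(a1/d1)*b1, b1^2; 2*(a1/d1)*(b1/d1), (a1/d1)*a1-(b1/d1)*b1, -2*a1*b1;
    (b1/d1)^2, (b1/d1)*a1, a1^2] with hS
  set B : Matrix (Fin 2) (Fin 2) ℝ := !![(a1^2-b1^2)/d1^2, 2*a1*b1; -(2*a1*b1)/d1^2, (a1^2-b1^2)] with hB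
  have hdS : S.det = 1 := by
    have e : a1/d1*a1+b1/d1*b1 = 1 := by field_simp; rw [hd1]
    rw [hS, Matrix.det_fin_three]; simp
    calc _ = (a1/d1*a1+b1/d1*b1)^3 := by ring
      _ = 1 := by rw [e]; norm_num
  have hdB : B.det = 1 := by
    rw [hB, Matrix.det_fin_two]; simp
    field_simp; rw [hd1]; ring
  set W1 := W * (kroneckerMap (· * ·) S B) with hW1
  have hW1d : W1.det = W.det := by
    rw [hW1, Matrix.det_mul, Matrix.det_kronecker, hdS, hdB]; simp
  have hW1e : ∀ i j, W1 i j = (![(g i)^2, g i * y i, (y i)^2] j.1) * (![p i, q i] j.2) := by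
    intro i j
    obtain ⟨j, k⟩ := j
    rw [hW1, Matrix.mul_apply, Fintype.sum_prod_type]
    simp only [Fin.sum_univ_three, Fin.sum_univ_two, kroneckerMap_apply, hW, hS, hB]
    fin_cases j <;> fin_cases k <;> simp [hg, hy, hp, hq] <;> ring
  set W2 := W1 * transvection (1,0) (0,1) (2*d1) * transvection (2,1) (0,1) (-(1/d1^2)) * transvection (2,0) (1,1) (2*d1) with hW2
  have hW2d : W2.det = W.det := by
    rw [hW2, Matrix.det_mul, Matrix.det_mul, Matrix.det_mul, det_transvection_of_ne _ _ (by decide),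
      det_transvection_of_ne _ _ (by decide), det_transvection_of_ne _ _ (by decide), hW1d]; simp
  have hb := det_col_bound W2 (fun j => (![![c0, 1], ![c1, c3], ![c2, c4]] j.1) j.2) (by
    intro i j
    obtain ⟨j, k⟩ := j
    fin_cases j <;> fin_cases k
    · rw [hW2, mul_transvection_apply_of_ne _ _ _ _ (by decide), mul_transvection_apply_of_ne _ _ _ _ (by decide),
        mul_transvection_apply_of_ne _ _ _ _ (by decide), hW1e]
      simpa using h0 i
    · show |W2 i (0,1)| ≤ _
      rw [hW2, mul_transvection_apply_of_ne _ _ _ _ (by decide), mul_transvection_apply_same, mul_transvection_apply_same,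
        mul_transvection_apply_of_ne _ _ _ _ (by decide), hW1e, hW1e, hW1e]
      have := hF i
      simp
      rw [show g i ^ 2 * q i + 2 * d1 * (g i * y i * p i) + -((d1 ^ 2)⁻¹ * (y i ^ 2 * q i)) = 1 by rw [← this]; ring]
      simp
    · rw [hW2, mul_transvection_apply_of_ne _ _ _ _ (by decide), mul_transvection_apply_of_ne _ _ _ _ (by decide),
        mul_transvection_apply_of_ne _ _ _ _ (by decide), hW1e]
      simpa using h1 i
    · show |W2 i (1,1)| ≤ _
      rw [hW2, mul_transvection_apply_same, mul_transvection_apply_of_ne _ _ _ _ (by decide), mul_transvection_apply_of_ne _ _ _ _ (by decide),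
        mul_transvection_apply_of_ne _ _ _ _ (by decide), mul_transvection_apply_of_ne _ _ _ _ (by decide), hW1e, hW1e]
      simpa using h3 i
    · rw [hW2, mul_transvection_apply_of_ne _ _ _ _ (by decide), mul_transvection_apply_of_ne _ _ _ _ (by decide),
        mul_transvection_apply_of_ne _ _ _ _ (by decide), hW1e]
      simpa using h2 i
    · rw [hW2, mul_transvection_apply_of_ne _ _ _ _ (by decide), mul_transvection_apply_of_ne _ _ _ _ (by decide),
        mul_transvection_apply_of_ne _ _ _ _ (by decide), hW1e]
      simpa using h4 i)
  rw [hW2d] at hb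
  refine hb.trans (le_of_eq ?_)
  rw [Fintype.prod_prod_type]
  simp [Fin.prod_univ_three]
  norm_num [Nat.factorial]
  ring


structure Par (x D τ : ℝ) : Prop where
  x100 : 100 ≤ x
  τ0 : 0 < τ
  τ1 : τ ≤ 1/100
  xτ : 1 ≤ x * τ
  xτ3 : x * τ^3 ≤ 1/400
  main : x^4 * τ^7 ≤ 1/10^10
  D1 : 1 ≤ D
  Dx : 100 * D ≤ x

structure Cls (x D τ : ℝ) (S : Finset Qd) : Prop where
  good : ∀ q ∈ S, Good x q
  dlo : ∀ q ∈ S, D ≤ (q.a:ℝ)^2+(q.b:ℝ)^2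
  dhi : ∀ q ∈ S, (q.a:ℝ)^2+(q.b:ℝ)^2 < 2*D
  cls : ∀ q ∈ S, ∀ q' ∈ S, |(q.b:ℝ)/q.a - (q'.b:ℝ)/q'.a| < τ

lemma Cls.mono {x D τ : ℝ} {S S' : Finset Qd} (h : Cls x D τ S) (hs : S' ⊆ S) : Cls x D τ S' :=
  ⟨fun q hq => h.good q (hs hq), fun q hq => h.dlo q (hs hq), fun q hq => h.dhi q (hs hq),
    fun q hq q' hq' => h.cls q (hs hq) q' (hs hq')⟩

lemma le_of_sq_le_sq' {a b : ℝ} (hb : 0 ≤ b) (h : a^2 ≤ b^2) : a ≤ b :=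
  le_trans (le_abs_self _) (abs_le_of_sq_le_sq h hb)

/-- elementary two-point estimates -/
lemma two_pt {a b a1 b1 D τ : ℝ} (ha : 0 < a) (ha1 : 0 < a1) (hb : |b| ≤ a) (hb1 : |b1| ≤ a1)
    (h1 : D ≤ a^2+b^2) (h2 : a^2+b^2 < 2*D) (h3 : D ≤ a1^2+b1^2) (h4 : a1^2+b1^2 < 2*D)
    (hD : 1 ≤ D) (hτ1 : τ ≤ 1/100) (ht : |b/a - b1/a1| < τ) :
    a1*b-b1*a = a1*a*(b/a-b1/a1) ∧ D/2 ≤ a1*a ∧ a1*a ≤ 2*D ∧ |a1*b-b1*a| ≤ 2*D*τ ∧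
    1/2 ≤ (a1*a+b1*b)/(a1^2+b1^2) ∧ (a1*a+b1*b)/(a1^2+b1^2) ≤ 2 ∧
    ((a1*a+b1*b)/(a1^2+b1^2))^2 + ((a1*b-b1*a)/(a1^2+b1^2))^2 = (a^2+b^2)/(a1^2+b1^2) ∧
    ((a1*b-b1*a)/(a1^2+b1^2))^2 ≤ (2*τ)^2 ∧ 1/4 ≤ ((a1*a+b1*b)/(a1^2+b1^2))^2 - ((a1*b-b1*a)/(a1^2+b1^2))^2 := by
  have hτ0 : 0 < τ := lt_of_le_of_lt (abs_nonneg _) ht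
  have e1 : a1*b-b1*a = a1*a*(b/a-b1/a1) := by field_simp
  have sb : b^2 ≤ a^2 := by rw [← sq_abs b]; exact pow_le_pow_left₀ (abs_nonneg _) hb 2
  have sb1 : b1^2 ≤ a1^2 := by rw [← sq_abs b1]; exact pow_le_pow_left₀ (abs_nonneg _) hb1 2
  have a2 : D/2 ≤ a^2 := by linarith
  have a12 : D/2 ≤ a1^2 := by linarith
  have e2 : D/2 ≤ a1*a := by
    refine le_trans (le_abs_self _) (abs_le_of_sq_le_sq ?_ (by positivity))
    rw [mul_pow, sq (D/2)]; exact mul_le_mul a12 a2 (by positivity) (by positivity)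
  have e3 : a1*a ≤ 2*D := by nlinarith [sq_nonneg (a1-a), sq_nonneg b, sq_nonneg b1]
  have e4 : |a1*b-b1*a| ≤ 2*D*τ := by
    rw [e1, abs_mul, abs_of_pos (by positivity : 0 < a1*a)]
    exact mul_le_mul e3 ht.le (abs_nonneg _) (by positivity)
  set d1 := a1^2+b1^2 with hd1
  have d1p : 0 < d1 := by linarith
  have gpos : 0 ≤ a1*a+b1*b := by
    have : |b1*b| ≤ a1*a := by rw [abs_mul]; exact mul_le_mul hb1 hb (abs_nonneg _) ha1.le
    have := neg_abs_le (b1*b)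
    linarith
  have id : ((a1*a+b1*b)/d1)^2 + ((a1*b-b1*a)/d1)^2 = (a^2+b^2)/d1 := by
    rw [div_pow, div_pow, ← add_div, div_eq_div_iff (by positivity) (by positivity), hd1]; ring
  have r1 : 1/2 ≤ (a^2+b^2)/d1 := by rw [le_div_iff₀ d1p]; linarith
  have r2 : (a^2+b^2)/d1 ≤ 2 := by rw [div_le_iff₀ d1p]; linarith
  have yb : ((a1*b-b1*a)/d1)^2 ≤ (2*τ)^2 := by
    rw [← sq_abs, abs_div, abs_of_pos d1p]
    apply pow_le_pow_left₀ (by positivity)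
    rw [div_le_iff₀ d1p]
    refine e4.trans ?_
    have := mul_le_mul_of_nonneg_right h3 hτ0.le
    linarith
  have yb2 : (2*τ)^2 ≤ 1/2500 := by
    have := pow_le_pow_left₀ (by positivity) (by linarith : 2*τ ≤ 1/50) 2
    norm_num at this ⊢; exact this
  set G := (a1*a+b1*b)/d1
  have G0 : 0 ≤ G := div_nonneg gpos d1p.le
  set Yd := ((a1*b-b1*a)/d1)
  refine ⟨e1, e2, e3, e4, ?_, ?_, id, yb, ?_⟩
  · apply le_of_sq_le_sq' G0
    clear_value G Yd
    clear e1 e2 e3 e4 gpos sb sb1 ht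
    norm_num
    linarith
  · apply le_of_sq_le_sq' (by norm_num)
    have := sq_nonneg Yd
    clear_value G Yd
    clear e1 e2 e3 e4 gpos sb sb1 ht
    norm_num
    linarith
  · linarith

lemma Cls.two_pt {x D τ : ℝ} {S : Finset Qd} (hP : Par x D τ) (h : Cls x D τ S) {q1 q : Qd} (h1 : q1 ∈ S) (hq : q ∈ S) :
    (q1.a:ℝ)*q.b-q1.b*q.a = q1.a*q.a*((q.b:ℝ)/q.a-q1.b/q1.a) ∧ D/2 ≤ (q1.a:ℝ)*q.a ∧ (q1.a:ℝ)*q.a ≤ 2*D ∧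
    |(q1.a:ℝ)*q.b-q1.b*q.a| ≤ 2*D*τ ∧
    1/2 ≤ ((q1.a:ℝ)*q.a+q1.b*q.b)/((q1.a:ℝ)^2+(q1.b:ℝ)^2) ∧ ((q1.a:ℝ)*q.a+q1.b*q.b)/((q1.a:ℝ)^2+(q1.b:ℝ)^2) ≤ 2 ∧
    (((q1.a:ℝ)*q.a+q1.b*q.b)/((q1.a:ℝ)^2+(q1.b:ℝ)^2))^2 + (((q1.a:ℝ)*q.b-q1.b*q.a)/((q1.a:ℝ)^2+(q1.b:ℝ)^2))^2
      = ((q.a:ℝ)^2+(q.b:ℝ)^2)/((q1.a:ℝ)^2+(q1.b:ℝ)^2) ∧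
    (((q1.a:ℝ)*q.b-q1.b*q.a)/((q1.a:ℝ)^2+(q1.b:ℝ)^2))^2 ≤ (2*τ)^2 ∧
    1/4 ≤ (((q1.a:ℝ)*q.a+q1.b*q.b)/((q1.a:ℝ)^2+(q1.b:ℝ)^2))^2 - (((q1.a:ℝ)*q.b-q1.b*q.a)/((q1.a:ℝ)^2+(q1.b:ℝ)^2))^2 := by
  have g := h.good q hq
  have g1 := h.good q1 h1
  exact _root_.two_pt (by exact_mod_cast g.apos) (by exact_mod_cast g1.apos) (by exact_mod_cast g.hab)
    (by exact_mod_cast g1.hab) (h.dlo q hq) (h.dhi q hq) (h.dlo q1 h1) (h.dhi q1 h1) hP.D1 hP.τ1 (h.cls q hq q1 h1)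

/-- bound for beta -/
lemma Good.beta_sq {x : ℝ} {q : Qd} (h : Good x q) (hx : 2 ≤ x) {D : ℝ} (hD : 0 < D)
    (hd : D ≤ (q.a:ℝ)^2+(q.b:ℝ)^2) : (q.u:ℝ)^2+(q.v:ℝ)^2 ≤ 5*(x/D)^2 := by
  have h1 : ((q.u:ℝ)^2+(q.v:ℝ)^2) * ((q.a:ℝ)^2+(q.b:ℝ)^2)^2 =
      (((q.a^2-q.b^2)*q.u-2*q.a*q.b*q.v : ℤ) : ℝ)^2+1 := by exact_mod_cast h.norm
  have n1 := h.n1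
  have n2 := h.n2
  set N := (((q.a^2-q.b^2)*q.u-2*q.a*q.b*q.v : ℤ) : ℝ)
  have h2 : N^2+1 ≤ 5*x^2 := by nlinarith
  have h3 : D^2 ≤ ((q.a:ℝ)^2+(q.b:ℝ)^2)^2 := pow_le_pow_left₀ hD.le hd 2
  have h4 : ((q.u:ℝ)^2+(q.v:ℝ)^2) * D^2 ≤ 5*x^2 := by
    calc _ ≤ ((q.u:ℝ)^2+(q.v:ℝ)^2) * ((q.a:ℝ)^2+(q.b:ℝ)^2)^2 := mul_le_mul_of_nonneg_left h3 (by positivity)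
      _ ≤ _ := by rw [h1]; exact h2
  rw [div_pow, ← mul_div_assoc, le_div_iff₀ (by positivity)]
  exact h4

/-- real estimates for det columns -/
lemma col_bounds {x D τ d1 g y p q : ℝ} (hP : Par x D τ) (hd1 : D ≤ d1) (hg1 : 1/2 ≤ g) (hg2 : g ≤ 2)
    (hy : |y| ≤ 2*D*τ) (hyd : (y/d1)^2 ≤ (2*τ)^2) (h14 : 1/4 ≤ g^2 - (y/d1)^2)
    (hF : g^2 * q + 2*d1*(g*y*p) - (1/d1^2)*(y^2*q) = 1) (hp : |p|  * d1 ≤ 3*x/D) :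
    |g^2*p| ≤ 12*x/D^2 ∧ |g*y*p| ≤ 12*x*τ/D ∧ |y^2*p| ≤ 12*x*τ^2 ∧
    |g*y*q+2*d1*(y^2*p)| ≤ 8*D*τ ∧ |y^2*q| ≤ 400*D^2*x*τ^3 := by
  have hD0 : 0 < D := by linarith [hP.D1]
  have hd0 : 0 < d1 := by linarith
  have hx0 : 0 < x := by linarith [hP.x100]
  have hτ0 := hP.τ0
  have hg0 : 0 < g := by linarith
  have hp' : |p|  ≤ 3*x/D^2 := by
    have h1 : |p|  * D ≤ 3*x/D := (mul_le_mul_of_nonneg_left hd1 (abs_nonneg _)).trans hp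
    rw [← le_div_iff₀ hD0] at h1
    refine h1.trans (le_of_eq ?_); field_simp
  have hg4 : g^2 ≤ 4 := by nlinarith
  have hy2 : y^2 ≤ 4*D^2*τ^2 := by
    rw [← sq_abs]; calc |y|^2 ≤ (2*D*τ)^2 := pow_le_pow_left₀ (abs_nonneg _) hy 2
      _ = _ := by ring
  have hq : |q| ≤ 100*(x*τ) := by
    have e1 : (g^2 - (y/d1)^2) * q = 1 - 2*g*y*(p*d1) := by
      have k : (g^2 - (y/d1)^2) * q + 2*g*y*(p*d1) = g^2 * q + 2*d1*(g*y*p) - (1/d1^2)*(y^2*q) := by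
        field_simp; ring
      linarith
    have e2 : |(g^2 - (y/d1)^2) * q| ≤ 1 + 24*(x*τ) := by
      rw [e1]
      have k1 : |2*g*y*(p*d1)| ≤ 24*(x*τ) := by
        rw [abs_mul, abs_mul, abs_mul, abs_mul, abs_of_pos hg0, abs_of_pos hd0]
        calc |(2:ℝ)| * g * |y| * (|p| * d1) ≤ 2*2*(2*D*τ)*(3*x/D) := by
              rw [abs_of_pos (by norm_num : (0:ℝ) < 2)]
              gcongr
          _ = 24*(x*τ) := by field_simp; ring
      have := abs_sub (1:ℝ) (2*g*y*(p*d1))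
      rw [abs_one] at this
      linarith
    rw [abs_mul, abs_of_pos (by linarith : 0 < g^2 - (y/d1)^2)] at e2
    have := mul_le_mul_of_nonneg_right h14 (abs_nonneg q)
    have := hP.xτ
    linarith
  refine ⟨?_, ?_, ?_, ?_, ?_⟩
  · rw [abs_mul, abs_of_nonneg (sq_nonneg g)]
    calc g^2* |p|  ≤ 4*(3*x/D^2) := by gcongr
      _ = _ := by ring
  · rw [abs_mul, abs_mul, abs_of_pos hg0]
    calc g* |y| * |p|  ≤ 2*(2*D*τ)*(3*x/D^2) := by gcongr
      _ = _ := by field_simp; ring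
  · rw [abs_mul, abs_of_nonneg (sq_nonneg y)]
    calc y^2* |p|  ≤ (4*D^2*τ^2)*(3*x/D^2) := by gcongr
      _ = _ := by field_simp; ring
  · have e : g*y*q+2*d1*(y^2*p) = (y/g)*(1+(y/d1)^2*q) := by
      have k : (y/g)*((g^2 * q + 2*d1*(g*y*p) - (1/d1^2)*(y^2*q))+(y/d1)^2*q) = g*y*q+2*d1*(y^2*p) := by
        field_simp; ring
      rw [← k, hF]
    rw [e, abs_mul, abs_div, abs_of_pos hg0]
    have k1 : |y|/g ≤ 4*D*τ := by
      rw [div_le_iff₀ hg0]; nlinarith [mul_pos hD0 hτ0]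
    have k2 : |1+(y/d1)^2*q| ≤ 2 := by
      have k3 : |(y/d1)^2*q| ≤ 1 := by
        rw [abs_mul, abs_of_nonneg (sq_nonneg _)]
        calc (y/d1)^2* |q| ≤ (2*τ)^2*(100*(x*τ)) := by gcongr
          _ = 400*(x*τ^3) := by ring
          _ ≤ 1 := by linarith [hP.xτ3]
      have := abs_add_le (1:ℝ) ((y/d1)^2*q)
      rw [abs_one] at this
      linarith
    calc |y| / g * |1+(y/d1)^2*q| ≤ (4*D*τ)*2 := by gcongr
      _ = _ := by ring
  · rw [abs_mul, abs_of_nonneg (sq_nonneg y)]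
    calc y^2* |q| ≤ (4*D^2*τ^2)*(100*(x*τ)) := by gcongr
      _ = _ := by ring

def vec6 (q : Qd) : Fin 3 × Fin 2 → ℤ := fun j => (![q.a^2, q.a*q.b, q.b^2] j.1) * (![q.u, q.v] j.2)

lemma Cls.det_zero {x D τ : ℝ} {S : Finset Qd} (hP : Par x D τ) (h : Cls x D τ S) (f : Fin 3 × Fin 2 → Qd)
    (hf : ∀ i, f i ∈ S) : (Matrix.of fun i j => vec6 (f i) j).det = 0 := by
  have hD0 : 0 < D := by linarith [hP.D1]
  have hx0 : 0 < x := by linarith [hP.x100]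
  set q1 := f (0,0) with hq1
  have h1 : q1 ∈ S := hf _
  set d1 : ℝ := (q1.a:ℝ)^2+(q1.b:ℝ)^2 with hd1
  have hd1D : D ≤ d1 := h.dlo q1 h1
  have hd10 : 0 < d1 := by linarith
  have key := det6 (fun i => ((f i).a:ℝ)) (fun i => ((f i).b:ℝ)) (fun i => ((f i).u:ℝ)) (fun i => ((f i).v:ℝ))
    (fun i => ((q1.a:ℝ) * (f i).a + q1.b * (f i).b)/d1) (fun i => (q1.a:ℝ) * (f i).b - q1.b * (f i).a)
    (fun i => (((q1.a:ℝ)^2-(q1.b:ℝ)^2) * (f i).u - 2*q1.a*q1.b*(f i).v)/d1^2)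
    (fun i => 2*(q1.a:ℝ)*q1.b*(f i).u + ((q1.a:ℝ)^2-(q1.b:ℝ)^2)*(f i).v) q1.a q1.b d1 hd1 hd10
    (fun _ => rfl) (fun _ => rfl) (fun _ => rfl) (fun _ => rfl)
    (12*x/D^2) (12*x*τ/D) (12*x*τ^2) (8*D*τ) (400*D^2*x*τ^3)
  have hFF : ∀ i, (((q1.a:ℝ) * (f i).a + q1.b * (f i).b)/d1)^2 * (2*(q1.a:ℝ)*q1.b*(f i).u + ((q1.a:ℝ)^2-(q1.b:ℝ)^2)*(f i).v)
      + 2*d1*((((q1.a:ℝ) * (f i).a + q1.b * (f i).b)/d1) * ((q1.a:ℝ) * (f i).b - q1.b * (f i).a) *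
        ((((q1.a:ℝ)^2-(q1.b:ℝ)^2) * (f i).u - 2*q1.a*q1.b*(f i).v)/d1^2))
      - (1/d1^2)*(((q1.a:ℝ) * (f i).b - q1.b * (f i).a)^2 * (2*(q1.a:ℝ)*q1.b*(f i).u + ((q1.a:ℝ)^2-(q1.b:ℝ)^2)*(f i).v)) = 1 := by
    intro i
    have hF : (((f i).a:ℝ)^2-((f i).b:ℝ)^2)*(f i).v+2*(f i).a*(f i).b*(f i).u = 1 := by
      exact_mod_cast (h.good _ (hf i)).hF
    refine Eq.trans ?_ hF
    field_simp
    rw [hd1]; ring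
  have hall : ∀ i, _ := fun i => col_bounds hP hd1D (h.two_pt hP h1 (hf i)).2.2.2.2.1 (h.two_pt hP h1 (hf i)).2.2.2.2.2.1
    (h.two_pt hP h1 (hf i)).2.2.2.1 (h.two_pt hP h1 (hf i)).2.2.2.2.2.2.2.1 (h.two_pt hP h1 (hf i)).2.2.2.2.2.2.2.2 (hFF i) (by
      have hb := (h.good _ (hf i)).beta_sq (by linarith [hP.x100]) hD0 (h.dlo _ (hf i))
      rw [abs_div, abs_of_pos (by positivity : 0 < d1^2)]
      have e : |((q1.a:ℝ)^2-(q1.b:ℝ)^2) * (f i).u - 2*q1.a*q1.b*(f i).v| / d1^2 * d1 =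
        |((q1.a:ℝ)^2-(q1.b:ℝ)^2) * (f i).u - 2*q1.a*q1.b*(f i).v| / d1 := by field_simp
      rw [e, div_le_iff₀ hd10]
      apply abs_le_of_sq_le_sq _ (by positivity)
      have e2 : (((q1.a:ℝ)^2-(q1.b:ℝ)^2) * (f i).u - 2*q1.a*q1.b*(f i).v)^2 ≤ (((f i).u:ℝ)^2+((f i).v:ℝ)^2)*d1^2 := by
        have : (((f i).u:ℝ)^2+((f i).v:ℝ)^2)*d1^2 = (((q1.a:ℝ)^2-(q1.b:ℝ)^2) * (f i).u - 2*q1.a*q1.b*(f i).v)^2 +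
          (2*(q1.a:ℝ)*q1.b*(f i).u + ((q1.a:ℝ)^2-(q1.b:ℝ)^2)*(f i).v)^2 := by rw [hd1]; ring
        rw [this]; linarith [sq_nonneg (2*(q1.a:ℝ)*q1.b*(f i).u + ((q1.a:ℝ)^2-(q1.b:ℝ)^2)*(f i).v)]
      have e3 : (((f i).u:ℝ)^2+((f i).v:ℝ)^2)*d1^2 ≤ 5*(x/D)^2*d1^2 := by gcongr
      have e4 : (3*x/D*d1)^2 = 9*(x/D)^2*d1^2 := by ring
      rw [e4]
      have : 0 ≤ (x/D)^2*d1^2 := by positivity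
      linarith)
  have key2 := key hFF (fun i => (hall i).1) (fun i => (hall i).2.1) (fun i => (hall i).2.2.1) (fun i => (hall i).2.2.2.1)
    (fun i => (hall i).2.2.2.2)
  have e5 : 720 * (12*x/D^2 * (12*x*τ/D) * (12*x*τ^2) * (8*D*τ) * (400*D^2*x*τ^3)) = 720*5529600 * (x^4*τ^7) := by
    field_simp; ring
  rw [e5] at key2
  have hlt : (720*5529600 * (x^4*τ^7) : ℝ) < 1 := by
    have := hP.main; norm_num at this ⊢; linarith
  have key3 := lt_of_le_of_lt key2 hlt
  have cast : (Matrix.of (fun (i : Fin 3 × Fin 2) (j : Fin 3 × Fin 2) =>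
      (![((f i).a:ℝ)^2, (f i).a * (f i).b, ((f i).b:ℝ)^2] j.1) * (![((f i).u:ℝ), (f i).v] j.2))) =
      (Matrix.of fun i j => vec6 (f i) j).map (Int.castRingHom ℝ) := by
    ext i ⟨j, k⟩
    simp only [Matrix.of_apply, Matrix.map_apply, vec6]
    fin_cases j <;> fin_cases k <;> simp
  rw [cast, ← RingHom.mapMatrix_apply, ← RingHom.map_det] at key3
  simp only [eq_intCast] at key3
  have key4 : |(Matrix.of fun i j => vec6 (f i) j).det| < 1 := by exact_mod_cast key3
  exact Int.abs_lt_one_iff.1 key4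


/-- a polynomial of degree at most 4 bounded at five well separated points has small coefficients (normalised). -/
lemma poly_small_norm (κ : ℝ) (hκ : 1 ≤ κ) (z : Fin 5 → ℝ) (z0 : z 0 = 0) (hz : ∀ i, |z i| ≤ κ)
    (hs : ∀ i j, i ≠ j → 1 ≤ |z i - z j|) (s1 s2 s3 s4 : ℝ)
    (hw : ∀ i, |1 + s1 * z i + s2 * z i^2 + s3 * z i^3 + s4 * z i^4| ≤ 16) :
    |s1| ≤ 2100*κ^3 ∧ |s2| ≤ 2100*κ^3 ∧ |s3| ≤ 2100*κ^3 ∧ |s4| ≤ 2100*κ^3 := by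
  have divb : ∀ {f w B : ℝ}, 1 ≤ |w| → |w * f| ≤ B → |f| ≤ B := by
    intro f w B h1 h2
    rw [abs_mul] at h2
    nlinarith [abs_nonneg f]
  have n0 : ∀ i, i ≠ 0 → 1 ≤ |z i| := by
    intro i hi
    have := hs i 0 hi
    rwa [z0, sub_zero] at this
  have f1 : ∀ i, i ≠ 0 → |s1 + s2 * z i + s3 * z i^2 + s4 * z i^3| ≤ 17 := by
    intro i hi
    apply divb (n0 i hi)
    have := hw i
    have e : z i * (s1 + s2 * z i + s3 * z i^2 + s4 * z i^3) =
      (1 + s1 * z i + s2 * z i^2 + s3 * z i^3 + s4 * z i^4) - 1 := by ring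
    rw [e]
    have h2 := abs_sub (1 + s1 * z i + s2 * z i^2 + s3 * z i^3 + s4 * z i^4) 1
    rw [abs_one] at h2
    linarith
  have f2 : ∀ i, i ≠ 0 → i ≠ 1 → |s2 + s3 * (z i + z 1) + s4 * (z i^2 + z i * z 1 + z 1^2)| ≤ 34 := by
    intro i hi hi1
    apply divb (hs i 1 hi1)
    have e : (z i - z 1) * (s2 + s3 * (z i + z 1) + s4 * (z i^2 + z i * z 1 + z 1^2)) =
      (s1 + s2 * z i + s3 * z i^2 + s4 * z i^3) - (s1 + s2 * z 1 + s3 * z 1^2 + s4 * z 1^3) := by ring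
    rw [e]
    have h2 := abs_sub (s1 + s2 * z i + s3 * z i^2 + s4 * z i^3) (s1 + s2 * z 1 + s3 * z 1^2 + s4 * z 1^3)
    have h3 := f1 i hi
    have h4 := f1 1 (by decide)
    linarith
  have f3 : ∀ i, i ≠ 0 → i ≠ 1 → i ≠ 2 → |s3 + s4 * (z i + z 1 + z 2)| ≤ 68 := by
    intro i hi hi1 hi2
    apply divb (hs i 2 hi2)
    have e : (z i - z 2) * (s3 + s4 * (z i + z 1 + z 2)) =
      (s2 + s3 * (z i + z 1) + s4 * (z i^2 + z i * z 1 + z 1^2)) - 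
      (s2 + s3 * (z 2 + z 1) + s4 * (z 2^2 + z 2 * z 1 + z 1^2)) := by ring
    rw [e]
    have h2 := abs_sub (s2 + s3 * (z i + z 1) + s4 * (z i^2 + z i * z 1 + z 1^2))
      (s2 + s3 * (z 2 + z 1) + s4 * (z 2^2 + z 2 * z 1 + z 1^2))
    have h3 := f2 i hi hi1
    have h4 := f2 2 (by decide) (by decide)
    linarith
  have f4 : |s4| ≤ 136 := by
    apply divb (hs 4 3 (by decide))
    have e : (z 4 - z 3) * s4 = (s3 + s4 * (z 4 + z 1 + z 2)) - (s3 + s4 * (z 3 + z 1 + z 2)) := by ring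
    rw [e]
    have h2 := abs_sub (s3 + s4 * (z 4 + z 1 + z 2)) (s3 + s4 * (z 3 + z 1 + z 2))
    have h3 := f3 4 (by decide) (by decide) (by decide)
    have h4 := f3 3 (by decide) (by decide) (by decide)
    linarith
  have tri : ∀ {A B c d : ℝ}, |A + B| ≤ c → |B| ≤ d → |A| ≤ c + d := by
    intro A B c d h1 h2
    have := abs_sub (A+B) B
    rw [add_sub_cancel_right] at this
    linarith
  have mulb : ∀ {A B c d : ℝ}, |A| ≤ c → |B| ≤ d → |A*B| ≤ c*d := by
    intro A B c d h1 h2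
    rw [abs_mul]
    exact mul_le_mul h1 h2 (abs_nonneg _) ((abs_nonneg _).trans h1)
  have addb : ∀ {A B c d : ℝ}, |A| ≤ c → |B| ≤ d → |A+B| ≤ c+d := by
    intro A B c d h1 h2
    have := abs_add_le A B
    linarith
  have g3 : |s3| ≤ 68 + 136*(κ+κ+κ) :=
    tri (f3 3 (by decide) (by decide) (by decide)) (mulb f4 (addb (addb (hz _) (hz _)) (hz _)))
  have g2 : |s2| ≤ 34 + ((68 + 136*(κ+κ+κ))*(κ+κ) + 136*(κ*κ+κ*κ+κ*κ)) := by
    have := f2 2 (by decide) (by decide)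
    rw [add_assoc, sq, sq] at this
    exact tri this (addb (mulb g3 (addb (hz _) (hz _))) (mulb f4 (addb (addb (mulb (hz _) (hz _)) (mulb (hz _) (hz _))) (mulb (hz _) (hz _)))))
  have g1 : |s1| ≤ 17 + ((34 + ((68 + 136*(κ+κ+κ))*(κ+κ) + 136*(κ*κ+κ*κ+κ*κ)))*κ + ((68 + 136*(κ+κ+κ))*(κ*κ) + 136*(κ*κ*κ))) := by
    have := f1 1 (by decide)
    rw [add_assoc, add_assoc, sq, pow_three'] at this
    exact tri this (addb (mulb g2 (hz _)) (addb (mulb g3 (mulb (hz _) (hz _))) (mulb f4 (mulb (mulb (hz _) (hz _)) (hz _)))))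
  have k2 : κ ≤ κ^2 := by nlinarith
  have k3 : κ^2 ≤ κ^3 := by nlinarith
  ring_nf at g1 g2 g3
  refine ⟨?_, ?_, ?_, ?_⟩ <;> nlinarith

lemma poly_small (κ δ : ℝ) (hκ : 1 ≤ κ) (hδ : 2100000*κ^3 ≤ δ) (ψ : Fin 5 → ℝ) (z0 : ψ 0 = 0)
    (hz : ∀ i j, |ψ i - ψ j| ≤ κ*δ)
    (hs : ∀ i j, i ≠ j → δ ≤ |ψ i - ψ j|) (r1 r2 r3 r4 : ℝ)
    (hw : ∀ i, |1 + r1 * ψ i + r2 * ψ i^2 + r3 * ψ i^3 + r4 * ψ i^4| ≤ 16) :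
    |r1| ≤ 1/1000 ∧ |r2| ≤ 1/1000 ∧ |r3| ≤ 1/1000 ∧ |r4| ≤ 1/1000 := by
  have hκ3 : 1 ≤ κ^3 := one_le_pow₀ hκ
  have hδ1 : 1 ≤ δ := by linarith
  have hδ0 : 0 < δ := by linarith
  have hne := hδ0.ne'
  obtain ⟨h1, h2, h3, h4⟩ := poly_small_norm κ hκ (fun i => ψ i / δ) (by simp [z0])
    (by intro i
        have := hz i 0
        rw [z0, sub_zero] at this
        simp only [abs_div, abs_of_pos hδ0]
        rwa [div_le_iff₀ hδ0])
    (by intro i j hij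
        rw [← sub_div, abs_div, abs_of_pos hδ0, le_div_iff₀ hδ0, one_mul]
        exact hs i j hij) (r1*δ) (r2*δ^2) (r3*δ^3) (r4*δ^4)
    (by intro i
        have := hw i
        convert this using 2
        field_simp)
  have key : ∀ {r : ℝ} {w : ℝ}, δ ≤ w → |r*w| ≤ 2100*κ^3 → |r| ≤ 1/1000 := by
    intro r w hw h
    rw [abs_mul, abs_of_pos (lt_of_lt_of_le hδ0 hw)] at h
    have : |r| * δ ≤ 1/1000 * δ := by
      have := mul_le_mul_of_nonneg_left hw (abs_nonneg r)
      linarith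
    exact le_of_mul_le_mul_right this hδ0
  exact ⟨key le_rfl h1, key (le_self_pow₀ hδ1 (by norm_num)) h2, key (le_self_pow₀ hδ1 (by norm_num)) h3,
    key (le_self_pow₀ hδ1 (by norm_num)) h4⟩

/-- the geometry delivered by the selection step -/
structure Geo (X Y : Fin 5 → ℤ) (s κ δ : ℝ) : Prop where
  κ1 : 1 ≤ κ
  hδ : 2100000*κ^3 ≤ δ
  X0 : X 0 = 1
  Y0 : Y 0 = 0
  g1 : ∀ i, 1/2 ≤ X i + s * Y i
  g2 : ∀ i, X i + s * Y i ≤ 2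
  up : ∀ i j, |Y i / (X i + s * Y i) - Y j / (X j + s * Y j)| ≤ κ*δ
  lo : ∀ i j, i ≠ j → δ ≤ |Y i / (X i + s * Y i) - Y j / (X j + s * Y j)|

lemma int_zero_of_small {n : ℤ} {r : ℝ} (h : (n:ℝ) = r) (h1 : |r| < 1) : n = 0 := by
  rw [← h] at h1
  exact Int.abs_lt_one_iff.1 (by exact_mod_cast h1)

lemma rigid4 {X Y : Fin 5 → ℤ} {s κ δ : ℝ} (G : Geo X Y s κ δ) (h1 h2 h3 h4 : ℤ)
    (hH : ∀ i, X i^4 + h1 * X i^3 * Y i + h2 * X i^2 * Y i^2 + h3 * X i * Y i^3 + h4 * Y i^4 = 1) :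
    ∃ ρ : ℤ, h1 = 4*ρ ∧ h2 = 6*ρ^2 ∧ h3 = 4*ρ^3 ∧ h4 = ρ^4 := by
  obtain ⟨b1, b2, b3, b4⟩ := poly_small κ δ G.κ1 G.hδ (fun i => Y i / (X i + s * Y i)) (by simp [G.Y0]) G.up G.lo
    (h1 - 4*s) (h2 - 3*h1*s + 6*s^2) (h3 - 2*h2*s + 3*h1*s^2 - 4*s^3) (h4 - h3*s + h2*s^2 - h1*s^3 + s^4)
    (by
      intro i
      have g1 := G.g1 i
      have g0 : 0 < X i + s * Y i := by linarith
      have hi : (X i:ℝ)^4 + h1 * X i^3 * Y i + h2 * X i^2 * Y i^2 + h3 * X i * Y i^3 + h4 * Y i^4 = 1 := by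
        exact_mod_cast hH i
      have e : 1 + (h1 - 4*s) * (Y i / (X i + s * Y i)) + (h2 - 3*h1*s + 6*s^2) * (Y i / (X i + s * Y i))^2 
        + (h3 - 2*h2*s + 3*h1*s^2 - 4*s^3) * (Y i / (X i + s * Y i))^3 
        + (h4 - h3*s + h2*s^2 - h1*s^3 + s^4) * (Y i / (X i + s * Y i))^4 = 1/(X i + s * Y i)^4 := by
        rw [eq_div_iff (by positivity)]
        refine Eq.trans ?_ hi
        set g := (X i + s * Y i:ℝ) with hg
        have hX : (X i : ℝ) = g - s * Y i := by rw [hg]; ring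
        rw [hX]
        field_simp
        ring
      rw [e, abs_of_pos (by positivity), div_le_iff₀ (by positivity)]
      have := pow_le_pow_left₀ (by norm_num) g1 4
      norm_num at this ⊢
      linarith)
  set r1 := (h1 - 4*s : ℝ)
  set r2 := (h2 - 3*h1*s + 6*s^2 : ℝ)
  set r3 := (h3 - 2*h2*s + 3*h1*s^2 - 4*s^3 : ℝ)
  set r4 := (h4 - h3*s + h2*s^2 - h1*s^3 + s^4 : ℝ)
  have mulb : ∀ {A B c d : ℝ}, |A| ≤ c → |B| ≤ d → |A*B| ≤ c*d := by
    intro A B c d h1 h2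
    rw [abs_mul]
    exact mul_le_mul h1 h2 (abs_nonneg _) ((abs_nonneg _).trans h1)
  have m11 := abs_le.1 (mulb b1 b1)
  have m12 := abs_le.1 (mulb b1 b2)
  have m13 := abs_le.1 (mulb b1 b3)
  have m111 := abs_le.1 (mulb (mulb b1 b1) b1)
  have m112 := abs_le.1 (mulb (mulb b1 b1) b2)
  have m1111 := abs_le.1 (mulb (mulb b1 b1) (mulb b1 b1))
  have q2 : 8*h2 - 3*h1^2 = 0 := by
    apply int_zero_of_small (r := 8*r2 - 3*(r1*r1))
    · simp only [r1, r2]; push_cast; ring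
    · rw [abs_lt]; rw [abs_le] at b2; constructor <;> linarith
  have q3 : 8*h3 - 4*h1*h2 + h1^3 = 0 := by
    apply int_zero_of_small (r := 8*r3 - 4*(r1*r2) + (r1*r1*r1))
    · simp only [r1, r2, r3]; push_cast; ring
    · rw [abs_lt]; rw [abs_le] at b3; constructor <;> linarith
  have q4 : 256*h4 - 64*h1*h3 + 16*h1^2*h2 - 3*h1^4 = 0 := by
    apply int_zero_of_small (r := 256*r4 - 64*(r1*r3) + 16*(r1*r1*r2) - 3*(r1*r1*(r1*r1)))
    · simp only [r1, r2, r3, r4]; push_cast; ring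
    · rw [abs_lt]; rw [abs_le] at b4; constructor <;> linarith
  have h1e : ∃ w, h1 = 2*w := by
    have : Even (3*h1^2) := ⟨4*h2, by linarith⟩
    rw [Int.even_mul, Int.even_pow] at this
    rcases this with h | h
    · exact absurd h (by decide)
    · obtain ⟨w, hw⟩ := h.1; exact ⟨w, by linarith⟩
  obtain ⟨w, rfl⟩ := h1e
  have h2e : ∃ ρ, w = 2*ρ := by
    have : Even (3*w^2) := ⟨h2, by nlinarith⟩
    rw [Int.even_mul, Int.even_pow] at this
    rcases this with h | h
    · exact absurd h (by decide)
    · obtain ⟨w, hw⟩ := h.1; exact ⟨w, by linarith⟩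
  obtain ⟨ρ, rfl⟩ := h2e
  have e2 : h2 = 6*ρ^2 := by linarith
  subst e2
  have e3 : h3 = 4*ρ^3 := by linarith
  subst e3
  exact ⟨ρ, by ring, rfl, rfl, by linarith⟩

lemma rigid3 {X Y : Fin 5 → ℤ} {s κ δ : ℝ} (G : Geo X Y s κ δ) (h1 h2 h3 : ℤ)
    (hH : ∀ i, X i^3 + h1 * X i^2 * Y i + h2 * X i * Y i^2 + h3 * Y i^3 = 1) :
    ∃ ρ : ℤ, h1 = 3*ρ ∧ h2 = 3*ρ^2 ∧ h3 = ρ^3 := by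
  obtain ⟨b1, b2, b3, -⟩ := poly_small κ δ G.κ1 G.hδ (fun i => Y i / (X i + s * Y i)) (by simp [G.Y0]) G.up G.lo
    (h1 - 3*s) (h2 - 2*h1*s + 3*s^2) (h3 - h2*s + h1*s^2 - s^3) 0
    (by
      intro i
      have g1 := G.g1 i
      have g0 : 0 < X i + s * Y i := by linarith
      have hi : (X i:ℝ)^3 + h1 * X i^2 * Y i + h2 * X i * Y i^2 + h3 * Y i^3 = 1 := by
        exact_mod_cast hH i
      have e : 1 + (h1 - 3*s) * (Y i / (X i + s * Y i)) + (h2 - 2*h1*s + 3*s^2) * (Y i / (X i + s * Y i))^2 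
        + (h3 - h2*s + h1*s^2 - s^3) * (Y i / (X i + s * Y i))^3 
        + 0 * (Y i / (X i + s * Y i))^4 = 1/(X i + s * Y i)^3 := by
        rw [eq_div_iff (by positivity)]
        refine Eq.trans ?_ hi
        set g := (X i + s * Y i:ℝ) with hg
        have hX : (X i : ℝ) = g - s * Y i := by rw [hg]; ring
        rw [hX]
        field_simp
        ring
      rw [e, abs_of_pos (by positivity), div_le_iff₀ (by positivity)]
      have := pow_le_pow_left₀ (by norm_num) g1 3
      norm_num at this ⊢
      linarith)
  set r1 := (h1 - 3*s : ℝ)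
  set r2 := (h2 - 2*h1*s + 3*s^2 : ℝ)
  set r3 := (h3 - h2*s + h1*s^2 - s^3 : ℝ)
  have mulb : ∀ {A B c d : ℝ}, |A| ≤ c → |B| ≤ d → |A*B| ≤ c*d := by
    intro A B c d h1 h2
    rw [abs_mul]
    exact mul_le_mul h1 h2 (abs_nonneg _) ((abs_nonneg _).trans h1)
  have m11 := abs_le.1 (mulb b1 b1)
  have m12 := abs_le.1 (mulb b1 b2)
  have m111 := abs_le.1 (mulb (mulb b1 b1) b1)
  have q2 : 3*h2 - h1^2 = 0 := by
    apply int_zero_of_small (r := 3*r2 - (r1*r1))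
    · simp only [r1, r2]; push_cast; ring
    · rw [abs_lt]; rw [abs_le] at b2; constructor <;> linarith
  have q3 : 27*h3 - 9*h1*h2 + 2*h1^3 = 0 := by
    apply int_zero_of_small (r := 27*r3 - 9*(r1*r2) + 2*(r1*r1*r1))
    · simp only [r1, r2, r3]; push_cast; ring
    · rw [abs_lt]; rw [abs_le] at b3; constructor <;> linarith
  have h1e : (3:ℤ) ∣ h1 := Int.prime_three.dvd_of_dvd_pow (n := 2) ⟨h2, by linarith⟩
  obtain ⟨ρ, rfl⟩ := h1e
  have e2 : h2 = 3*ρ^2 := by linarith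
  subst e2
  exact ⟨ρ, rfl, rfl, by linarith⟩


lemma lattice_basis (Λ : AddSubgroup (ℤ × ℤ)) (a0 b0 : ℤ) (h0 : (a0, b0) ∈ Λ) (hc : IsCoprime a0 b0)
    (hne : ∃ l ∈ Λ, a0 * l.2 - b0 * l.1 ≠ 0) :
    ∃ f ∈ Λ, ∃ L : ℤ, 0 < L ∧ a0 * f.2 - b0 * f.1 = L ∧ 
      ∀ l ∈ Λ, ∃ X Y : ℤ, l.1 = X * a0 + Y * f.1 ∧ l.2 = X * b0 + Y * f.2 := by
  let φ : ℤ × ℤ →+ ℤ := AddMonoidHom.mk' (fun l => a0 * l.2 - b0 * l.1) (by intro x y; simp; ring)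
  have hφ : ∀ l, φ l = a0 * l.2 - b0 * l.1 := fun l => rfl
  obtain ⟨g, hg⟩ := Int.subgroup_cyclic (Λ.map φ)
  have hg' : ∀ z, z ∈ Λ.map φ ↔ ∃ n : ℤ, n • g = z := by
    intro z; rw [hg]; exact AddSubgroup.mem_closure_singleton
  obtain ⟨f, hf, hfg⟩ : ∃ f ∈ Λ, φ f = g := by
    have := (hg' g).2 ⟨1, by simp⟩
    simpa using this
  have hg0 : g ≠ 0 := by
    rintro rfl
    obtain ⟨l, hl, hl'⟩ := hne
    obtain ⟨n, hn⟩ := (hg' (φ l)).1 (AddSubgroup.mem_map_of_mem _ hl)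
    apply hl'
    rw [← hφ, ← hn]; simp
  have main : ∀ f ∈ Λ, (φ f = g ∨ φ f = -g) → ∀ l ∈ Λ, ∃ X Y : ℤ, l.1 = X * a0 + Y * f.1 ∧ l.2 = X * b0 + Y * f.2 := by
    intro f hf hfg l hl
    obtain ⟨n, hn⟩ := (hg' (φ l)).1 (AddSubgroup.mem_map_of_mem _ hl)
    obtain ⟨Y, hY⟩ : ∃ Y, φ l = Y * φ f := by
      rcases hfg with h | h
      · exact ⟨n, by rw [h, ← hn]; simp⟩
      · exact ⟨-n, by rw [h, ← hn]; simp⟩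
    rw [hφ, hφ] at hY
    have e : a0 * (l.2 - Y * f.2) = b0 * (l.1 - Y * f.1) := by linear_combination hY
    have hd : a0 ∣ l.1 - Y * f.1 := hc.dvd_of_dvd_mul_left ⟨_, e.symm⟩
    obtain ⟨r, s, hrs⟩ := hc
    -- X = r*(l.1 - Y f.1) + s*(l.2 - Y f.2)
    refine ⟨r * (l.1 - Y * f.1) + s * (l.2 - Y * f.2), Y, ?_, ?_⟩
    · linear_combination (-(l.1 - Y*f.1)) * hrs - s * e
    · linear_combination (-(l.2 - Y*f.2)) * hrs + r * e
  rcases lt_or_gt_of_ne hg0 with h | h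
  · refine ⟨-f, Λ.neg_mem hf, -g, by omega, ?_, main _ (Λ.neg_mem hf) (Or.inr (by rw [map_neg, hfg]))⟩
    rw [← hfg, ← map_neg, hφ]
  · exact ⟨f, hf, g, h, by rw [← hfg, hφ], main _ hf (Or.inl hfg)⟩

lemma Cls.sep {x D τ : ℝ} {S : Finset Qd} (hP : Par x D τ) (h : Cls x D τ S) {L : ℤ} (hL : 0 < L) {q q' : Qd} (hq : q ∈ S)
    (hq' : q' ∈ S) (hne : q ≠ q') (hd : L ∣ q.a * q'.b - q'.a * q.b) :
    (L:ℝ)/(2*D) ≤ |(q.b:ℝ)/q.a - (q'.b:ℝ)/q'.a| := by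
  have h0 : q.a * q'.b - q'.a * q.b ≠ 0 := fun e => hne (delta_zero (h.good q hq) (h.good q' hq') e)
  have h1 : L ≤ |q.a * q'.b - q'.a * q.b| := Int.le_of_dvd (abs_pos.2 h0) ((dvd_abs _ _).2 hd)
  have hD0 : 0 < D := by linarith [hP.D1]
  obtain ⟨e1, e2, e3, -⟩ := h.two_pt hP hq hq'
  have h2 : (L:ℝ) ≤ |(q.a:ℝ) * q'.b - q.b * q'.a| := by
    have : ((L:ℤ):ℝ) ≤ ((|q.a * q'.b - q'.a * q.b| : ℤ):ℝ) := by exact_mod_cast h1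
    push_cast at this
    rwa [mul_comm (q.b:ℝ)]
  rw [e1, abs_mul, abs_of_pos (by linarith : (0:ℝ) < q.a * q'.a), abs_sub_comm] at h2
  rw [div_le_iff₀ (by positivity)]
  have := mul_le_mul_of_nonneg_right e3 (abs_nonneg ((q.b:ℝ)/q.a - (q'.b:ℝ)/q'.a))
  linarith

set_option maxHeartbeats 1600000 in
lemma geom {x D τ : ℝ} {S : Finset Qd} (hP : Par x D τ) (hC : Cls x D τ S) (Λ : AddSubgroup (ℤ × ℤ))
    (hΛ : ∀ q ∈ S, (q.a, q.b) ∈ Λ) (Z J : ℕ) (hZ : 0 < Z) (hJ : 2*D*τ ≤ (Z:ℝ)^J) 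
    (hcard : 9^J*(10^13*Z^4+1) < S.card) :
    ∃ (p : Fin 5 → Qd) (f : ℤ × ℤ) (L : ℤ) (X Y : Fin 5 → ℤ) (s κ δ : ℝ), (∀ i, p i ∈ S) ∧ f ∈ Λ ∧ 0 < L ∧ 
      (p 0).a*f.2-(p 0).b*f.1=L ∧ (L:ℝ) ≤ 2*D*τ ∧ 
      (∀ i, (p i).a = X i*(p 0).a+Y i*f.1 ∧ (p i).b=X i*(p 0).b+Y i*f.2) ∧ (∀ i, i ≠ 0 → Y i ≠ 0) ∧ Geo X Y s κ δ := by
  have hD0 : 0 < D := by linarith [hP.D1]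
  have hZ1 : (1:ℝ) ≤ Z := by exact_mod_cast hZ
  have hSne : S.Nonempty := Finset.card_pos.1 (by omega)
  obtain ⟨qm, hqm, hmin⟩ := Finset.exists_min_image S (fun q => (q.b:ℝ)/q.a) hSne
  obtain ⟨l, hl, S', hS', hK, hdiam, p, hp, hpsep⟩ := select (fun q : Qd => (q.b:ℝ)/q.a) (1/(2*D)) Z (10^13*Z^4+1) hZ (by omega)
    J S ((qm.b:ℝ)/qm.a) τ (fun q hq => ⟨hmin q hq, by
      have := (abs_lt.1 (hC.cls q hq qm hqm)).2; linarith⟩) hP.τ0 (by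
      rw [one_div, inv_mul_eq_div, le_div_iff₀ (by positivity)]; linarith) (fun q hq q' hq' hne => by
      have := hC.sep hP one_pos hq hq' hne (one_dvd _)
      exact_mod_cast this) hcard
  have hpS : ∀ i, p i ∈ S := fun i => hS' (hp i)
  have hl0 : 0 < l / Z := by positivity
  have pne : ∀ k m, k ≠ m → p k ≠ p m := by
    intro k m hkm e
    have := hpsep k m hkm
    rw [e, sub_self, abs_zero] at this
    linarith
  set q0 := p 0 with hq0
  have g0 := hC.good q0 (hpS 0)
  have hnz : ∀ i, i ≠ 0 → q0.a * (p i).b - (p i).a * q0.b ≠ 0 := fun i hi e =>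
    pne 0 i hi.symm (delta_zero g0 (hC.good _ (hpS i)) e)
  obtain ⟨f, hf, L, hL, hfL, hspan⟩ := lattice_basis Λ q0.a q0.b (hΛ _ (hpS 0)) g0.cop
    ⟨_, hΛ _ (hpS 1), by have := hnz 1 (by decide); simpa [mul_comm] using this⟩
  have hXY : ∀ i, ∃ XY : ℤ × ℤ, (p i).a = XY.1*q0.a+XY.2*f.1 ∧ (p i).b=XY.1*q0.b+XY.2*f.2 := by
    intro i
    obtain ⟨X, Y, h1, h2⟩ := hspan _ (hΛ _ (hpS i))
    exact ⟨(X, Y), h1, h2⟩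
  choose XY hXY using hXY
  have hLR : (0:ℝ) < L := by exact_mod_cast hL
  have hdvd : ∀ q ∈ S', ∀ q' ∈ S', L ∣ q.a * q'.b - q'.a * q.b := by
    intro q hq q' hq'
    obtain ⟨X, Y, h1, h2⟩ := hspan _ (hΛ _ (hS' hq))
    obtain ⟨X', Y', h1', h2'⟩ := hspan _ (hΛ _ (hS' hq'))
    simp only at h1 h2 h1' h2'
    refine ⟨X*Y'-X'*Y, ?_⟩
    rw [h1, h2, h1', h2', ← hfL]; ring
  have hsc := sep_count (fun q : Qd => (q.b:ℝ)/q.a) (L/(2*D)) l (by positivity) S' ⟨_, hp 0⟩ 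
    (fun q hq q' hq' => hdiam q hq q' hq') (fun q hq q' hq' hne => hC.sep hP hL (hS' hq) (hS' hq') hne (hdvd q hq q' hq'))
  have hDl : (10:ℝ)^13*Z^4 ≤ 2 * (D*l/L) := by
    have h1 : (10:ℝ)^13*Z^4 ≤ (S'.card:ℝ)-1 := by
      have : ((10^13*Z^4+1 : ℕ):ℝ) ≤ (S'.card:ℝ) := by exact_mod_cast hK
      push_cast at this; linarith
    have h2 : (10:ℝ)^13*Z^4 * (L/(2*D)) ≤ l := (mul_le_mul_of_nonneg_right h1 (by positivity)).trans hsc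
    rw [← le_div_iff₀ (by positivity)] at h2
    refine h2.trans (le_of_eq ?_)
    field_simp
  have hLT : (L:ℝ) ≤ 2*D*τ := by
    have h1 : L ≤ |q0.a * (p 1).b - (p 1).a * q0.b| := Int.le_of_dvd (abs_pos.2 (hnz 1 (by decide))) ((dvd_abs _ _).2 (hdvd _ (hp 0) _ (hp 1)))
    have h2 := (hC.two_pt hP (hpS 0) (hpS 1)).2.2.2.1
    have : ((L:ℤ):ℝ) ≤ ((|q0.a * (p 1).b - (p 1).a * q0.b| : ℤ):ℝ) := by exact_mod_cast h1
    push_cast at this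
    rw [mul_comm ((p 1).a:ℝ)] at this
    linarith
  have hdelta : ∀ i j, (p i).a * (p j).b - (p i).b * (p j).a = L * ((XY i).1 * (XY j).2 - (XY j).1 * (XY i).2) := by
    intro i j
    rw [(hXY i).1, (hXY i).2, (hXY j).1, (hXY j).2, ← hfL]; ring
  have hd0 : 0 < (q0.a:ℝ)^2+(q0.b:ℝ)^2 := by linarith [hC.dlo _ (hpS 0)]
  set s : ℝ := (q0.a * f.1 + q0.b * f.2)/((q0.a:ℝ)^2+(q0.b:ℝ)^2) with hs
  have hg : ∀ i, ((XY i).1:ℝ) + s * (XY i).2 = ((q0.a:ℝ)*(p i).a+q0.b*(p i).b)/((q0.a:ℝ)^2+(q0.b:ℝ)^2) := by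
    intro i
    rw [eq_div_iff hd0.ne', hs]
    have h1 : ((p i).a:ℝ) = (XY i).1*q0.a+(XY i).2*f.1 := by exact_mod_cast (hXY i).1
    have h2 : ((p i).b:ℝ) = (XY i).1*q0.b+(XY i).2*f.2 := by exact_mod_cast (hXY i).2
    rw [h1, h2]
    field_simp
    ring
  have hg1 : ∀ i, 1/2 ≤ ((XY i).1:ℝ) + s * (XY i).2 := fun i => by
    rw [hg]; exact (hC.two_pt hP (hpS 0) (hpS i)).2.2.2.2.1
  have hg2 : ∀ i, ((XY i).1:ℝ) + s * (XY i).2 ≤ 2 := fun i => by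
    rw [hg]; exact (hC.two_pt hP (hpS 0) (hpS i)).2.2.2.2.2.1
  have Y0 : (XY 0).2 = 0 := by
    have := hdelta 0 0
    have h1 := (hXY 0).1; have h2 := (hXY 0).2
    have : L * (XY 0).2 = 0 := by rw [← hfL]; linear_combination q0.b * h1 - q0.a * h2
    rcases mul_eq_zero.1 this with h | h
    · omega
    · exact h
  have X0 : (XY 0).1 = 1 := by
    have h1 := (hXY 0).1
    rw [Y0, zero_mul, add_zero] at h1
    have : q0.a ≠ 0 := g0.apos.ne'
    apply mul_right_cancel₀ this
    rw [← h1, one_mul]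
  have hYn : ∀ i, i ≠ 0 → (XY i).2 ≠ 0 := by
    intro i hi e
    have := hdelta 0 i
    rw [X0, Y0, e] at this
    apply hnz i hi
    rw [mul_comm (p i).a]
    simpa using this
  -- distances
  have hdist : ∀ i j, D * |((p i).b:ℝ)/(p i).a - ((p j).b:ℝ)/(p j).a| ≤ 
      8 * (L * |((XY i).2:ℝ) / ((XY i).1 + s * (XY i).2) - (XY j).2 / ((XY j).1 + s * (XY j).2)|) ∧ 
      L * |((XY i).2:ℝ) / ((XY i).1 + s * (XY i).2) - (XY j).2 / ((XY j).1 + s * (XY j).2)| ≤ 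
      8 * (D * |((p i).b:ℝ)/(p i).a - ((p j).b:ℝ)/(p j).a|) := by
    intro i j
    obtain ⟨e1, e2, e3, -⟩ := hC.two_pt hP (hpS i) (hpS j)
    have hgi := hg1 i
    have hgj := hg1 j
    have hgi2 := hg2 i
    have hgj2 := hg2 j
    have hdR : ((p i).a:ℝ) * (p j).b - (p i).b * (p j).a = L * ((XY i).1 * (XY j).2 - (XY j).1 * (XY i).2) := by
      exact_mod_cast hdelta i j
    set gi := ((XY i).1:ℝ) + s * (XY i).2 with hgi'
    set gj := ((XY j).1:ℝ) + s * (XY j).2 with hgj'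
    have e4 : L * (((XY i).1:ℝ) * (XY j).2 - (XY j).1 * (XY i).2) = -(L * (gi * gj) * ((XY i).2 / gi - (XY j).2/gj)) := by
      have hi0 : gi ≠ 0 := by linarith
      have hj0 : gj ≠ 0 := by linarith
      have : ((XY i).1:ℝ) = gi - s * (XY i).2 := by rw [hgi']; ring
      have h' : ((XY j).1:ℝ) = gj - s * (XY j).2 := by rw [hgj']; ring
      rw [this, h']
      field_simp
      ring
    rw [hdR, e4] at e1
    have e5 := congrArg abs e1
    have hgg : (0:ℝ) < gi * gj := by apply mul_pos <;> linarith
    rw [abs_neg, abs_mul, abs_mul, abs_mul (_*_), abs_of_pos hLR, abs_of_pos hgg, abs_of_pos (by linarith : (0:ℝ) < (p i).a * (p j).a),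
      abs_sub_comm (((p j).b:ℝ)/_)] at e5
    set A := |((XY i).2:ℝ) / gi - (XY j).2/gj| with hA
    set B := |((p i).b:ℝ)/(p i).a - ((p j).b:ℝ)/(p j).a| with hB
    have hA0 : 0 ≤ L * A := mul_nonneg hLR.le (abs_nonneg _)
    have hB0 : 0 ≤ B := abs_nonneg _
    have k1 : 1/4 ≤ gi*gj := by nlinarith
    have k2 : gi*gj ≤ 4 := by nlinarith
    have k3 := mul_le_mul_of_nonneg_right k1 hA0
    have k4 := mul_le_mul_of_nonneg_right k2 hA0
    have k5 := mul_le_mul_of_nonneg_right e2 hB0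
    have k6 := mul_le_mul_of_nonneg_right e3 hB0
    have e6 : gi*gj*(L*A) = (p i).a * (p j).a * B := by rw [← e5]; ring
    constructor <;> linarith
  refine ⟨p, f, L, fun i => (XY i).1, fun i => (XY i).2, s, 64*Z, D*l/(8*L*Z), hpS, hf, hL, hfL, hLT, hXY, hYn, 
    ⟨by linarith, ?_, X0, Y0, hg1, hg2, ?_, ?_⟩⟩
  · have hZ0 : (0:ℝ) < Z := by linarith
    have : D*l/(8*L*Z) = (D*l/L)/(8*Z) := by field_simp
    rw [this, le_div_iff₀ (by positivity)]
    have h4 : (0:ℝ) < (Z:ℝ)^4 := by positivity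
    calc 2100000*(64*(Z:ℝ))^3*(8*Z) = (2100000*64^3*8)*(Z:ℝ)^4 := by ring
      _ ≤ 10^13/2*(Z:ℝ)^4 := by gcongr; norm_num
      _ ≤ D*l/L := by linarith
  · intro i j
    have h1 := (hdist i j).2
    have h2 := hdiam _ (hp i) _ (hp j)
    have h3 := mul_le_mul_of_nonneg_left h2 hD0.le
    have e : 64*(Z:ℝ)*(D*l/(8*L*Z)) = 8*(D*l)/L := by field_simp; ring
    rw [e, le_div_iff₀ hLR]
    linarith
  · intro i j hij
    have h1 := (hdist i j).1
    have h2 := hpsep i j hij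
    have h3 := mul_le_mul_of_nonneg_left h2 hD0.le
    have e : D*l/(8*L*Z) = (D*(l/Z))/(8*L) := by field_simp
    rw [e, div_le_iff₀ (by positivity)]
    linarith


lemma vp_bound {x D a b u v p r K E : ℝ} (hD : 1 ≤ D) (hDx : D ≤ x) (hd1 : D ≤ a^2+b^2) (hd2 : a^2+b^2 ≤ 2*D)
    (hF : (a^2-b^2)*v+2*a*b*u = 1) (hβ : u^2+v^2 ≤ 5*(x/D)^2) (hw : 1 ≤ p^2+r^2) (hK : K = |p*b-r*a|) (hK1 : 1 ≤ K)
    (hKD : K^2 ≤ D/50) (hE : 0 ≤ E) (hE2 : E^2 = 2*D*(p^2+r^2)) (hwE : p^2+r^2 ≤ 2*E) :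
    |2*p*r*u+(p^2-r^2)*v| ≤ 16*E*K*x/D^2 ∧ |a*p+b*r| ≤ E := by
  set w := p^2+r^2 with hwd
  have hD0 : 0 < D := by linarith
  have hx0 : 0 < x := by linarith
  have hw0 : 0 < w := by linarith
  have id1 : (a*p+b*r)^2 + K^2 = (a^2+b^2)*w := by rw [hK, sq_abs, hwd]; ring
  have hr : |a*p+b*r| ≤ E := by
    apply abs_le_of_sq_le_sq _ hE
    have := mul_le_mul_of_nonneg_right hd2 hw0.le
    nlinarith [sq_nonneg K]
  refine ⟨?_, hr⟩
  have id2 : ((a*p+b*r)^2 - K^2)*(2*p*r*u+(p^2-r^2)*v) = w^2 - 2*(a*p+b*r)*(p*b-r*a)*((p^2-r^2)*u-2*p*r*v) := by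
    have : w^2 * ((a^2-b^2)*v+2*a*b*u) = ((a*p+b*r)^2 - (p*b-r*a)^2)*(2*p*r*u+(p^2-r^2)*v) + 
       2*(a*p+b*r)*(p*b-r*a)*((p^2-r^2)*u-2*p*r*v) := by rw [hwd]; ring
    rw [hF] at this
    rw [hK, sq_abs]
    linarith
  have hu : |(p^2-r^2)*u-2*p*r*v| ≤ 3*w*x/D := by
    apply abs_le_of_sq_le_sq _ (by positivity)
    have e : ((p^2-r^2)*u-2*p*r*v)^2 + (2*p*r*u+(p^2-r^2)*v)^2 = w^2*(u^2+v^2) := by rw [hwd]; ring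
    have e2 : (3*w*x/D)^2 = 9*(w^2*(x/D)^2) := by ring
    have e3 : w^2*(u^2+v^2) ≤ w^2*(5*(x/D)^2) := by gcongr
    have e4 : 0 ≤ w^2*(x/D)^2 := by positivity
    rw [e2]
    linarith [sq_nonneg (2*p*r*u+(p^2-r^2)*v)]
  have hlow : D*w/2 ≤ (a*p+b*r)^2 - K^2 := by
    have h1 := mul_le_mul_of_nonneg_right hd1 hw0.le
    have h2 : K^2 ≤ D/50*w := hKD.trans (le_mul_of_one_le_right (by positivity) hw)
    have h3 : 0 < D*w := by positivity
    linarith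
  have hup : |((a*p+b*r)^2 - K^2)*(2*p*r*u+(p^2-r^2)*v)| ≤ w*(8*E*K*x/D) := by
    rw [id2]
    have h1 : |2*(a*p+b*r)*(p*b-r*a)*((p^2-r^2)*u-2*p*r*v)| ≤ 2*E*K*(3*w*x/D) := by
      rw [abs_mul, abs_mul, abs_mul, ← hK, abs_of_pos (by norm_num : (0:ℝ) < 2)]
      gcongr
    have h2 := abs_sub (w^2) (2*(a*p+b*r)*(p*b-r*a)*((p^2-r^2)*u-2*p*r*v))
    rw [abs_of_nonneg (sq_nonneg w)] at h2
    have h3 : w^2 ≤ w*(2*E*K*x/D) := by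
      rw [sq]
      apply mul_le_mul_of_nonneg_left _ hw0.le
      have k1 : 1 ≤ x/D := by rw [le_div_iff₀ hD0]; linarith
      calc w ≤ 2*E := hwE
        _ ≤ 2*E*(K*(x/D)) := le_mul_of_one_le_right (by positivity) (by nlinarith)
        _ = _ := by ring
    have h4 : 2*E*K*(3*w*x/D) + w*(2*E*K*x/D) = w*(8*E*K*x/D) := by ring
    linarith
  rw [abs_mul, abs_of_pos (lt_of_lt_of_le (by positivity) hlow)] at hup
  have h5 := mul_le_mul_of_nonneg_right hlow (abs_nonneg (2*p*r*u+(p^2-r^2)*v))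
  have h6 : D/2 * |2*p*r*u+(p^2-r^2)*v| ≤ 8*E*K*x/D := by
    apply le_of_mul_le_mul_left _ hw0
    linarith
  have h7 : 16*E*K*x/D^2 = (8*E*K*x/D) / (D/2) := by field_simp; ring
  rw [h7, le_div_iff₀ (by positivity)]
  linarith

lemma line_bound {x D a b p r s a1 b1 : ℝ} {U0 U1 U2 V0 V1 V2 : ℝ} (hD : 1 ≤ D) (hDx : D ≤ x) 
    (hd1 : D ≤ a^2+b^2) (hd2 : a^2+b^2 ≤ 2*D) (ha1 : a1 = a + s*p) (hb1 : b1 = b + s*r)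
    (hd3 : D ≤ a1^2+b1^2) (hd4 : a1^2+b1^2 ≤ 2*D)
    (hF : ∀ t : ℝ, ((a+t*p)^2-(b+t*r)^2)*(V0+V1*t+V2*t^2)+2*(a+t*p)*(b+t*r)*(U0+U1*t+U2*t^2) = 1) 
    (hβ : U0^2+V0^2 ≤ 5*(x/D)^2) (hβ1 : (U0+U1*s+U2*s^2)^2+(V0+V1*s+V2*s^2)^2 ≤ 5*(x/D)^2)
    (hw : 1 ≤ p^2+r^2) (hK1 : 1 ≤ |p*b-r*a|) (hs : 1 ≤ |s|)
    (hKD : |p*b-r*a|^2 ≤ D/50) : (p^2+r^2)^2 ≤ 64*(|p*b-r*a|^3*x/D) := by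
  set w := p^2+r^2 with hwd
  have hD0 : 0 < D := by linarith
  have hx0 : 0 < x := by linarith
  have hw0 : 0 < w := by linarith
  set K := |p*b-r*a| with hK
  have hK1' : K = |p*b1-r*a1| := by rw [hK, ha1, hb1]; congr 1; ring
  set E := √(2*D*w) with hE
  have hE0 : 0 ≤ E := Real.sqrt_nonneg _
  have hE2 : E^2 = 2*D*w := Real.sq_sqrt (by positivity)
  have rb : ∀ a b : ℝ, a^2+b^2 ≤ 2*D → |a*p+b*r| ≤ E := by
    intro a b h
    apply abs_le_of_sq_le_sq _ hE0
    have e : (a*p+b*r)^2 + (p*b-r*a)^2 = (a^2+b^2)*w := by rw [hwd]; ring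
    have := mul_le_mul_of_nonneg_right h hw0.le
    rw [hE2]
    linarith [sq_nonneg (p*b-r*a)]
  have hdiff : (a1*p+b1*r) - (a*p+b*r) = s*w := by rw [ha1, hb1, hwd]; ring
  have hsw : w ≤ |s*w| := by rw [abs_mul, abs_of_pos hw0]; exact le_mul_of_one_le_left hw0.le hs
  have hwE : w ≤ 2*E := by
    have h1 := abs_sub (a1*p+b1*r) (a*p+b*r)
    rw [hdiff] at h1
    linarith [rb a b hd2, rb a1 b1 hd4]
  obtain ⟨h1, h2⟩ := vp_bound hD hDx hd1 hd2 (by have := hF 0; simpa using this) hβ hw hK hK1 hKD hE0 hE2 hwE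
  obtain ⟨h3, h4⟩ := vp_bound hD hDx hd3 hd4 (by have := hF s; rw [← ha1, ← hb1] at this; exact this) hβ1 hw hK1' hK1 hKD hE0 hE2 hwE
  -- polynomial identity
  have hG : ∀ t : ℝ, ((a*p+b*r+t*w)^2 - (p*b-r*a)^2) * (2*p*r*(U0+U1*t+U2*t^2)+(p^2-r^2)*(V0+V1*t+V2*t^2)) + 
      2*(a*p+b*r+t*w)*(p*b-r*a)*((p^2-r^2)*(U0+U1*t+U2*t^2)-2*p*r*(V0+V1*t+V2*t^2)) = w^2 := by
    intro t
    have : w^2 = w^2*(((a+t*p)^2-(b+t*r)^2)*(V0+V1*t+V2*t^2)+2*(a+t*p)*(b+t*r)*(U0+U1*t+U2*t^2)) := by rw [hF t, mul_one]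
    rw [this, hwd]; ring
  have hV2 : 2*p*r*U2+(p^2-r^2)*V2 = 0 := by
    have e : 24*w^2*(2*p*r*U2+(p^2-r^2)*V2) = 0 := by
      linear_combination hG 2 - 4*hG 1 + 6*hG 0 - 4 * hG (-1) + hG (-2)
    rcases mul_eq_zero.1 e with h | h
    · exact absurd h (by positivity)
    · exact h
  have hκ : (p*b-r*a)^2 = K^2 := by rw [hK, sq_abs]
  have h0 := hG (-(a*p+b*r)/w)
  have e0 : a*p+b*r + -(a*p+b*r)/w*w = 0 := by field_simp; ring
  rw [e0] at h0
  set t0 := -(a*p+b*r)/w with ht0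
  have h0' : K^2 * (2*p*r*(U0+U1*t0)+(p^2-r^2)*(V0+V1*t0)) = -w^2 := by
    rw [← hκ]; linear_combination -h0 - (p*b-r*a)^2*t0^2*hV2
  have ht0w : t0*w = -(a*p+b*r) := by rw [ht0]; field_simp
  have key : K^2 * ((2*p*r*U0+(p^2-r^2)*V0)*(a1*p+b1*r) - (2*p*r*(U0+U1*s+U2*s^2)+(p^2-r^2)*(V0+V1*s+V2*s^2))*(a*p+b*r)) = -w^2*(s*w) := by
    have hr1 : a1*p+b1*r = a*p+b*r + s*w := by linarith
    rw [hr1]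
    rw [← h0']
    have : a*p+b*r = -(t0*w) := by linarith
    rw [this]
    linear_combination K^2*t0*w*s^2*hV2
  have key2 := congrArg abs key
  rw [abs_mul, abs_of_nonneg (sq_nonneg K), abs_mul, abs_neg, abs_of_nonneg (sq_nonneg w)] at key2
  have key3 : |(2*p*r*U0+(p^2-r^2)*V0)*(a1*p+b1*r) - (2*p*r*(U0+U1*s+U2*s^2)+(p^2-r^2)*(V0+V1*s+V2*s^2))*(a*p+b*r)| ≤ 
      2*((16*E*K*x/D^2)*E) := by
    have k := abs_sub ((2*p*r*U0+(p^2-r^2)*V0)*(a1*p+b1*r)) ((2*p*r*(U0+U1*s+U2*s^2)+(p^2-r^2)*(V0+V1*s+V2*s^2))*(a*p+b*r))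
    rw [abs_mul, abs_mul] at k
    have k1 := mul_le_mul h1 h4 (abs_nonneg _) (by positivity)
    have k2 := mul_le_mul h3 h2 (abs_nonneg _) (by positivity)
    linarith
  have e5 : 2*((16*E*K*x/D^2)*E) = 64*w*K*x/D := by
    have : 2*((16*E*K*x/D^2)*E) = 32*E^2*K*x/D^2 := by ring
    rw [this, hE2]; field_simp; ring
  rw [e5] at key3
  have k3 := mul_le_mul_of_nonneg_left key3 (sq_nonneg K)
  have k4 := mul_le_mul_of_nonneg_left hsw (sq_nonneg w)
  have k5 : w * w^2 ≤ w * (64*(K^3*x/D)) := by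
    have e6 : K^2*(64*w*K*x/D) = w * (64*(K^3*x/D)) := by ring
    linarith
  exact le_of_mul_le_mul_left k5 hw0


lemma prim_part (f1 f2 : ℤ) (h : ¬ (f1 = 0 ∧ f2 = 0)) : ∃ γ p r : ℤ, 0 < γ ∧ f1 = γ * p ∧ f2 = γ * r ∧ IsCoprime p r := by
  have hg : 0 < Int.gcd f1 f2 := Nat.pos_of_ne_zero (fun e => h (Int.gcd_eq_zero_iff.1 e))
  obtain ⟨p, r, h1, h2, h3⟩ := Int.exists_gcd_one hg
  exact ⟨Int.gcd f1 f2, p, r, by exact_mod_cast hg, by rw [mul_comm]; exact h2, by rw [mul_comm]; exact h3, Int.isCoprime_iff_gcd_eq_one.2 h1⟩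

/-- line type, relative to D -/
def LTD (x D τ : ℝ) (q : Qd) : Prop := ∃ p r : ℤ, IsCoprime p r ∧ p * q.b - r * q.a ≠ 0 ∧
  ((p * q.b - r * q.a : ℤ) : ℝ)^2 ≤ 2*D*τ ∧ ((p:ℝ)^2+(r:ℝ)^2)^2 ≤ 64*(|((p * q.b - r * q.a : ℤ) : ℝ)|^3*x/D)

lemma endgame {x D τ : ℝ} {S : Finset Qd} (hP : Par x D τ) (hC : Cls x D τ S) {q0 q1 : Qd} (h0 : q0 ∈ S) (h1 : q1 ∈ S)
    {γ p r L : ℤ} (hγ : 0 < γ) (hcop : IsCoprime p r) (hL : γ * (q0.a * r - q0.b * p) = L) (hL0 : 0 < L) (hLT : (L:ℝ) ≤ 2*D*τ)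
    {u1 u2 v1 v2 : ℤ} 
    (hH : ∀ X Y : ℝ, ((X*q0.a+Y*(γ*p))^2-(X*q0.b+Y*(γ*r))^2)*(q0.v*X^2+v1*X*Y+v2*Y^2) + 
      2*(X*q0.a+Y*(γ*p))*(X*q0.b+Y*(γ*r))*(q0.u*X^2+u1*X*Y+u2*Y^2) = X^4)
    {X Y : ℤ} (hX : X^2 = 1) (hY : Y ≠ 0) (ha : q1.a = X*q0.a+Y*(γ*p)) (hb : q1.b = X*q0.b+Y*(γ*r))
    (hu : q1.u = q0.u*X^2+u1*X*Y+u2*Y^2) (hv : q1.v = q0.v*X^2+v1*X*Y+v2*Y^2)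
    (hκ : (p * q0.b - r * q0.a)^2 ≤ L) : LTD x D τ q0 := by
  have hκ0 : p * q0.b - r * q0.a ≠ 0 := by
    intro e
    have : L = -γ * (p * q0.b - r * q0.a) := by rw [← hL]; ring
    rw [e] at this; simp at this; omega
  have hD0 : 0 < D := by linarith [hP.D1]
  have hx0 := hP.x100
  have hκR : ((p * q0.b - r * q0.a : ℤ) : ℝ)^2 ≤ 2*D*τ := le_trans (by exact_mod_cast hκ) hLT
  refine ⟨p, r, hcop, hκ0, hκR, ?_⟩
  have hγR : (0:ℝ) < γ := by exact_mod_cast hγ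
  have g1 := hC.good q1 h1
  have g0 := hC.good q0 h0
  have hXR : (X:ℝ)^2 = 1 := by exact_mod_cast hX
  have haR : (q1.a:ℝ) = X*q0.a+Y*(γ*p) := by exact_mod_cast ha
  have hbR : (q1.b:ℝ) = X*q0.b+Y*(γ*r) := by exact_mod_cast hb
  have huR : (q1.u:ℝ) = q0.u*X^2+u1*X*Y+u2*Y^2 := by exact_mod_cast hu
  have hvR : (q1.v:ℝ) = q0.v*X^2+v1*X*Y+v2*Y^2 := by exact_mod_cast hv
  have ed : ((X:ℝ)*q1.a)^2+(X*q1.b)^2 = (q1.a:ℝ)^2+(q1.b:ℝ)^2 := by rw [mul_pow, mul_pow, hXR]; ring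
  have hne : p^2 + r^2 ≠ 0 := by
    intro e
    have hp : p = 0 := by nlinarith [sq_nonneg p, sq_nonneg r]
    have hr : r = 0 := by nlinarith [sq_nonneg p, sq_nonneg r]
    rw [hp, hr] at hcop
    exact absurd hcop (by simp [isCoprime_zero_left])
  have hw : (1:ℝ) ≤ (p:ℝ)^2+(r:ℝ)^2 := by
    have : 1 ≤ p^2+r^2 := by have := sq_nonneg p; have := sq_nonneg r; omega
    exact_mod_cast this
  have hK1 : (1:ℝ) ≤ |(p:ℝ) * q0.b - r * q0.a| := by
    have : 1 ≤ |p * q0.b - r * q0.a| := Int.one_le_abs hκ0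
    exact_mod_cast this
  have key := line_bound (x := x) (D := D) (a := q0.a) (b := q0.b) (p := p) (r := r) (s := X*Y*γ) (a1 := X*q1.a) (b1 := X*q1.b)
    (U0 := q0.u) (U1 := u1/γ) (U2 := u2/γ^2) (V0 := q0.v) (V1 := v1/γ) (V2 := v2/γ^2)
    hP.D1 (by linarith [hP.Dx]) (hC.dlo _ h0) (hC.dhi _ h0).le
    (by rw [haR]; linear_combination q0.a * hXR) (by rw [hbR]; linear_combination q0.b * hXR)
    (by rw [ed]; exact hC.dlo _ h1) (by rw [ed]; exact (hC.dhi _ h1).le)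
    (by intro t
        have := hH 1 (t/γ)
        refine Eq.trans ?_ (this.trans (one_pow 4))
        field_simp)
    (g0.beta_sq (by linarith) hD0 (hC.dlo _ h0))
    (by
      have e1 : (q0.u:ℝ) + u1/γ*(X*Y*γ)+u2/γ^2*(X*Y*γ)^2 = q1.u := by
        rw [huR]; field_simp; linear_combination (u2*Y^2 - q0.u) * hXR
      have e2 : (q0.v:ℝ) + v1/γ*(X*Y*γ)+v2/γ^2*(X*Y*γ)^2 = q1.v := by
        rw [hvR]; field_simp; linear_combination (v2*Y^2 - q0.v) * hXR
      rw [e1, e2]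
      exact g1.beta_sq (by linarith) hD0 (hC.dlo _ h1)) hw hK1
    (by
      have : X * Y * γ ≠ 0 := by
        refine mul_ne_zero (mul_ne_zero ?_ hY) hγ.ne'
        rintro rfl; simp at hX
      have := Int.one_le_abs this
      exact_mod_cast this)
    (by
      rw [sq_abs]
      have : ((p:ℝ) * q0.b - r * q0.a)^2 ≤ 2*D*τ := by exact_mod_cast hκR
      have := mul_le_mul_of_nonneg_left hP.τ1 hD0.le
      linarith)
  push_cast
  exact key

set_option maxHeartbeats 2000000 in
lemma core2 {x D τ : ℝ} {S : Finset Qd} (hP : Par x D τ) (hC : Cls x D τ S) (hn : ∀ q ∈ S, ¬ LTD x D τ q) 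
    (Λ : AddSubgroup (ℤ × ℤ)) (hΛ : ∀ q ∈ S, (q.a, q.b) ∈ Λ) (m A0 A1 A2 B0 B1 B2 : ℤ) (hm : m ≠ 0)
    (hu : ∀ q ∈ S, m * q.u = A0*q.a^2+A1*q.a*q.b+A2*q.b^2) (hv : ∀ q ∈ S, m * q.v = B0*q.a^2+B1*q.a*q.b+B2*q.b^2)
    (hA : ∀ l ∈ Λ, m ∣ A0*l.1^2+A1*l.1*l.2+A2*l.2^2) (hB : ∀ l ∈ Λ, m ∣ B0*l.1^2+B1*l.1*l.2+B2*l.2^2)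
    (hΔ : ∀ l ∈ Λ, ∀ l' ∈ Λ, m ∣ (l.1*l'.2-l.2*l'.1)^2)
    (Z J : ℕ) (hZ : 0 < Z) (hJ : 2*D*τ ≤ (Z:ℝ)^J) : S.card ≤ 9^J*(10^13*Z^4+1) := by
  by_contra hcon
  push Not at hcon
  obtain ⟨p, f, L, X, Y, s, κ, δ, hpS, hf, hL, hfL, hLT, hXY, hYn, G⟩ := geom hP hC Λ hΛ Z J hZ hJ hcon
  set q0 := p 0 with hq0
  have h0Λ := hΛ q0 (hpS 0)
  have hint : ∀ (A0 A1 A2 u0 : ℤ), m * u0 = A0*q0.a^2+A1*q0.a*q0.b+A2*q0.b^2 → (∀ l ∈ Λ, m ∣ A0*l.1^2+A1*l.1*l.2+A2*l.2^2) →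
      ∃ u1 u2 : ℤ, ∀ X Y : ℤ, A0*(X*q0.a+Y*f.1)^2+A1*(X*q0.a+Y*f.1)*(X*q0.b+Y*f.2)+A2*(X*q0.b+Y*f.2)^2 = 
        m * (u0*X^2+u1*X*Y+u2*Y^2) := by
    intro A0 A1 A2 u0 hu0 hA
    obtain ⟨u2, hu2⟩ := hA f hf
    obtain ⟨w, hw⟩ := hA _ (Λ.add_mem h0Λ hf)
    simp only [Prod.fst_add, Prod.snd_add] at hw
    refine ⟨w - u0 - u2, u2, fun X Y => ?_⟩
    linear_combination (X*Y-X^2) * hu0 + (Y^2-X*Y) * hu2 + X*Y*hw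
  obtain ⟨u1, u2, hu12⟩ := hint A0 A1 A2 q0.u (hu _ (hpS 0)) hA
  obtain ⟨v1, v2, hv12⟩ := hint B0 B1 B2 q0.v (hv _ (hpS 0)) hB
  have hui : ∀ i, (p i).u = q0.u*X i^2+u1*X i*Y i+u2*Y i^2 := by
    intro i
    apply mul_left_cancel₀ hm
    rw [← hu12, hu _ (hpS i), (hXY i).1, (hXY i).2]
  have hvi : ∀ i, (p i).v = q0.v*X i^2+v1*X i*Y i+v2*Y i^2 := by
    intro i
    apply mul_left_cancel₀ hm
    rw [← hv12, hv _ (hpS i), (hXY i).1, (hXY i).2]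
  have hF0 := (hC.good _ (hpS 0)).hF
  rw [← hq0] at hF0
  obtain ⟨h1, hh1⟩ : ∃ h, h = (q0.a^2-q0.b^2)*v1 + 2*(q0.a*f.1-q0.b*f.2)*q0.v + 2*q0.a*q0.b*u1+2*(q0.a*f.2+q0.b*f.1)*q0.u := ⟨_, rfl⟩
  obtain ⟨h2, hh2⟩ : ∃ h, h = (q0.a^2-q0.b^2)*v2 + 2*(q0.a*f.1-q0.b*f.2)*v1 + (f.1^2-f.2^2)*q0.v + 2*q0.a*q0.b*u2+2*(q0.a*f.2+q0.b*f.1)*u1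
    + 2*f.1*f.2*q0.u := ⟨_, rfl⟩
  obtain ⟨h3, hh3⟩ : ∃ h, h = 2*(q0.a*f.1-q0.b*f.2)*v2 + (f.1^2-f.2^2)*v1 + 2*(q0.a*f.2+q0.b*f.1)*u2 + 2*f.1*f.2*u1 := ⟨_, rfl⟩
  obtain ⟨h4, hh4⟩ : ∃ h, h = (f.1^2-f.2^2)*v2 + 2*f.1*f.2*u2 := ⟨_, rfl⟩
  obtain ⟨ρ, e1, e2, e3, e4⟩ := rigid4 G h1 h2 h3 h4 (by
    intro i
    have hFi := (hC.good _ (hpS i)).hF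
    rw [hui, hvi, (hXY i).1, (hXY i).2] at hFi
    rw [hh1, hh2, hh3, hh4]
    linear_combination hFi - X i ^ 4 * hF0)
  rw [e1] at hh1
  rw [e2] at hh2
  rw [e3] at hh3
  rw [e4] at hh4
  -- shear
  have hfne : ¬ (f.1 - ρ * q0.a = 0 ∧ f.2 - ρ * q0.b = 0) := by
    rintro ⟨k1, k2⟩
    have : L = 0 := by rw [← hfL]; linear_combination q0.a * k2 - q0.b * k1
    omega
  obtain ⟨γ, c, r, hγ, hf1, hf2, hcop⟩ := prim_part _ _ hfne
  have hf1' : f.1 = γ*c + ρ*q0.a := by linarith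
  have hf2' : f.2 = γ*r + ρ*q0.b := by linarith
  have hL' : γ * (q0.a * r - q0.b * c) = L := by rw [← hfL, hf1', hf2']; ring
  have hHR : ∀ {R : Type} [CommRing R] (X Y : R), ((X*q0.a+Y*(γ*c))^2-(X*q0.b+Y*(γ*r))^2)*(q0.v*X^2+(v1-2*ρ*q0.v : ℤ)*X*Y+(v2-ρ*v1+ρ^2*q0.v : ℤ)*Y^2) + 
      2*(X*q0.a+Y*(γ*c))*(X*q0.b+Y*(γ*r))*(q0.u*X^2+(u1-2*ρ*q0.u : ℤ)*X*Y+(u2-ρ*u1+ρ^2*q0.u : ℤ)*Y^2) = X^4 := by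
    intro R _ X Y
    have c0 := congrArg (Int.cast : ℤ → R) hF0
    have c1 := congrArg (Int.cast : ℤ → R) hh1
    have c2 := congrArg (Int.cast : ℤ → R) hh2
    have c3 := congrArg (Int.cast : ℤ → R) hh3
    have c4 := congrArg (Int.cast : ℤ → R) hh4
    have c5 := congrArg (Int.cast : ℤ → R) hf1
    have c6 := congrArg (Int.cast : ℤ → R) hf2
    push_cast at c0 c1 c2 c3 c4 c5 c6 ⊢
    rw [← c5, ← c6]
    linear_combination (X-ρ*Y)^4 * c0 - (X-ρ*Y)^3*Y * c1 - (X-ρ*Y)^2*Y^2*c2 - (X-ρ*Y)*Y^3*c3 - Y^4*c4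
  -- κ^4 ∣ m
  have hκ : (c * q0.b - r * q0.a)^2 ≤ L := by
    obtain ⟨g2, g1, hg⟩ := hcop
    -- g2*c + g1*r = 1 
    have hW := hHR (R := ℤ) γ (-(q0.a*g2+q0.b*g1))
    have k1 : γ*q0.a+(-(q0.a*g2+q0.b*g1))*(γ*c) = γ*(c * q0.b - r * q0.a)*(-g1) := by
      linear_combination (-γ*q0.a)*hg
    have k2 : γ*q0.b+(-(q0.a*g2+q0.b*g1))*(γ*r) = γ*(c * q0.b - r * q0.a)*g2 := by
      linear_combination (-γ*q0.b)*hg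
    have k3 : ∀ A0 A1 A2 u0 u1 u2 : ℤ, (∀ X Y : ℤ, A0*(X*q0.a+Y*f.1)^2+A1*(X*q0.a+Y*f.1)*(X*q0.b+Y*f.2)+A2*(X*q0.b+Y*f.2)^2 = 
        m * (u0*X^2+u1*X*Y+u2*Y^2)) → ∀ X Y : ℤ, A0*(X*q0.a+Y*(γ*c))^2+A1*(X*q0.a+Y*(γ*c))*(X*q0.b+Y*(γ*r))+A2*(X*q0.b+Y*(γ*r))^2 = 
        m * (u0*X^2+(u1-2*ρ*u0)*X*Y+(u2-ρ*u1+ρ^2*u0)*Y^2) := by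
      intro A0 A1 A2 u0 u1 u2 h X Y
      have := h (X-ρ*Y) Y
      rw [hf1', hf2'] at this
      linear_combination this
    have ku := k3 _ _ _ _ _ _ hu12 γ (-(q0.a*g2+q0.b*g1))
    have kv := k3 _ _ _ _ _ _ hv12 γ (-(q0.a*g2+q0.b*g1))
    simp only [Int.cast_id] at hW
    rw [k1, k2] at hW ku kv
    have hm4 : γ^4 * ((c * q0.b - r * q0.a)^4 * (((-g1)^2-g2^2)*(B0*(-g1)^2+B1*(-g1)*g2+B2*g2^2) + 2*(-g1)*g2*(A0*(-g1)^2+A1*(-g1)*g2+A2*g2^2))) = γ^4 * m := by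
      linear_combination m * hW + (γ^2*(c * q0.b - r * q0.a)^2*((-g1)^2-g2^2)) * kv + (γ^2*(c * q0.b - r * q0.a)^2*2*(-g1)*g2) * ku
    have hm4' := mul_left_cancel₀ (pow_ne_zero 4 hγ.ne') hm4
    have d1 : (c * q0.b - r * q0.a)^4 ∣ m := ⟨_, hm4'.symm⟩
    have d2 : m ∣ L^2 := by
      have := hΔ _ h0Λ _ hf
      simp only at this
      rwa [hfL] at this
    have d3 := Int.le_of_dvd (by positivity) (d1.trans d2)
    rw [show (c * q0.b - r * q0.a)^4 = ((c * q0.b - r * q0.a)^2)^2 by ring] at d3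
    exact (pow_le_pow_iff_left₀ (sq_nonneg _) hL.le two_ne_zero).1 d3
  apply hn _ (hpS 0)
  have hX4 : (X 1 + ρ * Y 1)^4 = 1 := by
    have hFi := (hC.good _ (hpS 1)).hF
    rw [hui, hvi, (hXY 1).1, (hXY 1).2] at hFi
    linear_combination hFi - X 1 ^ 4 * hF0 + X 1^3*Y 1 * hh1 + X 1^2*Y 1^2*hh2 + X 1*Y 1^3*hh3 + Y 1^4*hh4
  have hX2 : (X 1 + ρ * Y 1)^2 = 1 := by
    have k : ((X 1 + ρ * Y 1)^2 - 1) * ((X 1 + ρ * Y 1)^2 + 1) = 0 := by linear_combination hX4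
    rcases mul_eq_zero.1 k with h | h
    · linarith
    · have := sq_nonneg (X 1 + ρ * Y 1)
      linarith
  refine endgame hP hC (hpS 0) (hpS 1) hγ hcop hL' hL hLT (fun X Y => hHR X Y) hX2 (hYn 1 (by decide)) ?_ ?_ ?_ ?_ hκ
  · rw [(hXY 1).1, hf1']; ring
  · rw [(hXY 1).2, hf2']; ring
  · rw [hui]; ring
  · rw [hvi]; ring

set_option maxHeartbeats 2000000 in
lemma core1 {x D τ : ℝ} {S : Finset Qd} (hP : Par x D τ) (hC : Cls x D τ S) (hn : ∀ q ∈ S, ¬ LTD x D τ q) 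
    (Λ : AddSubgroup (ℤ × ℤ)) (hΛ : ∀ q ∈ S, (q.a, q.b) ∈ Λ) (m A0 A1 B0 B1 : ℤ) (hm : m ≠ 0)
    (hu : ∀ q ∈ S, m * q.u = A0*q.a+A1*q.b) (hv : ∀ q ∈ S, m * q.v = B0*q.a+B1*q.b)
    (hA : ∀ l ∈ Λ, m ∣ A0*l.1+A1*l.2) (hB : ∀ l ∈ Λ, m ∣ B0*l.1+B1*l.2)
    (hΔ : ∀ l ∈ Λ, ∀ l' ∈ Λ, m ∣ (l.1*l'.2-l.2*l'.1))
    (Z J : ℕ) (hZ : 0 < Z) (hJ : 2*D*τ ≤ (Z:ℝ)^J) : S.card ≤ 9^J*(10^13*Z^4+1) := by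
  by_contra hcon
  push Not at hcon
  obtain ⟨p, f, L, X, Y, s, κ, δ, hpS, hf, hL, hfL, hLT, hXY, hYn, G⟩ := geom hP hC Λ hΛ Z J hZ hJ hcon
  set q0 := p 0 with hq0
  have h0Λ := hΛ q0 (hpS 0)
  have hint : ∀ (A0 A1 u0 : ℤ), m * u0 = A0*q0.a+A1*q0.b → (∀ l ∈ Λ, m ∣ A0*l.1+A1*l.2) →
      ∃ u1 : ℤ, ∀ X Y : ℤ, A0*(X*q0.a+Y*f.1)+A1*(X*q0.b+Y*f.2) = m * (u0*X+u1*Y) := by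
    intro A0 A1 u0 hu0 hA
    obtain ⟨u2, hu2⟩ := hA f hf
    refine ⟨u2, fun X Y => ?_⟩
    linear_combination (-X) * hu0 + Y * hu2
  obtain ⟨u1, hu12⟩ := hint A0 A1 q0.u (hu _ (hpS 0)) hA
  obtain ⟨v1, hv12⟩ := hint B0 B1 q0.v (hv _ (hpS 0)) hB
  have hui : ∀ i, (p i).u = q0.u*X i+u1*Y i := by
    intro i
    apply mul_left_cancel₀ hm
    rw [← hu12, hu _ (hpS i), (hXY i).1, (hXY i).2]
  have hvi : ∀ i, (p i).v = q0.v*X i+v1*Y i := by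
    intro i
    apply mul_left_cancel₀ hm
    rw [← hv12, hv _ (hpS i), (hXY i).1, (hXY i).2]
  have hF0 := (hC.good _ (hpS 0)).hF
  rw [← hq0] at hF0
  obtain ⟨h1, hh1⟩ : ∃ h, h = (q0.a^2-q0.b^2)*v1 + 2*(q0.a*f.1-q0.b*f.2)*q0.v + 2*q0.a*q0.b*u1+2*(q0.a*f.2+q0.b*f.1)*q0.u := ⟨_, rfl⟩
  obtain ⟨h2, hh2⟩ : ∃ h, h = 2*(q0.a*f.1-q0.b*f.2)*v1 + (f.1^2-f.2^2)*q0.v + 2*(q0.a*f.2+q0.b*f.1)*u1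
    + 2*f.1*f.2*q0.u := ⟨_, rfl⟩
  obtain ⟨h3, hh3⟩ : ∃ h, h = (f.1^2-f.2^2)*v1 + 2*f.1*f.2*u1 := ⟨_, rfl⟩
  obtain ⟨ρ, e1, e2, e3⟩ := rigid3 G h1 h2 h3 (by
    intro i
    have hFi := (hC.good _ (hpS i)).hF
    rw [hui, hvi, (hXY i).1, (hXY i).2] at hFi
    rw [hh1, hh2, hh3]
    linear_combination hFi - X i ^ 3 * hF0)
  rw [e1] at hh1
  rw [e2] at hh2
  rw [e3] at hh3
  have hfne : ¬ (f.1 - ρ * q0.a = 0 ∧ f.2 - ρ * q0.b = 0) := by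
    rintro ⟨k1, k2⟩
    have : L = 0 := by rw [← hfL]; linear_combination q0.a * k2 - q0.b * k1
    omega
  obtain ⟨γ, c, r, hγ, hf1, hf2, hcop⟩ := prim_part _ _ hfne
  have hf1' : f.1 = γ*c + ρ*q0.a := by linarith
  have hf2' : f.2 = γ*r + ρ*q0.b := by linarith
  have hL' : γ * (q0.a * r - q0.b * c) = L := by rw [← hfL, hf1', hf2']; ring
  have hHR : ∀ {R : Type} [CommRing R] (X Y : R), ((X*q0.a+Y*(γ*c))^2-(X*q0.b+Y*(γ*r))^2)*(q0.v*X+(v1-ρ*q0.v : ℤ)*Y) + 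
      2*(X*q0.a+Y*(γ*c))*(X*q0.b+Y*(γ*r))*(q0.u*X+(u1-ρ*q0.u : ℤ)*Y) = X^3 := by
    intro R _ X Y
    have c0 := congrArg (Int.cast : ℤ → R) hF0
    have c1 := congrArg (Int.cast : ℤ → R) hh1
    have c2 := congrArg (Int.cast : ℤ → R) hh2
    have c3 := congrArg (Int.cast : ℤ → R) hh3
    have c5 := congrArg (Int.cast : ℤ → R) hf1
    have c6 := congrArg (Int.cast : ℤ → R) hf2
    push_cast at c0 c1 c2 c3 c5 c6 ⊢
    rw [← c5, ← c6]
    linear_combination (X-ρ*Y)^3 * c0 - (X-ρ*Y)^2*Y * c1 - (X-ρ*Y)*Y^2*c2 - Y^3*c3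
  have hκ : (c * q0.b - r * q0.a)^2 ≤ L := by
    obtain ⟨g2, g1, hg⟩ := hcop
    have hW := hHR (R := ℤ) γ (-(q0.a*g2+q0.b*g1))
    have k1 : γ*q0.a+(-(q0.a*g2+q0.b*g1))*(γ*c) = γ*(c * q0.b - r * q0.a)*(-g1) := by
      linear_combination (-γ*q0.a)*hg
    have k2 : γ*q0.b+(-(q0.a*g2+q0.b*g1))*(γ*r) = γ*(c * q0.b - r * q0.a)*g2 := by
      linear_combination (-γ*q0.b)*hg
    have k3 : ∀ A0 A1 u0 u1 : ℤ, (∀ X Y : ℤ, A0*(X*q0.a+Y*f.1)+A1*(X*q0.b+Y*f.2) = 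
        m * (u0*X+u1*Y)) → ∀ X Y : ℤ, A0*(X*q0.a+Y*(γ*c))+A1*(X*q0.b+Y*(γ*r)) = 
        m * (u0*X+(u1-ρ*u0)*Y) := by
      intro A0 A1 u0 u1 h X Y
      have := h (X-ρ*Y) Y
      rw [hf1', hf2'] at this
      linear_combination this
    have ku := k3 _ _ _ _ hu12 γ (-(q0.a*g2+q0.b*g1))
    have kv := k3 _ _ _ _ hv12 γ (-(q0.a*g2+q0.b*g1))
    simp only [Int.cast_id] at hW
    rw [k1, k2] at hW ku kv
    have hm4 : γ^3 * ((c * q0.b - r * q0.a)^3 * (((-g1)^2-g2^2)*(B0*(-g1)+B1*g2) + 2*(-g1)*g2*(A0*(-g1)+A1*g2))) = γ^3 * m := by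
      linear_combination m * hW + (γ^2*(c * q0.b - r * q0.a)^2*((-g1)^2-g2^2)) * kv + (γ^2*(c * q0.b - r * q0.a)^2*2*(-g1)*g2) * ku
    have hm4' := mul_left_cancel₀ (pow_ne_zero 3 hγ.ne') hm4
    have d1 : (c * q0.b - r * q0.a)^3 ∣ m := ⟨_, hm4'.symm⟩
    have d2 : m ∣ L := by
      have := hΔ _ h0Λ _ hf
      simp only at this
      rwa [hfL] at this
    exact Int.le_of_dvd hL ((Dvd.intro_left _ (by ring : (c * q0.b - r * q0.a) * (c * q0.b - r * q0.a)^2 = _)).trans (d1.trans d2))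
  apply hn _ (hpS 0)
  have hX3 : (X 1 + ρ * Y 1)^3 = 1 := by
    have hFi := (hC.good _ (hpS 1)).hF
    rw [hui, hvi, (hXY 1).1, (hXY 1).2] at hFi
    linear_combination hFi - X 1 ^ 3 * hF0 + X 1^2*Y 1 * hh1 + X 1*Y 1^2*hh2 + Y 1^3*hh3
  have hX1 : X 1 + ρ * Y 1 = 1 := by
    have : (X 1 + ρ * Y 1 - 1) * ((X 1 + ρ * Y 1)^2 + (X 1 + ρ * Y 1) + 1) = 0 := by linear_combination hX3
    rcases mul_eq_zero.1 this with h | h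
    · linarith
    · nlinarith [sq_nonneg (2*(X 1 + ρ * Y 1)+1)]
  refine endgame (u1 := u1-ρ*q0.u) (u2 := 0) (v1 := v1-ρ*q0.v) (v2 := 0) (X := 1) hP hC (hpS 0) (hpS 1) hγ hcop hL' hL hLT 
    (fun X Y => ?_) rfl (hYn 1 (by decide)) ?_ ?_ ?_ ?_ hκ
  · have := hHR X Y
    push_cast at this ⊢
    linear_combination X * this
  · rw [(hXY 1).1, hf1']; linear_combination q0.a * hX1
  · rw [(hXY 1).2, hf2']; linear_combination q0.b * hX1
  · rw [hui]; linear_combination q0.u * hX1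
  · rw [hvi]; linear_combination q0.v * hX1


set_option maxHeartbeats 1000000 in
lemma beta_par {x D τ : ℝ} {S : Finset Qd} (hP : Par x D τ) (hC : Cls x D τ S) {q q' : Qd} (h : q ∈ S) (h' : q' ∈ S)
    (e : q.u * q'.v = q'.u * q.v) : q = q' := by
  have g := hC.good q h
  have g' := hC.good q' h'
  have hx := hP.x100
  have hD1 := hP.D1
  have hDx := hP.Dx
  obtain ⟨r, s, hrs⟩ := g.cop'
  obtain ⟨r', s', hrs'⟩ := g'.cop'
  -- q' = k q, q = k' q
  have e1 : q'.u = (r*q'.u+s*q'.v) * q.u := by linear_combination (-q'.u)*hrs - s * e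
  have e2 : q'.v = (r*q'.u+s*q'.v) * q.v := by linear_combination (-q'.v)*hrs + r * e
  set k := r*q'.u+s*q'.v with hk
  have hk1 : k * (r'*q.u+s'*q.v) = 1 := by rw [← hrs']; linear_combination (-r')*e1 - s'*e2
  have hn := g.n1
  have hn2 := g.n2
  have hn' := g'.n1
  have hn2' := g'.n2
  have hF := g.hF
  have hF' := g'.hF
  rw [e1, e2] at hF' hn' hn2'
  obtain ⟨-, k2, k3, k4, k5, k6, k7, k8, k9⟩ := hC.two_pt hP h h'
  have hd1 := hC.dlo q h
  have hd2 := hC.dhi q h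
  have hd0 : (0:ℝ) < (q.a:ℝ)^2+(q.b:ℝ)^2 := by linarith
  have hnorm : ((q.u:ℝ)^2+(q.v:ℝ)^2)*((q.a:ℝ)^2+(q.b:ℝ)^2)^2 = (((q.a^2-q.b^2)*q.u-2*q.a*q.b*q.v : ℤ):ℝ)^2+1 := by exact_mod_cast g.norm
  rcases Int.eq_one_or_neg_one_of_mul_eq_one hk1 with hk' | hk'
  · rw [hk'] at hF' hn' hn2'
    simp only [one_mul] at hF' hn' hn2'
    have bi := beta_identity hF hF'
    apply delta_zero g g'
    by_contra hne
    have h1 : (1:ℝ) ≤ |((q.a*q'.b-q'.a*q.b : ℤ):ℝ)| := by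
      have := Int.one_le_abs hne; exact_mod_cast this
    have biR := congrArg (Int.cast : ℤ → ℝ) bi
    set N := (((q.a^2-q.b^2)*q.u-2*q.a*q.b*q.v : ℤ):ℝ) with hN
    set N' := (((q'.a^2-q'.b^2)*q.u-2*q'.a*q'.b*q.v : ℤ):ℝ) with hN'
    have biR' : ((q.u:ℝ)^2+(q.v:ℝ)^2)*(2*((q.a:ℝ)*q'.a+q.b*q'.b)*((q.a*q'.b-q'.a*q.b : ℤ):ℝ)) = N - N' := by
      rw [hN, hN']; push_cast at biR ⊢; linarith
    have hab := congrArg abs biR'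
    have hg : D/2 ≤ (q.a:ℝ)*q'.a+q.b*q'.b := by
      rw [le_div_iff₀ hd0] at k5; linarith
    have hNN : |N - N'| < x := by rw [abs_lt]; constructor <;> linarith
    rw [← hab, abs_mul, abs_mul, abs_of_nonneg (by positivity), abs_of_pos (by linarith)] at hNN
    have hB : 0 ≤ (q.u:ℝ)^2+(q.v:ℝ)^2 := by positivity
    have c1 : ((q.u:ℝ)^2+(q.v:ℝ)^2)*D < x := by
      refine lt_of_le_of_lt ?_ hNN
      apply mul_le_mul_of_nonneg_left _ hB
      have hD2 : D ≤ 2*((q.a:ℝ)*q'.a+q.b*q'.b) := by linarith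
      calc D ≤ 2*((q.a:ℝ)*q'.a+q.b*q'.b) := hD2
        _ ≤ _ := le_mul_of_one_le_right (by linarith) h1
    have c2 : x^2 < ((q.u:ℝ)^2+(q.v:ℝ)^2)*(2*D)^2 := by
      have c3 : ((q.u:ℝ)^2+(q.v:ℝ)^2)*((q.a:ℝ)^2+(q.b:ℝ)^2)^2 ≤ ((q.u:ℝ)^2+(q.v:ℝ)^2)*(2*D)^2 := by gcongr
      rw [hnorm] at c3
      have c4 : x^2 ≤ N^2 := pow_le_pow_left₀ (by linarith) hn.le 2
      linarith
    have c5 : ((q.u:ℝ)^2+(q.v:ℝ)^2)*D*(4*D) < x*(4*D) := mul_lt_mul_of_pos_right c1 (by linarith)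
    have c6 : x*(4*D) ≤ x*x := mul_le_mul_of_nonneg_left (by linarith) (by linarith)
    have c7 : ((q.u:ℝ)^2+(q.v:ℝ)^2)*D*(4*D) = ((q.u:ℝ)^2+(q.v:ℝ)^2)*(2*D)^2 := by ring
    have c8 : x^2 = x*x := by ring
    linarith
  · exfalso
    rw [hk'] at hF' hn' hn2'
    set N := (((q.a^2-q.b^2)*q.u-2*q.a*q.b*q.v : ℤ):ℝ) with hN
    set N' := (((q'.a^2-q'.b^2)*(-1*q.u)-2*q'.a*q'.b*(-1*q.v) : ℤ):ℝ) with hN'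
    have hFR : ((q.a:ℝ)^2-q.b^2)*q.v+2*q.a*q.b*q.u = 1 := by exact_mod_cast hF
    have hFR' : ((q'.a:ℝ)^2-q'.b^2)*(-1*q.v)+2*q'.a*q'.b*(-1*q.u) = 1 := by exact_mod_cast hF'
    have id : ((q.u:ℝ)^2+(q.v:ℝ)^2)*(((q.a:ℝ)*q'.a+q.b*q'.b)^2 - ((q.a:ℝ)*q'.b-q.b*q'.a)^2) = -(N*N'+1) := by
      have : N*N' + (((q.a:ℝ)^2-q.b^2)*q.v+2*q.a*q.b*q.u) * (((q'.a:ℝ)^2-q'.b^2)*(-1*q.v)+2*q'.a*q'.b*(-1*q.u)) = 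
        -(((q.u:ℝ)^2+(q.v:ℝ)^2)*(((q.a:ℝ)*q'.a+q.b*q'.b)^2 - ((q.a:ℝ)*q'.b-q.b*q'.a)^2)) := by
        rw [hN, hN']; push_cast; ring
      rw [hFR, hFR'] at this
      linarith
    have pos : 0 ≤ ((q.a:ℝ)*q'.a+q.b*q'.b)^2 - ((q.a:ℝ)*q'.b-q.b*q'.a)^2 := by
      rw [div_pow, div_pow, ← sub_div, le_div_iff₀ (by positivity)] at k9
      refine le_trans (by positivity) k9
    have h0 : 0 < N*N' := mul_pos (by linarith) (by linarith)
    have : 0 ≤ ((q.u:ℝ)^2+(q.v:ℝ)^2)*(((q.a:ℝ)*q'.a+q.b*q'.b)^2 - ((q.a:ℝ)*q'.b-q.b*q'.a)^2) := mul_nonneg (by positivity) pos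
    linarith

lemma int_div_card (S : Finset ℤ) (N : ℤ) (hN : N ≠ 0) (h : ∀ m ∈ S, m ∣ N) : S.card ≤ 2 * N.natAbs.divisors.card := by
  classical
  have : S ⊆ (N.natAbs.divisors.image (fun n : ℕ => (n:ℤ))) ∪ (N.natAbs.divisors.image (fun n : ℕ => -(n:ℤ))) := by
    intro m hm
    have hd : m.natAbs ∈ N.natAbs.divisors := by
      rw [Nat.mem_divisors]; exact ⟨Int.natAbs_dvd_natAbs.2 (h m hm), by simpa using hN⟩
    rw [Finset.mem_union, Finset.mem_image, Finset.mem_image]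
    rcases Int.natAbs_eq m with e | e
    · left; exact ⟨_, hd, e.symm⟩
    · right; exact ⟨_, hd, e.symm⟩
  calc S.card ≤ _ := Finset.card_le_card this
    _ ≤ _ := Finset.card_union_le _ _
    _ ≤ N.natAbs.divisors.card + N.natAbs.divisors.card := add_le_add Finset.card_image_le Finset.card_image_le
    _ = _ := by ring

lemma mfun {P Q u v : ℤ} (hc : IsCoprime u v) (h : P*u+Q*v = 0) : ∃ m : ℤ, Q = m*u ∧ P = -(m*v) := by
  obtain ⟨r, s, hrs⟩ := hc
  refine ⟨r*Q-s*P, ?_, ?_⟩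
  · linear_combination (-Q)*hrs + s*h
  · linear_combination (-P)*hrs + r*h

open Classical in
lemma case11 {x D τ : ℝ} {S : Finset Qd} (hP : Par x D τ) (hC : Cls x D τ S) (hn : ∀ q ∈ S, ¬ LTD x D τ q) 
    (Z J : ℕ) (hZ : 0 < Z) (hJ : 2*D*τ ≤ (Z:ℝ)^J) (g00 g10 g01 g11 : ℤ) 
    (hrel : ∀ q ∈ S, (g00*q.a+g10*q.b)*q.u+(g01*q.a+g11*q.b)*q.v = 0)
    (hne : ¬ (g00 = 0 ∧ g10 = 0 ∧ g01 = 0 ∧ g11 = 0))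
    (hprim : ∀ m z : ℤ, m ∣ g00*z → m ∣ g10*z → m ∣ g01*z → m ∣ g11*z → m ∣ z)
    (Dv : ℕ) (hDv : g00*g11-g10*g01 ≠ 0 → (g00*g11-g10*g01).natAbs.divisors.card ≤ Dv) :
    S.card ≤ 2 + 9^J*(10^13*Z^4+1) * (2*Dv) := by
  have hm : ∀ q : Qd, ∃ m : ℤ, q ∈ S → (g01*q.a+g11*q.b) = m*q.u ∧ (g00*q.a+g10*q.b) = -(m*q.v) := by
    intro q
    by_cases h : q ∈ S
    · obtain ⟨m, h1⟩ := mfun (hC.good q h).cop' (hrel q h)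
      exact ⟨m, fun _ => h1⟩
    · exact ⟨0, fun h' => absurd h' h⟩
  choose M hM using hm
  by_cases hdet : g00*g11-g10*g01 = 0
  · have h0 : (S.filter (fun q => M q = 0)).card ≤ 1 := by
      rw [Finset.card_le_one]
      intro q hq q' hq'
      rw [Finset.mem_filter] at hq hq'
      obtain ⟨e1, e2⟩ := hM q hq.1
      obtain ⟨e3, e4⟩ := hM q' hq'.1
      rw [hq.2, zero_mul] at e1 e2
      rw [hq'.2, zero_mul] at e3 e4
      rw [neg_zero] at e2 e4
      apply delta_zero (hC.good q hq.1) (hC.good q' hq'.1)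
      by_contra hd
      apply hne
      refine ⟨?_, ?_, ?_, ?_⟩
      · have : (q.a*q'.b-q'.a*q.b)*g00 = 0 := by linear_combination q'.b*e2 - q.b*e4
        exact (mul_eq_zero.1 this).resolve_left hd
      · have : (q.a*q'.b-q'.a*q.b)*g10 = 0 := by linear_combination q.a*e4 - q'.a*e2
        exact (mul_eq_zero.1 this).resolve_left hd
      · have : (q.a*q'.b-q'.a*q.b)*g01 = 0 := by linear_combination q'.b*e1 - q.b*e3
        exact (mul_eq_zero.1 this).resolve_left hd
      · have : (q.a*q'.b-q'.a*q.b)*g11 = 0 := by linear_combination q.a*e3 - q'.a*e1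
        exact (mul_eq_zero.1 this).resolve_left hd
    have h1 : (S.filter (fun q => ¬ M q = 0)).card ≤ 1 := by
      rw [Finset.card_le_one]
      intro q hq q' hq'
      rw [Finset.mem_filter] at hq hq'
      obtain ⟨e1, e2⟩ := hM q hq.1
      obtain ⟨e3, e4⟩ := hM q' hq'.1
      apply beta_par hP hC hq.1 hq'.1
      have : (M q * M q') * (q.u*q'.v-q'.u*q.v) = 0 := by
        have : (g01*q.a+g11*q.b)*(g00*q'.a+g10*q'.b) - (g01*q'.a+g11*q'.b)*(g00*q.a+g10*q.b) = 
          -(q.a*q'.b-q'.a*q.b)*(g00*g11-g10*g01) := by ring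
        rw [hdet, e1, e2, e3, e4] at this
        linear_combination -this
      have := (mul_eq_zero.1 this).resolve_left (mul_ne_zero hq.2 hq'.2)
      linarith
    have := Finset.card_filter_add_card_filter_not (s := S) (fun q => M q = 0)
    omega
  · have hfib := Finset.card_le_mul_card_image (f := M) S (9^J*(10^13*Z^4+1)) (by
      intro m hm
      rw [Finset.mem_image] at hm
      obtain ⟨q1, hq1, hq1m⟩ := hm
      have hm0 : m ≠ 0 := by
        rintro rfl
        obtain ⟨e1, e2⟩ := hM q1 hq1
        rw [hq1m, zero_mul] at e1 e2
        rw [neg_zero] at e2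
        have : (g00*g11-g10*g01)*q1.a = 0 := by linear_combination g11*e2-g10*e1
        exact (hC.good q1 hq1).apos.ne' ((mul_eq_zero.1 this).resolve_left hdet)
      let Λ : AddSubgroup (ℤ × ℤ) := 
        { carrier := {l | m ∣ g00*l.1+g10*l.2 ∧ m ∣ g01*l.1+g11*l.2}
          add_mem' := by
            rintro l l' ⟨h1, h2⟩ ⟨h3, h4⟩
            refine ⟨?_, ?_⟩
            · rw [show g00*(l+l').1+g10*(l+l').2 = (g00*l.1+g10*l.2)+(g00*l'.1+g10*l'.2) from by simp only [Prod.fst_add,Prod.snd_add]; ring]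
              exact dvd_add h1 h3
            · rw [show g01*(l+l').1+g11*(l+l').2 = (g01*l.1+g11*l.2)+(g01*l'.1+g11*l'.2) from by simp only [Prod.fst_add,Prod.snd_add]; ring]
              exact dvd_add h2 h4
          zero_mem' := by simp
          neg_mem' := by
            rintro l ⟨h1, h2⟩
            refine ⟨?_, ?_⟩
            · rw [show g00*(-l).1+g10*(-l).2 = -(g00*l.1+g10*l.2) from by simp only [Prod.fst_neg,Prod.snd_neg]; ring]
              exact h1.neg_right
            · rw [show g01*(-l).1+g11*(-l).2 = -(g01*l.1+g11*l.2) from by simp only [Prod.fst_neg,Prod.snd_neg]; ring]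
              exact h2.neg_right }
      have hΛ : ∀ l, l ∈ Λ ↔ m ∣ g00*l.1+g10*l.2 ∧ m ∣ g01*l.1+g11*l.2 := fun l => Iff.rfl
      refine core1 hP (hC.mono (Finset.filter_subset _ _)) (fun q hq => hn q (Finset.mem_filter.1 hq).1) Λ ?_ m g01 g11 (-g00) (-g10) hm0
        ?_ ?_ ?_ ?_ ?_ Z J hZ hJ
      · intro q hq
        rw [Finset.mem_filter] at hq
        obtain ⟨e1, e2⟩ := hM q hq.1
        rw [hq.2] at e1 e2
        exact (hΛ _).2 ⟨⟨-q.v, by rw [e2]; ring⟩, ⟨q.u, e1⟩⟩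
      · intro q hq
        rw [Finset.mem_filter] at hq
        obtain ⟨e1, e2⟩ := hM q hq.1
        rw [← hq.2, ← e1]
      · intro q hq
        rw [Finset.mem_filter] at hq
        obtain ⟨e1, e2⟩ := hM q hq.1
        rw [← hq.2]; linear_combination e2
      · intro l hl; exact ((hΛ l).1 hl).2
      · intro l hl
        have := ((hΛ l).1 hl).1
        rw [show -g00*l.1 + -g10*l.2 = -(g00*l.1+g10*l.2) from by ring]; exact this.neg_right
      · intro l hl l' hl'
        obtain ⟨h1, h2⟩ := (hΛ l).1 hl
        obtain ⟨h3, h4⟩ := (hΛ l').1 hl'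
        apply hprim
        · rw [show g00*(l.1*l'.2-l.2*l'.1) = (g00*l.1+g10*l.2)*l'.2 - (g00*l'.1+g10*l'.2)*l.2 from by ring]
          exact dvd_sub (dvd_mul_of_dvd_left h1 l'.2) (dvd_mul_of_dvd_left h3 l.2)
        · rw [show g10*(l.1*l'.2-l.2*l'.1) = (g00*l'.1+g10*l'.2)*l.1 - (g00*l.1+g10*l.2)*l'.1 from by ring]
          exact dvd_sub (dvd_mul_of_dvd_left h3 l.1) (dvd_mul_of_dvd_left h1 l'.1)
        · rw [show g01*(l.1*l'.2-l.2*l'.1) = (g01*l.1+g11*l.2)*l'.2 - (g01*l'.1+g11*l'.2)*l.2 from by ring]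
          exact dvd_sub (dvd_mul_of_dvd_left h2 l'.2) (dvd_mul_of_dvd_left h4 l.2)
        · rw [show g11*(l.1*l'.2-l.2*l'.1) = (g01*l'.1+g11*l'.2)*l.1 - (g01*l.1+g11*l.2)*l'.1 from by ring]
          exact dvd_sub (dvd_mul_of_dvd_left h4 l.1) (dvd_mul_of_dvd_left h2 l'.1))
    have himg : (S.image M).card ≤ 2*Dv := by
      refine (int_div_card (S.image M) _ hdet ?_).trans (Nat.mul_le_mul_left 2 (hDv hdet))
      intro m hm
      rw [Finset.mem_image] at hm
      obtain ⟨q, hq, rfl⟩ := hm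
      obtain ⟨e1, e2⟩ := hM q hq
      obtain ⟨r, s, hrs⟩ := (hC.good q hq).cop
      refine ⟨r*(-g11*q.v-g10*q.u)+s*(g01*q.v+g00*q.u), ?_⟩
      linear_combination (-(g00*g11-g10*g01))*hrs + (r*g11-s*g01)*e2 + (s*g00-r*g10)*e1
    calc S.card ≤ _ := hfib
      _ ≤ 9^J*(10^13*Z^4+1) * (2*Dv) := Nat.mul_le_mul_left _ himg
      _ ≤ _ := by omega

lemma quad_vanish {x : ℝ} {S : Finset Qd} (hg : ∀ q ∈ S, Good x q) (p0 p1 p2 : ℤ) (hne : ¬ (p0 = 0 ∧ p1 = 0 ∧ p2 = 0))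
    (h : ∀ q ∈ S, p0*q.a^2+p1*q.a*q.b+p2*q.b^2 = 0) : S.card ≤ 2 := by
  classical
  by_contra hc
  push Not at hc
  obtain ⟨q1, q2, q3, h1, h2, h3, n12, n13, n23⟩ := Finset.two_lt_card_iff.1 hc
  have d12 : q1.a*q2.b-q2.a*q1.b ≠ 0 := fun e => n12 (delta_zero (hg _ h1) (hg _ h2) e)
  have d13 : q1.a*q3.b-q3.a*q1.b ≠ 0 := fun e => n13 (delta_zero (hg _ h1) (hg _ h3) e)
  have d23 : q2.a*q3.b-q3.a*q2.b ≠ 0 := fun e => n23 (delta_zero (hg _ h2) (hg _ h3) e)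
  have hd : (q1.a*q2.b-q2.a*q1.b)*(q1.a*q3.b-q3.a*q1.b)*(q2.a*q3.b-q3.a*q2.b) ≠ 0 := mul_ne_zero (mul_ne_zero d12 d13) d23
  have E1 := h _ h1
  have E2 := h _ h2
  have E3 := h _ h3
  apply hne
  refine ⟨?_, ?_, ?_⟩
  · have : ((q1.a*q2.b-q2.a*q1.b)*(q1.a*q3.b-q3.a*q1.b)*(q2.a*q3.b-q3.a*q2.b)) * p0 = 0 := by
      linear_combination (q2.b*q3.b*(q2.a*q3.b-q3.a*q2.b))*E1 - (q1.b*q3.b*(q1.a*q3.b-q3.a*q1.b))*E2 + (q1.b*q2.b*(q1.a*q2.b-q2.a*q1.b))*E3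
    exact (mul_eq_zero.1 this).resolve_left hd
  · have : ((q1.a*q2.b-q2.a*q1.b)*(q1.a*q3.b-q3.a*q1.b)*(q2.a*q3.b-q3.a*q2.b)) * p1 = 0 := by
      linear_combination (-(q2.a*q3.b+q3.a*q2.b)*(q2.a*q3.b-q3.a*q2.b))*E1 + ((q1.a*q3.b+q3.a*q1.b)*(q1.a*q3.b-q3.a*q1.b))*E2 - ((q1.a*q2.b+q2.a*q1.b)*(q1.a*q2.b-q2.a*q1.b))*E3
    exact (mul_eq_zero.1 this).resolve_left hd
  · have : ((q1.a*q2.b-q2.a*q1.b)*(q1.a*q3.b-q3.a*q1.b)*(q2.a*q3.b-q3.a*q2.b)) * p2 = 0 := by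
      linear_combination (q2.a*q3.a*(q2.a*q3.b-q3.a*q2.b))*E1 - (q1.a*q3.a*(q1.a*q3.b-q3.a*q1.b))*E2 + (q1.a*q2.a*(q1.a*q2.b-q2.a*q1.b))*E3
    exact (mul_eq_zero.1 this).resolve_left hd


lemma res_dvd (p0 p1 p2 q0 q1 q2 a b m : ℤ) (hc : IsCoprime a b) (hP : m ∣ p0*a^2+p1*a*b+p2*b^2)
    (hQ : m ∣ q0*a^2+q1*a*b+q2*b^2) : m ∣ (p0*q2-p2*q0)^2-(p0*q1-p1*q0)*(p1*q2-p2*q1) := by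
  obtain ⟨P, hP⟩ := hP
  obtain ⟨Q, hQ⟩ := hQ
  obtain ⟨r, s, hrs⟩ := (hc.pow_left (m := 3)).pow_right (n := 3)
  set R := (p0*q2-p2*q0)^2-(p0*q1-p1*q0)*(p1*q2-p2*q1) with hR
  have h1 : m ∣ R*a^3 := by
    refine ⟨(a*(p0*q2-p2*q0)-b*(p1*q2-p2*q1))*(q2*P-p2*Q) - a*(p1*q2-p2*q1)*(q1*P-p1*Q), ?_⟩
    have : R*a^3 = (a*(p0*q2-p2*q0)-b*(p1*q2-p2*q1))*(q2*(p0*a^2+p1*a*b+p2*b^2)-p2*(q0*a^2+q1*a*b+q2*b^2)) - a*(p1*q2-p2*q1)*(q1*(p0*a^2+p1*a*b+p2*b^2)-p1*(q0*a^2+q1*a*b+q2*b^2)) := by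
      rw [hR]; ring
    rw [this, hP, hQ]; ring
  have h2 : m ∣ R*b^3 := by
    refine ⟨(a*(p0*q1-p1*q0)-b*(p0*q2-p2*q0))*(q0*P-p0*Q) + b*(p0*q1-p1*q0)*(q1*P-p1*Q), ?_⟩
    have : R*b^3 = (a*(p0*q1-p1*q0)-b*(p0*q2-p2*q0))*(q0*(p0*a^2+p1*a*b+p2*b^2)-p0*(q0*a^2+q1*a*b+q2*b^2)) + b*(p0*q1-p1*q0)*(q1*(p0*a^2+p1*a*b+p2*b^2)-p1*(q0*a^2+q1*a*b+q2*b^2)) := by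
      rw [hR]; ring
    rw [this, hP, hQ]; ring
  have : R = r*(R*a^3)+s*(R*b^3) := by linear_combination (-R)*hrs
  rw [this]
  exact dvd_add (h1.mul_left r) (h2.mul_left s)

lemma form_coord (p0 p1 p2 a1 b1 r s w : ℤ) (hrs : r*a1+s*b1 = 1) (hw : p0*a1^2+p1*a1*b1+p2*b1^2 = w) :
    ∃ b c : ℤ, ∀ l1 l2 : ℤ, p0*l1^2+p1*l1*l2+p2*l2^2 = w*(r*l1+s*l2)^2+b*(r*l1+s*l2)*(a1*l2-b1*l1)+c*(a1*l2-b1*l1)^2 := by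
  refine ⟨2*p0*a1*(-s)+p1*(a1*r-s*b1)+2*p2*b1*r, p0*s^2-p1*s*r+p2*r^2, fun l1 l2 => ?_⟩
  have e1 : l1 = (r*l1+s*l2)*a1 - s*(a1*l2-b1*l1) := by linear_combination (-l1)*hrs
  have e2 : l2 = (r*l1+s*l2)*b1 + r*(a1*l2-b1*l1) := by linear_combination (-l2)*hrs
  generalize r*l1+s*l2 = X at *
  generalize a1*l2-b1*l1 = Y at *
  rw [e1, e2, ← hw]; ring

lemma coef_dvd (p0 p1 p2 a1 b1 r s w b c h Δ : ℤ) (hf : ∀ l1 l2 : ℤ, p0*l1^2+p1*l1*l2+p2*l2^2 = w*(r*l1+s*l2)^2+b*(r*l1+s*l2)*(a1*l2-b1*l1)+c*(a1*l2-b1*l1)^2)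
    (hw : h ∣ w) (hb : h ∣ b*Δ) (hc : h ∣ c*Δ) : h ∣ p0*Δ ∧ h ∣ p1*Δ ∧ h ∣ p2*Δ := by
  have key : ∀ l1 l2 : ℤ, h ∣ (p0*l1^2+p1*l1*l2+p2*l2^2)*Δ := by
    intro l1 l2
    rw [hf, show (w*(r*l1+s*l2)^2+b*(r*l1+s*l2)*(a1*l2-b1*l1)+c*(a1*l2-b1*l1)^2)*Δ = w*((r*l1+s*l2)^2*Δ) + (b*Δ)*((r*l1+s*l2)*(a1*l2-b1*l1)) + (c*Δ)*(a1*l2-b1*l1)^2 from by ring]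
    exact dvd_add (dvd_add (hw.mul_right _) (hb.mul_right _)) (hc.mul_right _)
  have k1 := key 1 0
  have k2 := key 0 1
  have k3 := key 1 1
  have e1 : (p0*1^2+p1*1*0+p2*0^2)*Δ = p0*Δ := by ring
  have e2 : (p0*0^2+p1*0*1+p2*1^2)*Δ = p2*Δ := by ring
  rw [e1] at k1
  rw [e2] at k2
  refine ⟨k1, ?_, k2⟩
  have := dvd_sub (dvd_sub k3 k1) k2
  rwa [show (p0*1^2+p1*1*1+p2*1^2)*Δ - p0*Δ - p2*Δ = p1*Δ from by ring] at this

lemma cross_dvd (b c X Y X' Y' h : ℤ) (h1 : h ∣ b*X+c*Y) (h2 : h ∣ b*X'+c*Y') : h ∣ b*(X*Y'-Y*X') ∧ h ∣ c*(X*Y'-Y*X') := by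
  constructor
  · rw [show b*(X*Y'-Y*X') = (b*X+c*Y)*Y' - (b*X'+c*Y')*Y from by ring]
    exact dvd_sub (h1.mul_right _) (h2.mul_right _)
  · rw [show c*(X*Y'-Y*X') = (b*X'+c*Y')*X - (b*X+c*Y)*X' from by ring]
    exact dvd_sub (h2.mul_right _) (h1.mul_right _)

lemma sub_gcd (m w X Y b c g h : ℤ) (hg : g = Int.gcd Y m) (hm : m ≠ 0) (hgh : m = g*h)
    (hP : m ∣ w*X^2+b*X*Y+c*Y^2) (hw : m ∣ w) : h ∣ b*X+c*Y := by
  have h1 : m ∣ Y*(b*X+c*Y) := by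
    have := dvd_sub hP (hw.mul_right (X^2))
    rwa [show w*X^2+b*X*Y+c*Y^2 - w*X^2 = Y*(b*X+c*Y) from by ring] at this
  have hgY : g ∣ Y := by rw [hg]; exact Int.gcd_dvd_left ..
  obtain ⟨Y', hY'⟩ := hgY
  have hg0 : g ≠ 0 := by rintro rfl; apply hm; rw [hgh, zero_mul]
  have hcop : IsCoprime h Y' := by
    have := Int.gcd_eq_gcd_ab Y m
    rw [← hg] at this
    refine ⟨Int.gcdB Y m, Int.gcdA Y m, ?_⟩
    apply mul_left_cancel₀ hg0
    linear_combination -this - Int.gcdA Y m * hY' - Int.gcdB Y m * hgh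
  rw [hY', hgh, mul_assoc] at h1
  have := (mul_dvd_mul_iff_left hg0).1 h1
  exact hcop.dvd_of_dvd_mul_left (by rw [hY']; exact this)

def lat (g h a1 b1 r s b c b' c' : ℤ) : AddSubgroup (ℤ × ℤ) where
  carrier := {l | g ∣ a1*l.2-b1*l.1 ∧ h ∣ b*(r*l.1+s*l.2)+c*(a1*l.2-b1*l.1) ∧ h ∣ b'*(r*l.1+s*l.2)+c'*(a1*l.2-b1*l.1)}
  add_mem' := by
    rintro ⟨x, y⟩ ⟨x', y'⟩ ⟨h1, h2, h3⟩ ⟨h4, h5, h6⟩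
    simp only [Prod.mk_add_mk, Set.mem_setOf_eq] at *
    refine ⟨?_, ?_, ?_⟩
    · have := dvd_add h1 h4; ring_nf at this ⊢; exact this
    · have := dvd_add h2 h5; ring_nf at this ⊢; exact this
    · have := dvd_add h3 h6; ring_nf at this ⊢; exact this
  zero_mem' := by simp
  neg_mem' := by
    rintro ⟨x, y⟩ ⟨h1, h2, h3⟩
    simp only [Prod.neg_mk, Set.mem_setOf_eq] at *
    refine ⟨?_, ?_, ?_⟩
    · have := h1.neg_right; ring_nf at this ⊢; exact this
    · have := h2.neg_right; ring_nf at this ⊢; exact this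
    · have := h3.neg_right; ring_nf at this ⊢; exact this

lemma mem_lat (g h a1 b1 r s b c b' c' : ℤ) (l : ℤ × ℤ) : l ∈ lat g h a1 b1 r s b c b' c' ↔
  g ∣ a1*l.2-b1*l.1 ∧ h ∣ b*(r*l.1+s*l.2)+c*(a1*l.2-b1*l.1) ∧ h ∣ b'*(r*l.1+s*l.2)+c'*(a1*l.2-b1*l.1) := Iff.rfl

open Classical in
lemma case21 {x D τ : ℝ} {S : Finset Qd} (hP : Par x D τ) (hC : Cls x D τ S) (hn : ∀ q ∈ S, ¬ LTD x D τ q) 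
    (Z J : ℕ) (hZ : 0 < Z) (hJ : 2*D*τ ≤ (Z:ℝ)^J) (p0 p1 p2 q0 q1 q2 : ℤ) 
    (hrel : ∀ q ∈ S, (p0*q.a^2+p1*q.a*q.b+p2*q.b^2)*q.u+(q0*q.a^2+q1*q.a*q.b+q2*q.b^2)*q.v = 0)
    (hprim : ∀ m z : ℤ, m ∣ p0*z → m ∣ p1*z → m ∣ p2*z → m ∣ q0*z → m ∣ q1*z → m ∣ q2*z → m ∣ z)
    (Dv : ℕ) (hres : (p0*q2-p2*q0)^2-(p0*q1-p1*q0)*(p1*q2-p2*q1) ≠ 0) 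
    (hDv : ((p0*q2-p2*q0)^2-(p0*q1-p1*q0)*(p1*q2-p2*q1)).natAbs.divisors.card ≤ Dv) :
    S.card ≤ 9^J*(10^13*Z^4+1) * (2*Dv) * (2*Dv) := by
  set R := (p0*q2-p2*q0)^2-(p0*q1-p1*q0)*(p1*q2-p2*q1) with hR
  have hm : ∀ q : Qd, ∃ m : ℤ, q ∈ S → (q0*q.a^2+q1*q.a*q.b+q2*q.b^2) = m*q.u ∧ (p0*q.a^2+p1*q.a*q.b+p2*q.b^2) = -(m*q.v) := by
    intro q
    by_cases h : q ∈ S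
    · obtain ⟨m, h1⟩ := mfun (hC.good q h).cop' (hrel q h)
      exact ⟨m, fun _ => h1⟩
    · exact ⟨0, fun h' => absurd h' h⟩
  choose M hM using hm
  have hMR : ∀ q ∈ S, M q ∣ R := by
    intro q hq
    obtain ⟨e1, e2⟩ := hM q hq
    exact res_dvd _ _ _ _ _ _ q.a q.b _ (hC.good q hq).cop (by rw [e2]; exact (dvd_mul_right _ _).neg_right) (by rw [e1]; exact dvd_mul_right _ _)
  have himg : (S.image M).card ≤ 2*Dv := by
    refine (int_div_card (S.image M) _ hres ?_).trans (Nat.mul_le_mul_left 2 hDv)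
    intro m hm
    rw [Finset.mem_image] at hm
    obtain ⟨q, hq, rfl⟩ := hm
    exact hMR q hq
  refine (Finset.card_le_mul_card_image (f := M) S (9^J*(10^13*Z^4+1)*(2*Dv)) ?_).trans (Nat.mul_le_mul_left _ himg)
  intro m hm
  rw [Finset.mem_image] at hm
  obtain ⟨k, hk, hkm⟩ := hm
  have hmR : m ∣ R := hkm ▸ hMR k hk
  have hm0 : m ≠ 0 := by
    rintro rfl; exact hres (zero_dvd_iff.1 hmR)
  obtain ⟨r, s, hrs⟩ := (hC.good k hk).cop
  obtain ⟨ek1, ek2⟩ := hM k hk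
  rw [hkm] at ek1 ek2
  obtain ⟨b, c, hbc⟩ := form_coord p0 p1 p2 k.a k.b r s _ hrs ek2
  obtain ⟨b', c', hbc'⟩ := form_coord q0 q1 q2 k.a k.b r s _ hrs ek1
  set T := S.filter (fun q => M q = m) with hT
  set G : Qd → ℤ := fun q => (Int.gcd (k.a*q.b-k.b*q.a) m : ℤ) with hG
  have hGm : ∀ q, G q ∣ m := fun q => Int.gcd_dvd_right ..
  have himg2 : (T.image G).card ≤ 2*Dv := by
    refine (int_div_card (T.image G) _ hres ?_).trans (Nat.mul_le_mul_left 2 hDv)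
    intro g hg
    rw [Finset.mem_image] at hg
    obtain ⟨q, hq, rfl⟩ := hg
    exact (hGm q).trans hmR
  refine (Finset.card_le_mul_card_image (f := G) T (9^J*(10^13*Z^4+1)) ?_).trans (Nat.mul_le_mul_left _ himg2)
  intro g hg
  rw [Finset.mem_image] at hg
  obtain ⟨k', -, hk'⟩ := hg
  obtain ⟨h, hgh⟩ := hGm k'
  rw [hk'] at hgh
  have hsub : ∀ q ∈ T.filter (fun q => G q = g), q ∈ S ∧ M q = m ∧ G q = g := by
    intro q hq
    rw [Finset.mem_filter, hT, Finset.mem_filter] at hq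
    exact ⟨hq.1.1, hq.1.2, hq.2⟩
  have hW1 : m ∣ -(m*k.v) := (dvd_mul_right _ _).neg_right
  have hW2 : m ∣ m*k.u := dvd_mul_right _ _
  have hhm : h ∣ m := ⟨g, by rw [hgh]; ring⟩
  have hform : ∀ (w b c X Y : ℤ), m ∣ w → g ∣ Y → h ∣ b*X+c*Y → m ∣ w*X^2+b*X*Y+c*Y^2 := by
    intro w b c X Y h1 h2 h3
    rw [show w*X^2+b*X*Y+c*Y^2 = w*X^2 + Y*(b*X+c*Y) from by ring]
    refine dvd_add (h1.mul_right _) ?_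
    rw [hgh]; exact mul_dvd_mul h2 h3
  refine core2 hP (hC.mono (fun q hq => (hsub q hq).1)) (fun q hq => hn q (hsub q hq).1) (lat g h k.a k.b r s b c b' c') ?_ m 
     q0 q1 q2 (-p0) (-p1) (-p2) hm0 ?_ ?_ ?_ ?_ ?_ Z J hZ hJ
  · intro q hq
    obtain ⟨h1, h2, h3⟩ := hsub q hq
    obtain ⟨e1, e2⟩ := hM q h1
    rw [h2] at e1 e2
    rw [mem_lat]
    refine ⟨?_, ?_, ?_⟩
    · rw [← h3]; exact Int.gcd_dvd_left ..
    · refine sub_gcd m _ _ _ b c g h h3.symm hm0 hgh ?_ hW1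
      rw [← hbc, e2]; exact (dvd_mul_right _ _).neg_right
    · refine sub_gcd m _ _ _ b' c' g h h3.symm hm0 hgh ?_ hW2
      rw [← hbc', e1]; exact (dvd_mul_right _ _)
  · intro q hq
    obtain ⟨h1, h2, h3⟩ := hsub q hq
    obtain ⟨e1, e2⟩ := hM q h1
    rw [e1, h2]
  · intro q hq
    obtain ⟨h1, h2, h3⟩ := hsub q hq
    obtain ⟨e1, e2⟩ := hM q h1
    rw [← h2]; linear_combination e2
  · intro l hl
    rw [mem_lat] at hl
    rw [hbc']
    exact hform _ _ _ _ _ hW2 hl.1 hl.2.2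
  · intro l hl
    rw [mem_lat] at hl
    rw [show -p0*l.1^2 + -p1*l.1*l.2 + -p2*l.2^2 = -(p0*l.1^2+p1*l.1*l.2+p2*l.2^2) from by ring, hbc]
    exact (hform _ _ _ _ _ hW1 hl.1 hl.2.1).neg_right
  · intro l hl l' hl'
    rw [mem_lat] at hl hl'
    obtain ⟨h1, h2, h3⟩ := hl
    obtain ⟨h1', h2', h3'⟩ := hl'
    have eΔ : l.1*l'.2-l.2*l'.1 = (r*l.1+s*l.2)*(k.a*l'.2-k.b*l'.1) - (k.a*l.2-k.b*l.1)*(r*l'.1+s*l'.2) := by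
      linear_combination (-(l.1*l'.2-l.2*l'.1))*hrs
    rw [eΔ]
    obtain ⟨c1, c2⟩ := cross_dvd _ _ _ _ _ _ _ h2 h2'
    obtain ⟨c3, c4⟩ := cross_dvd _ _ _ _ _ _ _ h3 h3'
    obtain ⟨d1, d2, d3⟩ := coef_dvd _ _ _ _ _ _ _ _ _ _ h _ hbc (hhm.trans hW1) c1 c2
    obtain ⟨d4, d5, d6⟩ := coef_dvd _ _ _ _ _ _ _ _ _ _ h _ hbc' (hhm.trans hW2) c3 c4
    rw [sq, hgh]
    refine mul_dvd_mul ?_ (hprim _ _ d1 d2 d3 d4 d5 d6)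
    exact dvd_sub (h1'.mul_left _) (h1.mul_right _)


lemma sylv (p0 p1 p2 q0 q1 q2 : ℤ) (hres : (p0*q2-p2*q0)^2-(p0*q1-p1*q0)*(p1*q2-p2*q1) = 0) :
    ∃ u0 u1 v0 v1 : ℤ, ¬ (u0 = 0 ∧ u1 = 0 ∧ v0 = 0 ∧ v1 = 0) ∧ ∀ a b : ℤ, 
      (u0*a+u1*b)*(p0*a^2+p1*a*b+p2*b^2)+(v0*a+v1*b)*(q0*a^2+q1*a*b+q2*b^2) = 0 := by
  have hdet : (!![p0, 0, q0, 0; p1, p0, q1, q0; p2, p1, q2, q1; 0, p2, 0, q2] : Matrix (Fin 4) (Fin 4) ℤ).det = 0 := by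
    simp [Matrix.det_succ_row_zero, Fin.sum_univ_succ, Fin.succAbove]
    linear_combination hres
  obtain ⟨w, hw, hw0⟩ := Matrix.exists_mulVec_eq_zero_iff.2 hdet
  refine ⟨w 0, w 1, w 2, w 3, ?_, ?_⟩
  · rintro ⟨h0, h1, h2, h3⟩
    apply hw; ext i; fin_cases i <;> simpa
  · intro a b
    have e0 := congrFun hw0 0
    have e1 := congrFun hw0 1
    have e2 := congrFun hw0 2
    have e3 := congrFun hw0 3
    simp [Matrix.mulVec, dotProduct, Fin.sum_univ_four] at e0 e1 e2 e3
    linear_combination a^3*e0+a^2*b*e1+a*b^2*e2+b^3*e3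

def vec4 (q : Qd) : Fin 2 × Fin 2 → ℤ := fun j => (![q.a, q.b] j.1) * (![q.u, q.v] j.2)

lemma ent_bd {x D τ : ℝ} {S : Finset Qd} (hP : Par x D τ) (hC : Cls x D τ S) {q : Qd} (h : q ∈ S) :
    |(q.a:ℝ)| ≤ x ∧ |(q.b:ℝ)| ≤ x ∧ |(q.a:ℝ)^2| ≤ x ∧ |(q.a:ℝ)*q.b| ≤ x ∧ |(q.b:ℝ)^2| ≤ x ∧ |(q.u:ℝ)| ≤ x^2 ∧ |(q.v:ℝ)| ≤ x^2 := by
  have hx := hP.x100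
  have hD1 := hP.D1
  have hDx := hP.Dx
  have hd2 := hC.dhi q h
  have hd1 := hC.dlo q h
  have hb := (hC.good q h).beta_sq (by linarith) (by linarith) hd1
  have ha2 := sq_nonneg (q.a:ℝ)
  have hb2 := sq_nonneg (q.b:ℝ)
  have hu2 := sq_nonneg (q.u:ℝ)
  have hv2 := sq_nonneg (q.v:ℝ)
  have hbb : (q.u:ℝ)^2+(q.v:ℝ)^2 ≤ (x^2)^2 := by
    have h1 : x/D ≤ x := div_le_self (by linarith) hD1
    have h2 : (x/D)^2 ≤ x^2 := pow_le_pow_left₀ (by positivity) h1 2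
    have h3 : 5*x^2 ≤ x^2*x^2 := mul_le_mul_of_nonneg_right (by nlinarith) (by positivity)
    calc _ ≤ _ := hb
      _ ≤ 5*x^2 := by linarith
      _ ≤ _ := by rw [sq (x^2)]; exact h3
  have xx : x ≤ x^2 := by nlinarith
  refine ⟨?_, ?_, ?_, ?_, ?_, ?_, ?_⟩
  · exact abs_le_of_sq_le_sq (by linarith) (by linarith)
  · exact abs_le_of_sq_le_sq (by linarith) (by linarith)
  · rw [abs_of_nonneg ha2]; linarith
  · rw [abs_le]; constructor <;> nlinarith [sq_nonneg ((q.a:ℝ)+q.b), sq_nonneg ((q.a:ℝ)-q.b)]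
  · rw [abs_of_nonneg hb2]; linarith
  · exact abs_le_of_sq_le_sq (by linarith) (by positivity)
  · exact abs_le_of_sq_le_sq (by linarith) (by positivity)

lemma small_det {M : ℝ} (a b c d : ℤ) (ha : |(a:ℝ)| ≤ M) (hb : |(b:ℝ)| ≤ M) (hc : |(c:ℝ)| ≤ M) (hd : |(d:ℝ)| ≤ M) :
    |((a*b-c*d : ℤ):ℝ)| ≤ 2*M^2 := by
  have h1 : |(a:ℝ)*b| ≤ M*M := by rw [abs_mul]; exact mul_le_mul ha hb (abs_nonneg _) ((abs_nonneg _).trans ha)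
  have h2 : |(c:ℝ)*d| ≤ M*M := by rw [abs_mul]; exact mul_le_mul hc hd (abs_nonneg _) ((abs_nonneg _).trans ha)
  push_cast
  calc _ ≤ |(a:ℝ)*b| + |(c:ℝ)*d| := abs_sub _ _
    _ ≤ _ := by linarith

lemma det4_zero (T : Set Qd) (g00 g10 g01 g11 : ℤ) (hrel : ∀ q ∈ T, (g00*q.a+g10*q.b)*q.u+(g01*q.a+g11*q.b)*q.v = 0)
    (hne : ¬ (g00 = 0 ∧ g10 = 0 ∧ g01 = 0 ∧ g11 = 0)) (f : Fin 2 × Fin 2 → Qd) (hf : ∀ i, f i ∈ T) :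
    (Matrix.of fun i j => vec4 (f i) j).det = 0 := by
  rw [← Matrix.exists_mulVec_eq_zero_iff]
  refine ⟨fun j => ![![g00, g01], ![g10, g11]] j.1 j.2, ?_, ?_⟩
  · intro h
    apply hne
    exact ⟨congrFun h (0,0), congrFun h (1,0), congrFun h (0,1), congrFun h (1,1)⟩
  · ext i
    have := hrel _ (hf i)
    simp [Matrix.mulVec, dotProduct, Fintype.sum_prod_type, vec4]
    linear_combination this

open Classical in
set_option maxHeartbeats 1000000 in
lemma class_bound {x D τ : ℝ} {S : Finset Qd} (hP : Par x D τ) (hC : Cls x D τ S) (hn : ∀ q ∈ S, ¬ LTD x D τ q) 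
    (Z J : ℕ) (hZ : 0 < Z) (hJ : 2*D*τ ≤ (Z:ℝ)^J) (Dv : ℕ) 
    (hDv : ∀ N : ℕ, N ≠ 0 → (N:ℝ) ≤ 8*((6*x^3)^6)^4 → N.divisors.card ≤ Dv) :
    S.card ≤ 4 + 9^J*(10^13*Z^4+1) * (2*Dv) * (2*Dv) := by
  have hx := hP.x100
  have hH1 : (1:ℝ) ≤ x^3 := one_le_pow₀ (by linarith)
  have hM1 : (1:ℝ) ≤ (6*x^3)^6 := one_le_pow₀ (by linarith)
  have hDv1 : 1 ≤ Dv := by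
    have := hDv 1 (by norm_num) (by
      have : (1:ℝ) ≤ ((6*x^3)^6)^4 := one_le_pow₀ hM1
      push_cast; linarith)
    simpa using this
  have key : ∀ N : ℤ, N ≠ 0 → |(N:ℝ)| ≤ 8*((6*x^3)^6)^4 → N.natAbs.divisors.card ≤ Dv := by
    intro N h1 h2
    apply hDv _ (by simpa using h1)
    rw [Nat.cast_natAbs]; push_cast; exact h2
  have hxx : x * x^2 = x^3 := by ring
  obtain ⟨G, hG0, hGb, hGr, hGp⟩ := relation_prim vec6 (S : Set Qd) (x^3) hH1 (by
    intro q hq j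
    obtain ⟨e1, e2, e3, e4, e5, e6, e7⟩ := ent_bd hP hC hq
    have mm : ∀ s t : ℝ, |s| ≤ x → |t| ≤ x^2 → |s*t| ≤ x^3 := by
      intro s t h1 h2
      rw [abs_mul, ← hxx]; exact mul_le_mul h1 h2 (abs_nonneg _) (by linarith)
    obtain ⟨i, j⟩ := j
    fin_cases i <;> fin_cases j
    · show |((q.a^2*q.u : ℤ):ℝ)| ≤ x^3
      push_cast; exact mm _ _ e3 e6
    · show |((q.a^2*q.v : ℤ):ℝ)| ≤ x^3
      push_cast; exact mm _ _ e3 e7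
    · show |((q.a*q.b*q.u : ℤ):ℝ)| ≤ x^3
      push_cast; exact mm _ _ e4 e6
    · show |((q.a*q.b*q.v : ℤ):ℝ)| ≤ x^3
      push_cast; exact mm _ _ e4 e7
    · show |((q.b^2*q.u : ℤ):ℝ)| ≤ x^3
      push_cast; exact mm _ _ e5 e6
    · show |((q.b^2*q.v : ℤ):ℝ)| ≤ x^3
      push_cast; exact mm _ _ e5 e7) (fun f hf => hC.det_zero hP f hf)
  replace hGb : ∀ i j, |(G (i,j):ℝ)| ≤ (6*x^3)^6 := by
    intro i j
    have := hGb (i,j)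
    rw [show Fintype.card (Fin 3 × Fin 2) = 6 from rfl] at this
    exact_mod_cast this
  have hrel : ∀ q ∈ S, (G (0,0)*q.a^2+G (1,0)*q.a*q.b+G (2,0)*q.b^2)*q.u+(G (0,1)*q.a^2+G (1,1)*q.a*q.b+G (2,1)*q.b^2)*q.v = 0 := by
    intro q hq
    have := hGr q hq
    simp [Fintype.sum_prod_type, Fin.sum_univ_three, vec6] at this
    linear_combination this
  have hprim : ∀ m z : ℤ, m ∣ G (0,0)*z → m ∣ G (1,0)*z → m ∣ G (2,0)*z → m ∣ G (0,1)*z → m ∣ G (1,1)*z → m ∣ G (2,1)*z → m ∣ z := by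
    intro m z h1 h2 h3 h4 h5 h6
    apply hGp
    rintro ⟨i, j⟩
    fin_cases i <;> fin_cases j <;> assumption
  have hne : ¬ (G (0,0) = 0 ∧ G (1,0) = 0 ∧ G (2,0) = 0 ∧ G (0,1) = 0 ∧ G (1,1) = 0 ∧ G (2,1) = 0) := by
    rintro ⟨h1, h2, h3, h4, h5, h6⟩
    apply hG0
    ext ⟨i, j⟩
    fin_cases i <;> fin_cases j <;> assumption
  have b00 := hGb 0 0
  have b10 := hGb 1 0
  have b20 := hGb 2 0
  have b01 := hGb 0 1
  have b11 := hGb 1 1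
  have b21 := hGb 2 1
  generalize G (0,0) = p0 at *
  generalize G (1,0) = p1 at *
  generalize G (2,0) = p2 at *
  generalize G (0,1) = q0 at *
  generalize G (1,1) = q1 at *
  generalize G (2,1) = q2 at *
  clear hGb hGr hGp hG0
  set M : ℝ := (6*x^3)^6 with hM
  by_cases hres : (p0*q2-p2*q0)^2-(p0*q1-p1*q0)*(p1*q2-p2*q1) = 0
  swap
  · have := case21 hP hC hn Z J hZ hJ p0 p1 p2 q0 q1 q2 hrel hprim Dv hres (key _ hres (by
      have h1 := small_det p0 q2 p2 q0 b00 b21 b20 b01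
      have h2 := small_det p0 q1 p1 q0 b00 b11 b10 b01
      have h3 := small_det p1 q2 p2 q1 b10 b21 b20 b11
      have := small_det _ _ _ _ h1 h1 h2 h3
      rw [sq]
      refine this.trans (le_of_eq (by ring))))
    omega
  · obtain ⟨u0, u1, v0, v1, hnz, huv⟩ := sylv _ _ _ _ _ _ hres
    set T0 := S.filter (fun q => p0*q.a^2+p1*q.a*q.b+p2*q.b^2 = 0 ∧ q0*q.a^2+q1*q.a*q.b+q2*q.b^2 = 0) with hT0
    set T1 := S.filter (fun q => ¬ (p0*q.a^2+p1*q.a*q.b+p2*q.b^2 = 0 ∧ q0*q.a^2+q1*q.a*q.b+q2*q.b^2 = 0)) with hT1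
    have hsum : T0.card + T1.card = S.card := Finset.card_filter_add_card_filter_not _
    have hT0c : T0.card ≤ 2 := by
      by_cases hp : p0 = 0 ∧ p1 = 0 ∧ p2 = 0
      · refine quad_vanish (fun q hq => hC.good q (Finset.mem_filter.1 hq).1) q0 q1 q2 ?_ (fun q hq => (Finset.mem_filter.1 hq).2.2)
        tauto
      · exact quad_vanish (fun q hq => hC.good q (Finset.mem_filter.1 hq).1) p0 p1 p2 hp (fun q hq => (Finset.mem_filter.1 hq).2.1)
    have hC1 : Cls x D τ T1 := hC.mono (Finset.filter_subset _ _)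
    have hrel1 : ∀ q ∈ (T1 : Set Qd), (v0*q.a+v1*q.b)*q.u+((-u0)*q.a+(-u1)*q.b)*q.v = 0 := by
      intro q hq
      obtain ⟨hqS, hq0⟩ := Finset.mem_filter.1 (Finset.mem_coe.1 hq)
      obtain ⟨m, hm1, hm2⟩ := mfun (hC.good q hqS).cop' (hrel q hqS)
      have hm0 : m ≠ 0 := by
        rintro rfl
        apply hq0
        exact ⟨by rw [hm2]; ring, by rw [hm1]; ring⟩
      have := huv q.a q.b
      rw [hm1, hm2] at this
      apply mul_left_cancel₀ hm0
      linear_combination this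
    obtain ⟨G, hG0, hGb, hGr, hGp⟩ := relation_prim vec4 (T1 : Set Qd) (x^3) hH1 (by
      intro q hq j
      obtain ⟨e1, e2, e3, e4, e5, e6, e7⟩ := ent_bd hP hC1 hq
      have mm : ∀ s t : ℝ, |s| ≤ x → |t| ≤ x^2 → |s*t| ≤ x^3 := by
        intro s t h1 h2
        rw [abs_mul, ← hxx]; exact mul_le_mul h1 h2 (abs_nonneg _) (by linarith)
      obtain ⟨i, j⟩ := j
      fin_cases i <;> fin_cases j
      · show |((q.a*q.u : ℤ):ℝ)| ≤ x^3
        push_cast; exact mm _ _ e1 e6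
      · show |((q.a*q.v : ℤ):ℝ)| ≤ x^3
        push_cast; exact mm _ _ e1 e7
      · show |((q.b*q.u : ℤ):ℝ)| ≤ x^3
        push_cast; exact mm _ _ e2 e6
      · show |((q.b*q.v : ℤ):ℝ)| ≤ x^3
        push_cast; exact mm _ _ e2 e7) 
      (fun f hf => det4_zero (T1 : Set Qd) _ _ _ _ hrel1 (by
        rintro ⟨h1, h2, h3, h4⟩
        exact hnz ⟨by linarith, by linarith, h1, h2⟩) f hf)
    replace hGb : ∀ i j, |(G (i,j):ℝ)| ≤ (4*x^3)^4 := by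
      intro i j
      have := hGb (i,j)
      rw [show Fintype.card (Fin 2 × Fin 2) = 4 from rfl] at this
      exact_mod_cast this
    have hle : (4*x^3)^4 ≤ M := by
      calc (4*x^3)^4 ≤ (6*x^3)^4 := pow_le_pow_left₀ (by linarith) (by linarith) 4
        _ ≤ _ := pow_le_pow_right₀ (by linarith) (by norm_num)
    have := case11 hP hC1 (fun q hq => hn q (Finset.mem_filter.1 hq).1) Z J hZ hJ (G (0,0)) (G (1,0)) (G (0,1)) (G (1,1)) (by
        intro q hq
        have := hGr q hq
        simp [Fintype.sum_prod_type, vec4] at this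
        linear_combination this) (by
        rintro ⟨h1, h2, h3, h4⟩
        apply hG0
        ext ⟨i, j⟩
        fin_cases i <;> fin_cases j <;> assumption) (by
        intro m z h1 h2 h3 h4
        apply hGp
        rintro ⟨i, j⟩
        fin_cases i <;> fin_cases j <;> assumption) Dv (fun h => key _ h (by
        refine (small_det _ _ _ _ ((hGb 0 0).trans hle) ((hGb 1 1).trans hle) ((hGb 1 0).trans hle) ((hGb 0 1).trans hle)).trans ?_
        have : M^2 ≤ M^4 := pow_le_pow_right₀ hM1 (by norm_num)
        have : 0 ≤ M^4 := by positivity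
        linarith))
    have h2 : 9^J*(10^13*Z^4+1) * (2*Dv) ≤ 9^J*(10^13*Z^4+1) * (2*Dv) * (2*Dv) := Nat.le_mul_of_pos_right _ (by omega)
    omega


open Classical in
lemma lt_half {ι : Type*} (T : Finset ι) (A B : ι → ℤ) (hinj : ∀ i ∈ T, ∀ j ∈ T, A i = A j → B i = B j → i = j)
    (R Ω K : ℕ) (hK : 1 ≤ K) (hA : ∀ i ∈ T, |A i| ≤ R)
    (h : ∀ i ∈ T, ∃ (p : ℕ) (r : ℤ), IsCoprime (p:ℤ) r ∧ |r| ≤ p ∧ p ∈ Finset.Icc 1 Ω ∧ |p * B i - r * A i| ≤ K) :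
    T.card ≤ Ω * (9*K*(2*R+3*Ω)) := by
  have h' : ∀ i, ∃ (p : ℕ) (r : ℤ), i ∈ T → IsCoprime (p:ℤ) r ∧ |r| ≤ p ∧ p ∈ Finset.Icc 1 Ω ∧ |p * B i - r * A i| ≤ K := by
    intro i
    by_cases hi : i ∈ T
    · obtain ⟨p, r, H⟩ := h i hi
      exact ⟨p, r, fun _ => H⟩
    · exact ⟨0, 0, fun h => absurd h hi⟩
  choose p r H using h'
  rw [Finset.card_eq_sum_card_fiberwise (f := p) (t := Finset.Icc 1 Ω) (fun i hi => (H i hi).2.2.1)]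
  have : ∀ P ∈ Finset.Icc 1 Ω, (T.filter (fun i => p i = P)).card ≤ 9*K*(2*R+3*Ω) := by
    intro P hP
    rw [Finset.mem_Icc] at hP
    have hP0 : (0:ℤ) < P := by exact_mod_cast hP.1
    have hc : (T.filter (fun i => p i = P)).card ≤ 
       ((Finset.Icc (-(P:ℤ)) P) ×ˢ ((Finset.Icc (-(K:ℤ)) K) ×ˢ (Finset.Icc (-((R/P+1 : ℕ):ℤ)) ((R/P+1 : ℕ):ℤ)))).card := by
      apply Finset.card_le_card_of_injOn (fun i => (r i, P * B i - r i * A i, A i / P))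
      · intro i hi
        rw [Finset.mem_coe, Finset.mem_filter] at hi
        obtain ⟨hi, rfl⟩ := hi
        obtain ⟨h1, h2, h3, h4⟩ := H i hi
        have h5 := abs_le.1 (hA i hi)
        simp only [Finset.coe_product, Set.mem_prod, Finset.mem_coe, Finset.mem_Icc]
        refine ⟨abs_le.1 h2, abs_le.1 h4, ?_, ?_⟩
        · rw [Int.le_ediv_iff_mul_le hP0]
          have : (R:ℤ) < (p i : ℤ) * ((R / p i + 1 : ℕ) : ℤ) := by
            have := Nat.lt_mul_div_succ R (show 0 < p i from hP.1)
            exact_mod_cast this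
          nlinarith
        · have : A i / (p i:ℤ) < ((R / p i + 1 : ℕ) : ℤ) + 1 := by
            rw [Int.ediv_lt_iff_lt_mul hP0]
            have : (R:ℤ) < (p i : ℤ) * ((R / p i + 1 : ℕ) : ℤ) := by
              have := Nat.lt_mul_div_succ R (show 0 < p i from hP.1)
              exact_mod_cast this
            nlinarith
          omega
      · intro i hi j hj e
        rw [Finset.mem_coe, Finset.mem_filter] at hi hj
        simp only [Prod.mk.injEq] at e
        obtain ⟨e1, e2, e3⟩ := e
        obtain ⟨h1, -, -, -⟩ := H i hi.1
        rw [hi.2] at h1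
        rw [← e1] at e2
        have hd : (P:ℤ) ∣ r i * (A i - A j) := ⟨B i - B j, by linear_combination -e2⟩
        have hd := h1.dvd_of_dvd_mul_left hd
        have hmod : A i % P = A j % P := Int.emod_eq_emod_iff_emod_sub_eq_zero.2 (Int.emod_eq_zero_of_dvd hd)
        have hAA : A i = A j := by
          rw [← Int.mul_ediv_add_emod (A i) P, ← Int.mul_ediv_add_emod (A j) P, e3, hmod]
        refine hinj i hi.1 j hj.1 hAA ?_
        rw [hAA] at e2
        exact mul_left_cancel₀ hP0.ne' (by linarith)
    refine hc.trans ?_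
    rw [Finset.card_product, Finset.card_product, Int.card_Icc, Int.card_Icc, Int.card_Icc]
    have e1 : ((P:ℤ)+1- -(P:ℤ)).toNat = 2*P+1 := by omega
    have e2 : ((K:ℤ)+1- -(K:ℤ)).toNat = 2*K+1 := by omega
    have e3 : (((R/P+1 : ℕ):ℤ)+1- -((R/P+1 : ℕ):ℤ)).toNat = 2*(R/P)+3 := by omega
    rw [e1, e2, e3]
    have hdiv : P * (R/P) ≤ R := Nat.mul_div_le R P
    calc (2*P+1)*((2*K+1)*(2*(R/P)+3)) ≤ (3*P)*((3*K)*(2*(R/P)+3)) := by gcongr <;> omega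
      _ = 9*K*(2*(P*(R/P))+3*P) := by ring
      _ ≤ _ := by gcongr; exact hP.2
  calc _ ≤ ∑ _P ∈ Finset.Icc 1 Ω, 9*K*(2*R+3*Ω) := Finset.sum_le_sum this
    _ = _ := by simp

open Classical in
lemma lt_count {x : ℝ} (T : Finset Qd) (hT : ∀ q ∈ T, Good x q) (R Ω K : ℕ) (hK : 1 ≤ K) (hR : ∀ q ∈ T, |q.a| ≤ R)
    (h : ∀ q ∈ T, ∃ p r : ℤ, IsCoprime p r ∧ |p| ≤ Ω ∧ |r| ≤ Ω ∧ |p*q.b-r*q.a| ≤ K) :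
    T.card ≤ 2*(Ω * (9*K*(2*R+3*Ω))) := by
  set good : Qd → Prop := fun q => ∃ p r : ℤ, IsCoprime p r ∧ |p| ≤ Ω ∧ |r| ≤ Ω ∧ |p*q.b-r*q.a| ≤ K ∧ |r| ≤ |p| with hgood
  have hcop0 : ∀ p r : ℤ, IsCoprime p r → |r| ≤ |p| → 1 ≤ p.natAbs := by
    intro p r h1 h2
    by_contra h
    have : p = 0 := by omega
    subst this
    have : r = 0 := by simpa using h2
    subst this
    obtain ⟨s, t, hst⟩ := h1
    simp at hst
  have sgn : ∀ p r : ℤ, ∃ r' : ℤ, |r'| = |r| ∧ (IsCoprime p r → IsCoprime (p.natAbs:ℤ) r') ∧ ∀ A B : ℤ, |(p.natAbs:ℤ)*B-r'*A| = |p*B-r*A| := by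
    intro p r
    rcases Int.natAbs_eq p with e | e
    · refine ⟨r, rfl, ?_, ?_⟩
      · intro h; rwa [← e]
      · intro A B; rw [← e]
    · refine ⟨-r, abs_neg _, ?_, ?_⟩
      · intro h; rw [e] at h; simpa using h.neg_neg
      · intro A B
        rw [← abs_neg]; congr 1
        linear_combination -B * e
  have h1 : (T.filter good).card ≤ Ω * (9*K*(2*R+3*Ω)) := by
    refine lt_half _ (fun q => q.a) (fun q => q.b) ?_ R Ω K hK ?_ ?_
    · intro i hi j hj e1 e2
      exact same_alpha (hT i (Finset.mem_filter.1 hi).1) (hT j (Finset.mem_filter.1 hj).1) e1 e2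
    · intro i hi; exact hR i (Finset.mem_filter.1 hi).1
    · intro i hi
      obtain ⟨p, r, g1, g2, g3, g4, g5⟩ := (Finset.mem_filter.1 hi).2
      obtain ⟨r', s1, s2, s3⟩ := sgn p r
      refine ⟨p.natAbs, r', s2 g1, ?_, ?_, ?_⟩
      · rw [s1]; simpa using g5
      · rw [Finset.mem_Icc]; refine ⟨hcop0 p r g1 g5, ?_⟩
        rw [Int.abs_eq_natAbs] at g2; exact_mod_cast g2
      · rw [s3]; exact g4
  have h2 : (T.filter (fun q => ¬ good q)).card ≤ Ω * (9*K*(2*R+3*Ω)) := by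
    refine lt_half _ (fun q => q.b) (fun q => q.a) ?_ R Ω K hK ?_ ?_
    · intro i hi j hj e1 e2
      exact same_alpha (hT i (Finset.mem_filter.1 hi).1) (hT j (Finset.mem_filter.1 hj).1) e2 e1
    · intro i hi
      have hi := (Finset.mem_filter.1 hi).1
      exact ((hT i hi).hab.trans (le_abs_self _)).trans (hR i hi)
    · intro i hi
      obtain ⟨hi, hng⟩ := Finset.mem_filter.1 hi
      obtain ⟨p, r, g1, g2, g3, g4⟩ := h i hi
      have g5 : |p| ≤ |r| := by
        by_contra hc
        exact hng ⟨p, r, g1, g2, g3, g4, (not_le.1 hc).le⟩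
      obtain ⟨r', s1, s2, s3⟩ := sgn r p
      refine ⟨r.natAbs, r', s2 g1.symm, ?_, ?_, ?_⟩
      · rw [s1]; simpa using g5
      · rw [Finset.mem_Icc]; refine ⟨hcop0 r p g1.symm g5, ?_⟩
        rw [Int.abs_eq_natAbs] at g3; exact_mod_cast g3
      · rw [s3, ← abs_neg]; simpa using g4
  have := Finset.card_filter_add_card_filter_not (s := T) good
  omega


lemma par_y {y D : ℝ} (hy : 10 ≤ y) (h1 : y^140 ≤ D) (h2 : D ≤ y^170) : Par (y^240) D (y^140)⁻¹ := by
  have hy0 : (0:ℝ) < y := by linarith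
  have hy1 : (1:ℝ) ≤ y := by linarith
  have p10 : ∀ n : ℕ, (10:ℝ)^n ≤ y^n := fun n => pow_le_pow_left₀ (by norm_num) hy n
  have pm : ∀ m n : ℕ, m ≤ n → y^m ≤ y^n := fun m n h => pow_le_pow_right₀ hy1 h
  refine ⟨?_, by positivity, ?_, ?_, ?_, ?_, ?_, ?_⟩
  · exact le_trans (by norm_num) ((p10 2).trans (pm 2 240 (by norm_num)))
  · rw [one_div]
    apply inv_anti₀ (by norm_num)
    exact le_trans (by norm_num) ((p10 2).trans (pm 2 140 (by norm_num)))
  · rw [← div_eq_mul_inv, le_div_iff₀ (by positivity), one_mul]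
    exact pm _ _ (by norm_num)
  · rw [show y^240*((y^140)⁻¹)^3 = (y^180)⁻¹ from by field_simp, one_div]
    apply inv_anti₀ (by norm_num)
    exact le_trans (by norm_num) ((p10 3).trans (pm 3 180 (by norm_num)))
  · rw [show (y^240)^4*((y^140)⁻¹)^7 = (y^20)⁻¹ from by field_simp, one_div]
    apply inv_anti₀ (by norm_num)
    exact le_trans (by norm_num) ((p10 10).trans (pm 10 20 (by norm_num)))
  · exact le_trans (one_le_pow₀ hy1) h1
  · calc 100*D ≤ y^2*y^170 := mul_le_mul (le_trans (by norm_num) (p10 2)) h2 (le_trans (by positivity) h1) (by positivity)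
      _ = y^172 := by ring
      _ ≤ _ := pm _ _ (by norm_num)

lemma abs_le_floor {z : ℤ} {r : ℝ} (h : |(z:ℝ)| ≤ r) : |z| ≤ ((⌊r⌋₊ : ℕ) : ℤ) := by
  have : ((z.natAbs : ℕ):ℝ) ≤ r := by rw [Nat.cast_natAbs]; push_cast; exact h
  have := Nat.le_floor this
  rw [Int.abs_eq_natAbs]; exact_mod_cast this

lemma ltd_lt {y D : ℝ} {q : Qd} (hy : 10 ≤ y) (h1 : y^140 ≤ D) (h2 : D ≤ y^170) (h : LTD (y^240) D (y^140)⁻¹ q) :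
    ∃ p r : ℤ, IsCoprime p r ∧ |p| ≤ ((⌊y^38⌋₊ : ℕ) : ℤ) ∧ |r| ≤ ((⌊y^38⌋₊ : ℕ) : ℤ) ∧ |p*q.b-r*q.a| ≤ ((⌊y^16⌋₊ : ℕ) : ℤ) := by
  have hy0 : (0:ℝ) < y := by linarith
  have hy1 : (1:ℝ) ≤ y := by linarith
  obtain ⟨p, r, hc, -, hk, hpr⟩ := h
  set κ : ℝ := ((p*q.b-r*q.a : ℤ):ℝ) with hκ
  have hD0 : 0 < D := lt_of_lt_of_le (by positivity) h1
  have hk2 : κ^2 ≤ (y^16)^2 := by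
    calc κ^2 ≤ _ := hk
      _ ≤ 2*y^170*(y^140)⁻¹ := by gcongr
      _ = 2*y^30 := by field_simp
      _ ≤ y^2*y^30 := by gcongr; nlinarith
      _ = _ := by ring
  have hk1 : |κ| ≤ y^16 := abs_le_of_sq_le_sq hk2 (by positivity)
  have hpr2 : ((p:ℝ)^2+(r:ℝ)^2)^2 ≤ ((y^38)^2)^2 := by
    calc _ ≤ _ := hpr
      _ ≤ 64*((y^16)^3*y^240/y^140) := by gcongr
      _ = 64*y^148 := by field_simp
      _ ≤ y^4*y^148 := by
        gcongr
        calc (64:ℝ) ≤ 10^4 := by norm_num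
          _ ≤ _ := pow_le_pow_left₀ (by norm_num) hy 4
      _ = _ := by ring
  have hpr1 : (p:ℝ)^2+(r:ℝ)^2 ≤ (y^38)^2 := by
    have := abs_le_of_sq_le_sq hpr2 (by positivity)
    exact (le_abs_self _).trans this
  have hp2 := sq_nonneg (p:ℝ)
  have hr2 := sq_nonneg (r:ℝ)
  exact ⟨p, r, hc, abs_le_floor (abs_le_of_sq_le_sq (by linarith) (by positivity)), abs_le_floor (abs_le_of_sq_le_sq (by linarith) (by positivity)),
    abs_le_floor hk1⟩

open Classical in
lemma lt_total {y : ℝ} (hy : 10 ≤ y) (T : Finset Qd) (hT : ∀ q ∈ T, Good (y^240) q) (hd : ∀ q ∈ T, (q.a:ℝ)^2+(q.b:ℝ)^2 ≤ y^170)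
    (h : ∀ q ∈ T, ∃ p r : ℤ, IsCoprime p r ∧ |p| ≤ ((⌊y^38⌋₊ : ℕ) : ℤ) ∧ |r| ≤ ((⌊y^38⌋₊ : ℕ) : ℤ) ∧ |p*q.b-r*q.a| ≤ ((⌊y^16⌋₊ : ℕ) : ℤ)) :
    (T.card : ℝ) ≤ 90*y^140 := by
  have hy0 : (0:ℝ) < y := by linarith
  have hy1 : (1:ℝ) ≤ y := by linarith
  have := lt_count T hT ⌊y^85⌋₊ ⌊y^38⌋₊ ⌊y^16⌋₊ (Nat.le_floor (by push_cast; exact one_le_pow₀ hy1)) (by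
    intro q hq
    apply abs_le_floor
    apply abs_le_of_sq_le_sq _ (by positivity)
    have := hd q hq
    have h2 := sq_nonneg (q.b:ℝ)
    calc (q.a:ℝ)^2 ≤ y^170 := by linarith
      _ = _ := by ring) h
  have f1 : ((⌊y^85⌋₊:ℕ):ℝ) ≤ y^85 := Nat.floor_le (by positivity)
  have f2 : ((⌊y^38⌋₊:ℕ):ℝ) ≤ y^38 := Nat.floor_le (by positivity)
  have f3 : ((⌊y^16⌋₊:ℕ):ℝ) ≤ y^16 := Nat.floor_le (by positivity)
  calc (T.card : ℝ) ≤ ((2*(⌊y^38⌋₊ * (9*⌊y^16⌋₊*(2*⌊y^85⌋₊+3*⌊y^38⌋₊))) : ℕ):ℝ) := by exact_mod_cast this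
    _ = 2*(((⌊y^38⌋₊:ℕ):ℝ)*(9*((⌊y^16⌋₊:ℕ):ℝ)*(2*((⌊y^85⌋₊:ℕ):ℝ)+3*((⌊y^38⌋₊:ℕ):ℝ)))) := by push_cast; ring
    _ ≤ 2*(y^38*(9*y^16*(2*y^85+3*y^85))) := by
      gcongr
      exact f2.trans (pow_le_pow_right₀ hy1 (by norm_num))
    _ = 90*y^139 := by ring
    _ ≤ _ := by gcongr; norm_num


lemma fiber_bound (δ : ℝ) (hδ : 0 < δ) : ∃ C2 : ℝ, 0 ≤ C2 ∧ ∀ (y D : ℝ) (S : Finset Qd), 10 ≤ y → y^140 ≤ D → D ≤ y^170 →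
    Cls (y^240) D (y^140)⁻¹ S → (∀ q ∈ S, ¬ LTD (y^240) D (y^140)⁻¹ q) → (S.card : ℝ) ≤ C2 * (y^240)^(6*δ) := by
  obtain ⟨C1, hC1, hdiv⟩ := divisor_bound (δ/73) (by positivity)
  obtain ⟨J, hJ⟩ := exists_nat_ge (1/δ)
  refine ⟨4+9^J*(16*10^13+1)*(2*C1)^2, by positivity, ?_⟩
  intro y D S hy h1 h2 hC hn
  have hP := par_y hy h1 h2
  have hy0 : (0:ℝ) < y := by linarith
  have hy1 : (1:ℝ) ≤ y := by linarith
  set x := y^240 with hx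
  have hx0 : 0 < x := by positivity
  have hx1 : 1 ≤ x := one_le_pow₀ hy1
  have hxδ : 1 ≤ x^δ := Real.one_le_rpow hx1 hδ.le
  have hZ0 : 0 < ⌈x^δ⌉₊ := Nat.ceil_pos.2 (by positivity)
  have hZ2 : ((⌈x^δ⌉₊ : ℕ):ℝ) ≤ 2*x^δ := by
    have := Nat.ceil_lt_add_one (show 0 ≤ x^δ by positivity)
    linarith
  have hZJ : 2*D*(y^140)⁻¹ ≤ ((⌈x^δ⌉₊ : ℕ):ℝ)^J := by
    calc 2*D*(y^140)⁻¹ ≤ 2*y^170*(y^140)⁻¹ := by gcongr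
      _ = 2*y^30 := by field_simp
      _ ≤ y*y^30 := by gcongr; linarith
      _ = y^31 := by ring
      _ ≤ x := pow_le_pow_right₀ hy1 (by norm_num)
      _ = x^(1:ℝ) := (Real.rpow_one x).symm
      _ ≤ x^(δ*J) := by
        apply Real.rpow_le_rpow_of_exponent_le hx1
        rw [div_le_iff₀ hδ] at hJ; linarith
      _ = (x^δ)^J := by rw [Real.rpow_mul hx0.le, Real.rpow_natCast]
      _ ≤ _ := pow_le_pow_left₀ (by positivity) (Nat.le_ceil _) J
  have hbound : 8*((6*x^3)^6)^4 ≤ x^73 := by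
    have : (8*6^24:ℝ) ≤ x := by
      calc (8*6^24:ℝ) ≤ 10^240 := by norm_num
        _ ≤ _ := pow_le_pow_left₀ (by norm_num) hy 240
    calc 8*((6*x^3)^6)^4 = (8*6^24)*x^72 := by ring
      _ ≤ x*x^72 := by gcongr
      _ = _ := by ring
  have hcb := class_bound hP hC hn ⌈x^δ⌉₊ J hZ0 hZJ ⌊C1*x^δ⌋₊ (by
    intro N hN0 hN
    apply Nat.le_floor
    refine (hdiv N hN0).trans ?_
    gcongr
    calc (N:ℝ)^(δ/73) ≤ (x^73)^(δ/73) := Real.rpow_le_rpow (by positivity) (hN.trans hbound) (by positivity)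
      _ = x^δ := by
        rw [← Real.rpow_natCast, ← Real.rpow_mul hx0.le]; congr 1; push_cast; field_simp)
  have hDv : ((⌊C1*x^δ⌋₊ : ℕ):ℝ) ≤ C1*x^δ := Nat.floor_le (by positivity)
  have e6 : x^(6*δ) = (x^δ)^6 := by
    rw [← Real.rpow_natCast, ← Real.rpow_mul hx0.le]; congr 1; push_cast; ring
  rw [e6]
  set w := x^δ with hw
  set Z : ℝ := ((⌈w⌉₊ : ℕ):ℝ) with hZ
  set V : ℝ := ((⌊C1*w⌋₊ : ℕ):ℝ) with hV
  calc (S.card:ℝ) ≤ ((4 + 9^J*(10^13*⌈w⌉₊^4+1) * (2*⌊C1*w⌋₊) * (2*⌊C1*w⌋₊) : ℕ):ℝ) := by exact_mod_cast hcb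
    _ = 4 + 9^J*(10^13*Z^4+1)*(2*V)*(2*V) := by push_cast; ring
    _ ≤ 4 + 9^J*(10^13*(2*w)^4+1)*(2*(C1*w))*(2*(C1*w)) := by gcongr
    _ = 4 + 9^J*(16*10^13*w^4+1)*(2*C1)^2*w^2 := by ring
    _ ≤ 4*w^6 + 9^J*(16*10^13*w^4+w^4)*(2*C1)^2*w^2 := by
      gcongr
      · have : 1 ≤ w^6 := one_le_pow₀ hxδ
        linarith
      · exact one_le_pow₀ hxδ
    _ = _ := by ring

open Classical in
set_option maxHeartbeats 1000000 in
lemma mid_non (δ : ℝ) (hδ : 0 < δ) : ∃ C : ℝ, 0 ≤ C ∧ ∀ (y : ℝ) (S : Finset Qd), 10 ≤ y → (∀ q ∈ S, Good (y^240) q) → 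
    (∀ q ∈ S, y^140 ≤ (q.a:ℝ)^2+(q.b:ℝ)^2) → (∀ q ∈ S, (q.a:ℝ)^2+(q.b:ℝ)^2 ≤ y^170) → 
    (∀ q ∈ S, ∀ D : ℝ, y^140 ≤ D → D ≤ y^170 → ¬ LTD (y^240) D (y^140)⁻¹ q) → 
    (S.card : ℝ) ≤ C * (y^240)^(7*δ) * y^140 := by
  obtain ⟨C2, hC2, hfib⟩ := fiber_bound δ hδ
  refine ⟨C2*(2/δ+1)*5, by positivity, ?_⟩
  intro y S hy hg hlo hhi hn
  have hy0 : (0:ℝ) < y := by linarith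
  have hy1 : (1:ℝ) ≤ y := by linarith
  set x := y^240 with hx
  have hx0 : 0 < x := by positivity
  have hx1 : 1 ≤ x := one_le_pow₀ hy1
  have hxδ : 1 ≤ x^δ := Real.one_le_rpow hx1 hδ.le
  set k : Qd → ℕ := fun q => Nat.log 2 ⌊((q.a:ℝ)^2+(q.b:ℝ)^2)/y^140⌋₊ with hk
  set f : Qd → ℤ := fun q => ⌊((q.b:ℝ)/q.a)*y^140⌋ with hf
  have hk1 : ∀ q ∈ S, (2:ℝ)^(k q)*y^140 ≤ (q.a:ℝ)^2+(q.b:ℝ)^2 ∧ (q.a:ℝ)^2+(q.b:ℝ)^2 < 2*((2:ℝ)^(k q)*y^140) := by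
    intro q hq
    have hl := hlo q hq
    set d := (q.a:ℝ)^2+(q.b:ℝ)^2 with hd
    have h1 : 1 ≤ d/y^140 := by rw [le_div_iff₀ (by positivity), one_mul]; exact hl
    have hfl : ⌊d/y^140⌋₊ ≠ 0 := by
      have : 1 ≤ ⌊d/y^140⌋₊ := Nat.le_floor (by simpa using h1)
      omega
    have h2 : 2^(k q) ≤ ⌊d/y^140⌋₊ := Nat.pow_log_le_self 2 hfl
    have h3 : ⌊d/y^140⌋₊ < 2^(k q + 1) := Nat.lt_pow_succ_log_self (by norm_num) _
    constructor
    · rw [← le_div_iff₀ (by positivity)]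
      calc (2:ℝ)^(k q) ≤ ((⌊d/y^140⌋₊:ℕ):ℝ) := by exact_mod_cast h2
        _ ≤ _ := Nat.floor_le (by positivity)
    · rw [← mul_assoc, ← div_lt_iff₀ (by positivity)]
      calc d/y^140 < ((⌊d/y^140⌋₊:ℕ):ℝ)+1 := Nat.lt_floor_add_one _
        _ ≤ (2:ℝ)^(k q+1) := by exact_mod_cast h3
        _ = _ := by ring
  have hkL : ∀ q ∈ S, k q ∈ Finset.range (⌊2*Real.log x⌋₊+1) := by
    intro q hq
    rw [Finset.mem_range, Nat.lt_succ_iff]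
    apply Nat.le_floor
    have h1 : (2:ℝ)^(k q) ≤ x := by
      have h2 := (hk1 q hq).1
      have h3 : (1:ℝ) ≤ y^140 := one_le_pow₀ hy1
      calc (2:ℝ)^(k q) ≤ (2:ℝ)^(k q)*y^140 := le_mul_of_one_le_right (by positivity) h3
        _ ≤ _ := h2
        _ ≤ _ := hhi q hq
        _ ≤ x := pow_le_pow_right₀ hy1 (by norm_num)
    have h2 := Real.log_le_log (by positivity) h1
    rw [Real.log_pow] at h2
    have h3 := Real.log_two_gt_d9
    have : (0:ℝ) ≤ k q := by positivity
    nlinarith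
  have hfW : ∀ q ∈ S, f q ∈ Finset.Icc (-((⌈y^140⌉₊:ℕ):ℤ)) ((⌈y^140⌉₊:ℕ):ℤ) := by
    intro q hq
    have ha : (0:ℝ) < q.a := by exact_mod_cast (hg q hq).apos
    have hab : |(q.b:ℝ)| ≤ q.a := by exact_mod_cast (hg q hq).hab
    have hab := abs_le.1 hab
    have hc := Nat.le_ceil (y^140)
    have h1 : (q.b:ℝ)/q.a ≤ 1 := by rw [div_le_one ha]; exact hab.2
    have h2 : -1 ≤ (q.b:ℝ)/q.a := by rw [le_div_iff₀ ha]; linarith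
    have hp : (0:ℝ) < y^140 := by positivity
    rw [Finset.mem_Icc]
    constructor
    · apply Int.le_floor.2
      push_cast
      nlinarith
    · have : (f q:ℝ) ≤ ((⌈y^140⌉₊:ℕ):ℝ) := by
        refine (Int.floor_le _).trans ?_
        nlinarith
      exact_mod_cast this
  have hfibN : ∀ c ∈ S.image (fun q => (k q, f q)), (S.filter (fun q => (k q, f q) = c)).card ≤ ⌊C2*x^(6*δ)⌋₊ := by
    rintro ⟨k0, f0⟩ hc
    rw [Finset.mem_image] at hc
    obtain ⟨q0, hq0, e0⟩ := hc
    rw [Prod.mk.injEq] at e0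
    have hmem : ∀ q ∈ S.filter (fun q => (k q, f q) = (k0, f0)), q ∈ S ∧ k q = k0 ∧ f q = f0 := by
      intro q hq
      rw [Finset.mem_filter, Prod.mk.injEq] at hq
      exact hq
    have hD1 : y^140 ≤ (2:ℝ)^k0*y^140 := le_mul_of_one_le_left (by positivity) (one_le_pow₀ (by norm_num))
    have hD2 : (2:ℝ)^k0*y^140 ≤ y^170 := by
      have := (hk1 q0 hq0).1
      rw [e0.1] at this
      exact this.trans (hhi q0 hq0)
    apply Nat.le_floor
    refine hfib y ((2:ℝ)^k0*y^140) _ hy hD1 hD2 ⟨fun q hq => hg q (hmem q hq).1, ?_, ?_, ?_⟩ (fun q hq => hn q (hmem q hq).1 _ hD1 hD2)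
    · intro q hq
      obtain ⟨h1, h2, h3⟩ := hmem q hq
      rw [← h2]; exact (hk1 q h1).1
    · intro q hq
      obtain ⟨h1, h2, h3⟩ := hmem q hq
      rw [← h2]; exact (hk1 q h1).2
    · intro q hq q' hq'
      obtain ⟨h1, h2, h3⟩ := hmem q hq
      obtain ⟨h1', h2', h3'⟩ := hmem q' hq'
      have := Int.abs_sub_lt_one_of_floor_eq_floor (h3.trans h3'.symm)
      rw [← sub_mul, abs_mul, abs_of_pos (show (0:ℝ) < y^140 by positivity), ← lt_div_iff₀ (by positivity), one_div] at this
      exact this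
  have hmain := Finset.card_le_mul_card_image (f := fun q => (k q, f q)) S _ hfibN
  have himg : (S.image (fun q => (k q, f q))).card ≤ (⌊2*Real.log x⌋₊+1)*(2*⌈y^140⌉₊+1) := by
    have : S.image (fun q => (k q, f q)) ⊆ Finset.range (⌊2*Real.log x⌋₊+1) ×ˢ Finset.Icc (-((⌈y^140⌉₊:ℕ):ℤ)) ((⌈y^140⌉₊:ℕ):ℤ) := by
      intro c hc
      rw [Finset.mem_image] at hc
      obtain ⟨q, hq, rfl⟩ := hc
      rw [Finset.mem_product]
      exact ⟨hkL q hq, hfW q hq⟩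
    refine (Finset.card_le_card this).trans (le_of_eq ?_)
    rw [Finset.card_product, Finset.card_range, Int.card_Icc]
    congr 1; omega
  have hlog0 : 0 ≤ Real.log x := Real.log_nonneg hx1
  have a1 : ((⌊C2*x^(6*δ)⌋₊:ℕ):ℝ) ≤ C2*x^(6*δ) := Nat.floor_le (by positivity)
  have a2 : ((⌊2*Real.log x⌋₊:ℕ):ℝ) ≤ 2*Real.log x := Nat.floor_le (by positivity)
  have a3 : ((⌈y^140⌉₊:ℕ):ℝ) ≤ 2*y^140 := by
    have := Nat.ceil_lt_add_one (show 0 ≤ y^140 by positivity)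
    have h3 : (1:ℝ) ≤ y^140 := one_le_pow₀ hy1
    linarith
  have a4 : Real.log x ≤ x^δ/δ := Real.log_le_rpow_div hx0.le hδ
  have e7 : x^(7*δ) = x^(6*δ)*x^δ := by rw [← Real.rpow_add hx0]; congr 1; ring
  calc (S.card:ℝ) ≤ ((⌊C2*x^(6*δ)⌋₊ * ((⌊2*Real.log x⌋₊+1)*(2*⌈y^140⌉₊+1)) : ℕ):ℝ) := by
        exact_mod_cast hmain.trans (Nat.mul_le_mul_left _ himg)
    _ = ((⌊C2*x^(6*δ)⌋₊:ℕ):ℝ)*((((⌊2*Real.log x⌋₊:ℕ):ℝ)+1)*(2*((⌈y^140⌉₊:ℕ):ℝ)+1)) := by push_cast; ring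
    _ ≤ (C2*x^(6*δ))*((2*(x^δ/δ)+x^δ)*(2*(2*y^140)+y^140)) := by
      gcongr
      · linarith
      · exact one_le_pow₀ hy1
    _ = _ := by rw [e7]; field_simp; ring


open Classical in
lemma quads_bound (ε : ℝ) (hε : 0 < ε) : ∃ C : ℝ, 0 ≤ C ∧ ∀ (x : ℝ) (S : Finset Qd), 10^240 ≤ x → (∀ q ∈ S, Good x q) → 
    (S.card : ℝ) ≤ C * x ^ (7/12+ε : ℝ) := by
  obtain ⟨C, hC, hmid⟩ := mid_non (ε/7) (by positivity)
  refine ⟨9+2000+90+C, by positivity, ?_⟩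
  intro x S hx hg
  have hx1 : 1 ≤ x := le_trans (by norm_num) hx
  have hx0 : 0 < x := by linarith
  have hx2 : 2 ≤ x := le_trans (by norm_num) hx
  set y := x^((1:ℝ)/240) with hy
  have hxy : x = y^240 := by
    rw [hy, ← Real.rpow_natCast, ← Real.rpow_mul hx0.le]; norm_num
  have hy10 : 10 ≤ y := by
    have : ((10:ℝ)^240)^((1:ℝ)/240) ≤ y := Real.rpow_le_rpow (by positivity) hx (by norm_num)
    rwa [← Real.rpow_natCast, ← Real.rpow_mul (by norm_num), show (((240:ℕ):ℝ)*((1:ℝ)/240)) = 1 from by norm_num, Real.rpow_one] at this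
  have h140 : x^((7:ℝ)/12) = y^140 := by
    rw [hy, ← Real.rpow_natCast, ← Real.rpow_mul hx0.le]; norm_num
  have h170 : x^((17:ℝ)/24) = y^170 := by
    rw [hy, ← Real.rpow_natCast, ← Real.rpow_mul hx0.le]; norm_num
  have hcast : ∀ q : Qd, ((q.a^2+q.b^2 : ℤ):ℝ) = (q.a:ℝ)^2+(q.b:ℝ)^2 := by intro q; push_cast; ring
  set P1 : Qd → Prop := fun q => (q.a:ℝ)^2+(q.b:ℝ)^2 ≤ y^140 with hP1
  set P3 : Qd → Prop := fun q => y^170 ≤ (q.a:ℝ)^2+(q.b:ℝ)^2 with hP3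
  set PL : Qd → Prop := fun q => ∃ p r : ℤ, IsCoprime p r ∧ |p| ≤ ((⌊y^38⌋₊ : ℕ) : ℤ) ∧ |r| ≤ ((⌊y^38⌋₊ : ℕ) : ℤ) ∧ |p*q.b-r*q.a| ≤ ((⌊y^16⌋₊ : ℕ) : ℤ) with hPL
  set S1 := S.filter P1 with hS1
  set T1 := S.filter (fun q => ¬ P1 q) with hT1
  set S3 := T1.filter P3 with hS3
  set T3 := T1.filter (fun q => ¬ P3 q) with hT3
  set SL := T3.filter PL with hSL
  set TL := T3.filter (fun q => ¬ PL q) with hTL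
  have c1 : S1.card + T1.card = S.card := Finset.card_filter_add_card_filter_not _
  have c2 : S3.card + T3.card = T1.card := Finset.card_filter_add_card_filter_not _
  have c3 : SL.card + TL.card = T3.card := Finset.card_filter_add_card_filter_not _
  have m1 : ∀ q ∈ T1, q ∈ S := fun q hq => (Finset.mem_filter.1 hq).1
  have m3 : ∀ q ∈ T3, q ∈ S := fun q hq => m1 q (Finset.mem_filter.1 hq).1
  have l3 : ∀ q ∈ T3, y^140 ≤ (q.a:ℝ)^2+(q.b:ℝ)^2 := fun q hq => (not_le.1 (Finset.mem_filter.1 (Finset.mem_filter.1 hq).1).2).le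
  have u3 : ∀ q ∈ T3, (q.a:ℝ)^2+(q.b:ℝ)^2 ≤ y^170 := fun q hq => (not_le.1 (Finset.mem_filter.1 hq).2).le
  have b1 := range1 hx2 S1 (fun q hq => hg q (Finset.mem_filter.1 hq).1) (fun q hq => by
    rw [h140, hcast]; exact (Finset.mem_filter.1 hq).2)
  have b3 := range3 hx2 S3 (fun q hq => hg q (m1 q (Finset.mem_filter.1 hq).1)) (fun q hq => by
    rw [h170, hcast]; exact (Finset.mem_filter.1 hq).2)
  have hg' : ∀ q ∈ S, Good (y^240) q := by rw [← hxy]; exact hg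
  have bL := lt_total hy10 SL (fun q hq => hg' q (m3 q (Finset.mem_filter.1 hq).1)) (fun q hq => u3 q (Finset.mem_filter.1 hq).1)
    (fun q hq => (Finset.mem_filter.1 hq).2)
  have bT := hmid y TL hy10 (fun q hq => hg' q (m3 q (Finset.mem_filter.1 hq).1)) (fun q hq => l3 q (Finset.mem_filter.1 hq).1)
    (fun q hq => u3 q (Finset.mem_filter.1 hq).1) (fun q hq D h1 h2 h => (Finset.mem_filter.1 hq).2 (ltd_lt hy10 h1 h2 h))
  rw [← hxy, ← h140, show 7*(ε/7) = ε from by ring] at bT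
  rw [← h140] at bL
  have e : x^(7/12+ε:ℝ) = x^ε * x^((7:ℝ)/12) := by rw [← Real.rpow_add hx0, add_comm]
  have hε1 : 1 ≤ x^ε := Real.one_le_rpow hx1 hε.le
  have hle : x^((7:ℝ)/12) ≤ x^ε * x^((7:ℝ)/12) := le_mul_of_one_le_left (by positivity) hε1
  have hs : (S.card:ℝ) = S1.card+(S3.card+(SL.card+TL.card)) := by
    rw [← c1, ← c2, ← c3]; push_cast; ring
  rw [hs, e]
  linarith

lemma pair_bd {d n : ℕ} (h : d^2 ∣ n^2+1) : d ≤ n^2+1 := by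
  have h1 := Nat.le_of_dvd (by positivity) h
  nlinarith [Nat.zero_le d, sq_nonneg d, Nat.le_self_pow (show 2 ≠ 0 by norm_num) d]

theorem tail_square_divisor_count (ε : ℝ) (hε : 0 < ε) :
    ∃ C : ℝ, ∀ x : ℝ, 2 ≤ x →
      (Nat.card {p : ℕ × ℕ | x ^ ((1 : ℝ) / 2) < (p.1 : ℝ) ∧
          x < (p.2 : ℝ) ∧ (p.2 : ℝ) ≤ 2 * x ∧
          p.1 ^ 2 ∣ p.2 ^ 2 + 1} : ℝ) ≤ C * x ^ (7 / 12 + ε : ℝ) := by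
  classical
  obtain ⟨C, hC, hq⟩ := quads_bound ε hε
  set N0 : ℕ := 2*10^240 with hN0
  refine ⟨C + ((N0^2+2)*(N0+1) : ℕ), ?_⟩
  intro x hx
  set A : Set (ℕ × ℕ) := {p : ℕ × ℕ | x ^ ((1 : ℝ) / 2) < (p.1 : ℝ) ∧ x < (p.2 : ℝ) ∧ (p.2 : ℝ) ≤ 2 * x ∧ p.1 ^ 2 ∣ p.2 ^ 2 + 1} with hA
  have hx0 : 0 < x := by linarith
  have hpow : 1 ≤ x ^ (7 / 12 + ε : ℝ) := Real.one_le_rpow (by linarith) (by positivity)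
  have hsub : ∀ N : ℕ, 2*x ≤ N → A ⊆ ((Finset.range (N^2+2) ×ˢ Finset.range (N+1) : Finset (ℕ × ℕ)) : Set (ℕ × ℕ)) := by
    rintro N hN ⟨d, n⟩ ⟨-, -, h3, h4⟩
    simp only at h3 h4
    have hn : n ≤ N := by exact_mod_cast h3.trans hN
    have hd := pair_bd h4
    have : n^2 ≤ N^2 := Nat.pow_le_pow_left hn 2
    simp only [Finset.coe_product, Set.mem_prod, Finset.mem_coe, Finset.mem_range]
    constructor <;> omega
  obtain ⟨N1, hN1⟩ := exists_nat_ge (2*x)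
  have hfin : A.Finite := (Finset.finite_toSet _).subset (hsub N1 hN1)
  have hcard : Nat.card A = A.ncard := rfl
  rw [hcard]
  rcases le_or_gt ((10:ℝ)^240) x with hbig | hsmall
  · have hex : ∀ p : ℕ × ℕ, ∃ q : Qd, p ∈ A → Good x q ∧ ((q.a^2-q.b^2)*q.u-2*q.a*q.b*q.v : ℤ) = p.2 ∧ (p.1:ℤ) = q.a^2+q.b^2 := by
      rintro ⟨d, n⟩
      by_cases h : (d, n) ∈ A
      · obtain ⟨h1, h2, h3, h4⟩ := h
        simp only at h1 h2 h3 h4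
        obtain ⟨a, b, u, v, g1, g2, g3, g4, g5⟩ := gauss_param' d n h4
        refine ⟨⟨a, b, u, v⟩, fun _ => ⟨⟨g1, g2, g3, ?_, ?_, ?_⟩, g4, g5⟩⟩
        · simp only; rw [g4]; exact_mod_cast h2
        · simp only; rw [g4]; exact_mod_cast h3
        · simp only; rw [← g5]; push_cast
          rw [← Real.sqrt_eq_rpow] at h1
          exact (Real.sqrt_lt' (lt_of_le_of_lt (Real.sqrt_nonneg _) h1)).1 h1
      · exact ⟨⟨0,0,0,0⟩, fun h' => absurd h' h⟩
    choose F hF using hex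
    have hS := hq x (hfin.toFinset.image F) hbig (by
      intro q hq
      rw [Finset.mem_image] at hq
      obtain ⟨p, hp, rfl⟩ := hq
      exact (hF p (hfin.mem_toFinset.1 hp)).1)
    rw [Finset.card_image_of_injOn (by
      intro p hp p' hp' e
      have h1 := hF p (hfin.mem_toFinset.1 hp)
      have h2 := hF p' (hfin.mem_toFinset.1 hp')
      rw [← show F p = F p' from e] at h2
      apply Prod.ext
      · have := h1.2.2.trans h2.2.2.symm; exact_mod_cast this
      · have := h1.2.1.symm.trans h2.2.1; exact_mod_cast this), ← Set.ncard_eq_toFinset_card A hfin] at hS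
    refine hS.trans ?_
    gcongr
    have : (0:ℝ) ≤ (((N0^2+2)*(N0+1) : ℕ):ℝ) := Nat.cast_nonneg _
    linarith
  · have h1 := hsub N0 (by rw [hN0]; push_cast; linarith)
    have h2 := Set.ncard_le_ncard h1 (Finset.finite_toSet _)
    rw [Set.ncard_coe_finset, Finset.card_product, Finset.card_range, Finset.card_range] at h2
    have h3 : (A.ncard:ℝ) ≤ (((N0^2+2)*(N0+1) : ℕ):ℝ) := Nat.cast_le.2 h2
    have h4 : (0:ℝ) ≤ (((N0^2+2)*(N0+1) : ℕ):ℝ) := Nat.cast_nonneg _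
    calc (A.ncard:ℝ) ≤ C + (((N0^2+2)*(N0+1) : ℕ):ℝ) := by linarith
      _ ≤ _ := le_mul_of_one_le_right (by linarith) hpow
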